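/- arXiv:1004.3376 — 4 statements merged into one kernel-verified Lean document; each statement's English description precedes it below -/
import Mathlib

section
/- Let Δ be a (d−1)-dimensional simplicial complex on [n] which satisfies Serre's condition S_r (r ≥ 2) over a field k. Then for every face F ∈ Δ, the link lk_Δ F also satisfies Serre's condition S_r over k. -/
open MvPolynomial

namespace SeqSr

/-! ### Abstract simplicial complexes -/

/-- An abstract simplicial complex on the vertex set `V`, viewed as a set of finite
subsets of `V` (its faces) closed under taking subsets. -/
def IsComplex {V : Type*} (Δ : Set (Finset V)) : Prop :=
  ∀ F ∈ Δ, ∀ G : Finset V, G ⊆ F → G ∈ Δ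

/-- `Δ` is `(d-1)`-dimensional: every face has at most `d` vertices and
some face has exactly `d` vertices. -/
def HasDim {V : Type*} (Δ : Set (Finset V)) (d : ℕ) : Prop :=
  (∀ F ∈ Δ, F.card ≤ d) ∧ ∃ F ∈ Δ, F.card = d

/-- A facet is a maximal face. -/
def IsFacet {V : Type*} (Δ : Set (Finset V)) (F : Finset V) : Prop :=
  F ∈ Δ ∧ ∀ G ∈ Δ, F ⊆ G → F = G

/-- A simplicial complex is pure if all facets have the same number of vertices. -/
def IsPure {V : Type*} (Δ : Set (Finset V)) : Prop :=
  ∀ F G : Finset V, IsFacet Δ F → IsFacet Δ G → F.card = G.card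

/-- The link of a face `F` of `Δ`:
`lk_Δ F = {G : F ∩ G = ∅ and F ∪ G ∈ Δ}`. -/
def link {V : Type*} [DecidableEq V] (Δ : Set (Finset V)) (F : Finset V) :
    Set (Finset V) :=
  {G | F ∩ G = ∅ ∧ F ∪ G ∈ Δ}

/-- The `i`-skeleton of `Δ`: all faces of dimension at most `i`
(i.e. with at most `i + 1` vertices). -/
def skeleton {V : Type*} (Δ : Set (Finset V)) (i : ℕ) : Set (Finset V) :=
  {F ∈ Δ | F.card ≤ i + 1}

/-- The pure `i`-skeleton of `Δ`: the subcomplex generated by the `i`-dimensional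
faces of `Δ` (here `i : ℤ`, so that `i = -1` makes sense). -/
def pureSkeleton {V : Type*} (Δ : Set (Finset V)) (i : ℤ) : Set (Finset V) :=
  {F | ∃ G ∈ Δ, (G.card : ℤ) = i + 1 ∧ F ⊆ G}

/-- A simplicial complex is connected if any two of its vertices can be joined by a
path of `1`-dimensional faces. -/
def IsConnectedComplex {V : Type*} [DecidableEq V] (Δ : Set (Finset V)) : Prop :=
  ∀ x y : V, {x} ∈ Δ → {y} ∈ Δ →
    Relation.ReflTransGen (fun a b : V => ({a, b} : Finset V) ∈ Δ) x y

/-! ### Stanley-Reisner rings -/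

/-- The Stanley-Reisner ideal of `Δ` in the polynomial ring `k[x_v : v ∈ V]`:
the ideal generated by the squarefree monomials corresponding to non-faces of `Δ`. -/
noncomputable def srIdeal (k : Type*) [Field k] {V : Type*} (Δ : Set (Finset V)) :
    Ideal (MvPolynomial V k) :=
  Ideal.span {m | ∃ F : Finset V, F ∉ Δ ∧ m = ∏ i ∈ F, X i}

/-! ### Depth, dimension and Serre's condition for modules -/

/-- The depth of `M` with respect to the ideal `I`: the supremum of the lengths of
`M`-regular sequences consisting of elements of `I`.  (For a finitely generated
module over a Noetherian local ring, taking `I` to be the maximal ideal recovers the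
usual depth.) -/
noncomputable def depthIn (A : Type*) [CommRing A] (I : Ideal A) (M : Type*)
    [AddCommGroup M] [Module A M] : ℕ∞ :=
  sSup {n : ℕ∞ | ∃ rs : List A, (∀ x ∈ rs, x ∈ I) ∧
    RingTheory.Sequence.IsRegular M rs ∧ (rs.length : ℕ∞) = n}

/-- The (Krull) dimension of a module `M` over `A`: the Krull dimension of the ring
`A` modulo the annihilator of `M`. -/
noncomputable def mDim (A : Type*) [CommRing A] (M : Type*)
    [AddCommGroup M] [Module A M] : WithBot ℕ∞ :=
  ringKrullDim (A ⧸ Module.annihilator A M)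

/-- Serre's condition `S_r` for a module `M` over `A`: for every prime ideal `p`,
`depth M_p ≥ min (r, dim M_p)`. -/
def IsSerreMod (r : ℕ) (A : Type*) [CommRing A] (M : Type*)
    [AddCommGroup M] [Module A M] : Prop :=
  ∀ (p : Ideal A) [p.IsPrime],
    min ((r : ℕ∞) : WithBot ℕ∞)
        (mDim (Localization p.primeCompl) (LocalizedModule p.primeCompl M)) ≤
      ((depthIn (Localization p.primeCompl)
          (Ideal.map (algebraMap A (Localization p.primeCompl)) p)
          (LocalizedModule p.primeCompl M) : ℕ∞) : WithBot ℕ∞)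

/-- A module `M` over `A` is Cohen-Macaulay if `depth M_p ≥ dim M_p` for every
prime ideal `p` (the reverse inequality being automatic). -/
def IsCMMod (A : Type*) [CommRing A] (M : Type*) [AddCommGroup M] [Module A M] : Prop :=
  ∀ (p : Ideal A) [p.IsPrime],
    mDim (Localization p.primeCompl) (LocalizedModule p.primeCompl M) ≤
      ((depthIn (Localization p.primeCompl)
          (Ideal.map (algebraMap A (Localization p.primeCompl)) p)
          (LocalizedModule p.primeCompl M) : ℕ∞) : WithBot ℕ∞)

/-- `Δ` satisfies Serre's condition `S_r` over `k` if its Stanley-Reisner ring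
`k[Δ]` does, as a module over the polynomial ring. -/
def IsSerreComplex (k : Type*) [Field k] {V : Type*} (Δ : Set (Finset V)) (r : ℕ) :
    Prop :=
  IsSerreMod r (MvPolynomial V k) (MvPolynomial V k ⧸ srIdeal k Δ)

/-! ### Sequentially `S_r` and sequentially Cohen-Macaulay complexes -/

/-- A homogeneous ideal of the polynomial ring (with respect to the standard
grading): an ideal containing all homogeneous components of its elements. -/
def IsHomogeneousIdeal (k : Type*) [Field k] {V : Type*}
    (J : Ideal (MvPolynomial V k)) : Prop :=
  ∀ f ∈ J, ∀ i : ℕ, homogeneousComponent i f ∈ J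

/-- For ideals `J ⊆ J'` of `A`, the subquotient `J'/J` as an `A`-module. -/
abbrev subquot {A : Type*} [CommRing A] (J J' : Ideal A) : Type _ :=
  ↥J' ⧸ Submodule.comap J'.subtype J

/-- `Δ` is sequentially `S_r` over `k`: there is a finite filtration
`0 = M_0 ⊂ M_1 ⊂ ⋯ ⊂ M_t = k[Δ]` of `k[Δ]` by graded submodules such that each
quotient `M_i/M_{i-1}` satisfies Serre's condition `S_r` and the (Krull) dimensions
of the quotients are strictly increasing.  Since `k[Δ]` is a cyclic module generated
in degree `0`, its graded submodules are exactly the images of homogeneous ideals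
`J ⊇ I_Δ`, and `M_i/M_{i-1} = J_i/J_{i-1}`; we state the definition this way. -/
def IsSeqSerre (k : Type*) [Field k] {V : Type*} (Δ : Set (Finset V)) (r : ℕ) : Prop :=
  ∃ (t : ℕ) (J : ℕ → Ideal (MvPolynomial V k)),
    J 0 = srIdeal k Δ ∧ J t = ⊤ ∧
    (∀ i ≤ t, IsHomogeneousIdeal k (J i)) ∧
    (∀ i < t, J i < J (i + 1)) ∧
    (∀ i < t, IsSerreMod r (MvPolynomial V k) (subquot (J i) (J (i + 1)))) ∧
    (∀ i : ℕ, i + 2 ≤ t →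
      mDim (MvPolynomial V k) (subquot (J i) (J (i + 1))) <
        mDim (MvPolynomial V k) (subquot (J (i + 1)) (J (i + 2))))

/-- `Δ` is sequentially Cohen-Macaulay over `k`: there is a finite filtration
`0 = M_0 ⊂ M_1 ⊂ ⋯ ⊂ M_t = k[Δ]` by graded submodules with Cohen-Macaulay
quotients of strictly increasing dimensions. -/
def IsSeqCM (k : Type*) [Field k] {V : Type*} (Δ : Set (Finset V)) : Prop :=
  ∃ (t : ℕ) (J : ℕ → Ideal (MvPolynomial V k)),
    J 0 = srIdeal k Δ ∧ J t = ⊤ ∧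
    (∀ i ≤ t, IsHomogeneousIdeal k (J i)) ∧
    (∀ i < t, J i < J (i + 1)) ∧
    (∀ i < t, IsCMMod (MvPolynomial V k) (subquot (J i) (J (i + 1)))) ∧
    (∀ i : ℕ, i + 2 ≤ t →
      mDim (MvPolynomial V k) (subquot (J i) (J (i + 1))) <
        mDim (MvPolynomial V k) (subquot (J (i + 1)) (J (i + 2))))

/-! ### Graphs -/

/-- The independence complex of a graph `G`: faces are the independent sets. -/
def indepComplex {V : Type*} (G : SimpleGraph V) : Set (Finset V) :=
  {F | ∀ x ∈ F, ∀ y ∈ F, ¬ G.Adj x y}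

section Depth

open RingTheory.Sequence IsLocalRing CategoryTheory CategoryTheory.Abelian
open scoped TensorProduct

universe u

lemma exists_isRegular_quotSMulTop {R M : Type u} [CommRing R] [IsNoetherianRing R]
    [IsLocalRing R] [AddCommGroup M] [Module R M] [Module.Finite R M] {a : R}
    (ha : a ∈ maximalIdeal R) (hreg : IsSMulRegular M a) {rs : List R}
    (mem : ∀ x ∈ rs, x ∈ maximalIdeal R) (reg : IsRegular M rs) {n : ℕ}
    (len : rs.length = n + 1) :
    ∃ rs' : List R, rs'.length = n ∧ (∀ x ∈ rs', x ∈ maximalIdeal R) ∧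
      IsRegular (QuotSMulTop a M) rs' := by
  have : Nontrivial M := reg.nontrivial
  have : Nontrivial (QuotSMulTop a M) := nontrivial_quotSMulTop_of_mem_maximalIdeal M ha
  have lt_top (N : Type u) [AddCommGroup N] [Module R N] [Module.Finite R N] [Nontrivial N] :
      maximalIdeal R • (⊤ : Submodule R N) < ⊤ :=
    (Submodule.top_ne_ideal_smul_of_le_jacobson_annihilator
      (maximalIdeal_le_jacobson _)).symm.lt_top
  have supp : Module.support R (ModuleCat.of R (R ⧸ maximalIdeal R)) =
      PrimeSpectrum.zeroLocus (maximalIdeal R) := by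
    rw [Module.support_eq_zeroLocus, Ideal.annihilator_quotient]
  have vanish := ModuleCat.subsingleton_ext_of_exists_isRegular (maximalIdeal R)
    (ModuleCat.of R (R ⧸ maximalIdeal R)) supp.subset (ModuleCat.of R M) (lt_top M) rs mem reg
  refine ModuleCat.exists_isRegular_of_exists_subsingleton_ext (maximalIdeal R) n
    (ModuleCat.of R (QuotSMulTop a M)) (lt_top _)
    (ModuleCat.of R (R ⧸ maximalIdeal R)) supp fun i hi ↦ ?_
  have zero₁ := AddCommGrpCat.isZero_of_iff_subsingleton.mpr (vanish i (by omega))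
  have zero₂ := AddCommGrpCat.isZero_of_iff_subsingleton.mpr (vanish (i + 1) (by omega))
  exact AddCommGrpCat.subsingleton_of_isZero <| ShortComplex.Exact.isZero_of_both_zeros
    ((Ext.covariant_sequence_exact₃' _
      (IsSMulRegular.smulShortComplex_shortExact (M := ModuleCat.of R M) hreg)) i (i + 1) rfl)
    (zero₁.eq_zero_of_src _) (zero₂.eq_zero_of_tgt _)

lemma exists_isSMulRegular_of_baseChange {A B M : Type u} [CommRing A] [CommRing B]
    [IsNoetherianRing A] [IsLocalRing A] [IsLocalRing B] [Algebra A B]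
    [Module.FaithfullyFlat A B]
    (hmax : (maximalIdeal A).map (algebraMap A B) = maximalIdeal B)
    [AddCommGroup M] [Module A M] [Module.Finite A M] {b : B} (hb : b ∈ maximalIdeal B)
    (hreg : IsSMulRegular (B ⊗[A] M) b) :
    ∃ a ∈ maximalIdeal A, IsSMulRegular M a := by
  have key : Subsingleton ((A ⧸ maximalIdeal A) →ₗ[A] M) := by
    refine subsingleton_of_forall_eq 0 fun f ↦ ?_
    have hx : ∀ a ∈ maximalIdeal A, a • f 1 = 0 := fun a ha ↦ by
      rw [← map_smul, Algebra.smul_def, mul_one, Ideal.Quotient.algebraMap_eq,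
        Ideal.Quotient.eq_zero_iff_mem.mpr ha, map_zero]
    have hann : maximalIdeal B ≤
        LinearMap.ker (LinearMap.toSpanSingleton B (B ⊗[A] M) (1 ⊗ₜ[A] f 1)) := by
      rw [← hmax, Ideal.map_le_iff_le_comap]
      intro a ha
      rw [Ideal.mem_comap, LinearMap.mem_ker, LinearMap.toSpanSingleton_apply]
      rw [algebraMap_smul, ← TensorProduct.tmul_smul, hx a ha, TensorProduct.tmul_zero]
    have hone : (1 : B) ⊗ₜ[A] f 1 = 0 := hreg (by simpa using hann hb)
    have hf : f 1 = 0 :=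
      Module.FaithfullyFlat.tensorProduct_mk_injective (A := A) (B := B) M (by simpa using hone)
    ext
    simpa using hf
  obtain ⟨a, ha, h⟩ := IsSMulRegular.subsingleton_linearMap_iff.mp key
  exact ⟨a, by rwa [Ideal.annihilator_quotient] at ha, h⟩

lemma exists_isRegular_of_baseChange {A B : Type u} [CommRing A] [CommRing B]
    [IsNoetherianRing A] [IsNoetherianRing B] [IsLocalRing A] [IsLocalRing B] [Algebra A B]
    [Module.FaithfullyFlat A B]
    (hmax : (maximalIdeal A).map (algebraMap A B) = maximalIdeal B) (n : ℕ)
    (M : Type u) [AddCommGroup M] [Module A M] [Module.Finite A M] (rs : List B)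
    (len : rs.length = n) (mem : ∀ x ∈ rs, x ∈ maximalIdeal B)
    (reg : IsRegular (B ⊗[A] M) rs) :
    ∃ rs' : List A, rs'.length = n ∧ (∀ x ∈ rs', x ∈ maximalIdeal A) ∧ IsRegular M rs' := by
  induction n generalizing M rs with
  | zero =>
    have : Nontrivial (B ⊗[A] M) := reg.nontrivial
    have : Nontrivial M := by
      by_contra h
      rw [not_nontrivial_iff_subsingleton] at h
      exact not_subsingleton (B ⊗[A] M) inferInstance
    exact ⟨[], rfl, by simp, IsRegular.nil A M⟩
  | succ n ih =>
    obtain ⟨b, bs, rfl⟩ := List.exists_cons_of_length_eq_add_one len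
    obtain ⟨a, ha, hreg⟩ := exists_isSMulRegular_of_baseChange hmax
      (mem b List.mem_cons_self) ((isRegular_cons_iff _ _ _).mp reg).1
    have ha' : algebraMap A B a ∈ maximalIdeal B := hmax ▸ Ideal.mem_map_of_mem _ ha
    have hreg' : IsSMulRegular (B ⊗[A] M) (algebraMap A B a) :=
      hreg.of_flat_of_isBaseChange (TensorProduct.isBaseChange A M B)
    obtain ⟨cs, lencs, memcs, regcs⟩ := exists_isRegular_quotSMulTop ha' hreg' mem reg len
    obtain ⟨as, lenas, memas, regas⟩ := ih (QuotSMulTop a M) cs lencs memcs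
      (((QuotSMulTop.algebraMapTensorEquivTensorQuotSMulTop a M B).isRegular_congr cs).mp regcs)
    exact ⟨a :: as, by simp [lenas], List.forall_mem_cons.mpr ⟨ha, memas⟩, IsRegular.cons hreg regas⟩

lemma depthIn_le_of_faithfullyFlat {A B : Type u} [CommRing A] [CommRing B]
    [IsNoetherianRing A] [IsNoetherianRing B] [IsLocalRing A] [IsLocalRing B] [Algebra A B]
    [Module.FaithfullyFlat A B]
    (hmax : (maximalIdeal A).map (algebraMap A B) = maximalIdeal B) :
    depthIn B (maximalIdeal B) B ≤ depthIn A (maximalIdeal A) A := by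
  refine sSup_le ?_
  rintro _ ⟨rs, mem, reg, rfl⟩
  obtain ⟨rs', len, mem', reg'⟩ := exists_isRegular_of_baseChange hmax rs.length A rs rfl mem
    (((TensorProduct.AlgebraTensorModule.rid A B B).isRegular_congr rs).mpr reg)
  exact le_sSup ⟨rs', mem', reg', by rw [len]⟩

lemma depthIn_eq_of_surjective {R S M N : Type*} [CommRing R] [CommRing S] [AddCommGroup M]
    [AddCommGroup N] [Module R M] [Module S N] {f : R →+* S} (hf : Function.Surjective f)
    (e : M ≃+ N) (he : ∀ (r : R) (x : M), e (r • x) = f r • e x) (I : Ideal R) :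
    depthIn R I M = depthIn S (I.map f) N := by
  have key (rs : List R) : IsRegular M rs ↔ IsRegular N (rs.map f) :=
    e.isRegular_congr <| List.forall₂_map_right_iff.mpr <| List.forall₂_same.mpr fun r _ ↦ he r
  refine le_antisymm (sSup_le ?_) (sSup_le ?_)
  · rintro _ ⟨rs, mem, reg, rfl⟩
    refine le_sSup ⟨rs.map f, ?_, (key rs).mp reg, by simp⟩
    simpa using fun x hx ↦ Ideal.mem_map_of_mem f (mem x hx)
  · rintro _ ⟨rs, mem, reg, rfl⟩
    have mem' : ∀ x ∈ rs, x ∈ Set.range fun a : I ↦ f a := fun x hx ↦ by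
      obtain ⟨a, ha, rfl⟩ := (Ideal.mem_map_iff_of_surjective f hf).mp (mem x hx)
      exact ⟨⟨a, ha⟩, rfl⟩
    obtain ⟨rs', rfl⟩ : rs ∈ Set.range (List.map fun a : I ↦ f a) := by
      rwa [Set.range_list_map]
    refine le_sSup ⟨rs'.map (↑), ?_, (key _).mpr ?_, by simp⟩
    · simp +contextual
    · simpa [Function.comp_def] using reg

end Depth

section SerreRing

open IsLocalRing

/-- The inequality `depth A ≥ min (r, dim A)` for a local ring `A`. -/
def IsSerreLocal (r : ℕ) (A : Type*) [CommRing A] [IsLocalRing A] : Prop :=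
  min ((r : ℕ∞) : WithBot ℕ∞) (ringKrullDim A) ≤ (depthIn A (maximalIdeal A) A : ℕ∞)

/-- Serre's condition `S_r` for a ring, in terms of its own localizations. -/
def IsSerreRing (r : ℕ) (C : Type*) [CommRing C] : Prop :=
  ∀ (q : Ideal C) [q.IsPrime], IsSerreLocal r (Localization.AtPrime q)

lemma IsSerreLocal.of_ringEquiv {r : ℕ} {A B : Type*} [CommRing A] [CommRing B] [IsLocalRing A]
    [IsLocalRing B] (e : A ≃+* B) (h : IsSerreLocal r A) : IsSerreLocal r B := by
  have hmax : (maximalIdeal A).map (e : A →+* B) = maximalIdeal B :=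
    map_ringEquiv_maximalIdeal e
  unfold IsSerreLocal at h ⊢
  rwa [← ringKrullDim_eq_of_ringEquiv e, ← hmax, ← depthIn_eq_of_surjective
    (f := (e : A →+* B)) e.surjective e.toAddEquiv (fun r x ↦ by simp)]

lemma mDim_eq_of_linearEquiv_of_surjective {R M A : Type*} [CommRing R] [AddCommGroup M]
    [Module R M] [CommRing A] [Algebra R A] (e : M ≃ₗ[R] A)
    (hsurj : Function.Surjective (algebraMap R A)) : mDim R M = ringKrullDim A := by
  have hker : Module.annihilator R M = RingHom.ker (algebraMap R A) := by
    rw [e.annihilator_eq]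
    ext x
    rw [Module.mem_annihilator, RingHom.mem_ker, Algebra.algebraMap_eq_smul_one]
    exact ⟨fun h ↦ h 1, fun h a ↦ by rw [← one_mul a, ← smul_mul_assoc, h, zero_mul]⟩
  unfold mDim
  rw [hker]
  exact ringKrullDim_eq_of_ringEquiv (RingHom.quotientKerEquivOfSurjective hsurj)

lemma serre_atPrime_comap_iff {R : Type*} [CommRing R] (r : ℕ) (I : Ideal R) (q : Ideal (R ⧸ I))
    [q.IsPrime] (p : Ideal R) [p.IsPrime] (hp : p = q.comap (Ideal.Quotient.mk I)) :
    min ((r : ℕ∞) : WithBot ℕ∞)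
        (mDim (Localization p.primeCompl) (LocalizedModule p.primeCompl (R ⧸ I))) ≤
      ((depthIn (Localization p.primeCompl)
          (Ideal.map (algebraMap R (Localization p.primeCompl)) p)
          (LocalizedModule p.primeCompl (R ⧸ I)) : ℕ∞) : WithBot ℕ∞) ↔
    IsSerreLocal r (Localization.AtPrime q) := by
  have : q.LiesOver p := ⟨hp⟩
  let := Localization.AtPrime.algebraOfLiesOver p q
  have hM : Algebra.algebraMapSubmonoid (R ⧸ I) p.primeCompl = q.primeCompl := by
    ext x
    obtain ⟨x, rfl⟩ := Ideal.Quotient.mk_surjective x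
    constructor
    · rintro ⟨y, hy, hxy⟩
      rw [← hxy]
      simpa [hp] using hy
    · intro hx
      exact ⟨x, by simpa [hp] using hx, rfl⟩
  have : IsLocalization (Algebra.algebraMapSubmonoid (R ⧸ I) p.primeCompl)
      (Localization.AtPrime q) := by
    rw [hM]
    infer_instance
  let e := (IsLocalizedModule.linearEquiv p.primeCompl
    (LocalizedModule.mkLinearMap p.primeCompl (R ⧸ I))
    (IsScalarTower.toAlgHom R (R ⧸ I) (Localization.AtPrime q)).toLinearMap)
  let e' := e.extendScalarsOfIsLocalization p.primeCompl (Localization.AtPrime p)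
  have hsurj : Function.Surjective
      (algebraMap (Localization.AtPrime p) (Localization.AtPrime q)) := by
    intro z
    obtain ⟨⟨x, s⟩, h⟩ := IsLocalization.surj q.primeCompl z
    obtain ⟨a, rfl⟩ := Ideal.Quotient.mk_surjective x
    obtain ⟨b, hb⟩ := Ideal.Quotient.mk_surjective (s : R ⧸ I)
    have hbp : b ∈ p.primeCompl := by
      rw [Ideal.mem_primeCompl_iff, hp, Ideal.mem_comap, hb]
      exact s.2
    have htower (x : R) : algebraMap (Localization.AtPrime p) (Localization.AtPrime q)
        (algebraMap R _ x) = algebraMap (R ⧸ I) _ (Ideal.Quotient.mk I x) := by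
      rw [← IsScalarTower.algebraMap_apply, IsScalarTower.algebraMap_apply R (R ⧸ I)]
      rfl
    refine ⟨IsLocalization.mk' _ a ⟨b, hbp⟩, ?_⟩
    refine (IsLocalization.map_units (Localization.AtPrime q) s).mul_right_cancel ?_
    rw [h, ← hb, ← htower, ← htower, ← map_mul]
    exact congrArg _ (IsLocalization.mk'_spec _ a ⟨b, hbp⟩)
  have hmax : (p.map (algebraMap R (Localization.AtPrime p))).map
      (algebraMap (Localization.AtPrime p) (Localization.AtPrime q)) =
      maximalIdeal (Localization.AtPrime q) := by
    rw [Ideal.map_map, ← IsScalarTower.algebraMap_eq,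
      IsScalarTower.algebraMap_eq R (R ⧸ I) (Localization.AtPrime q), ← Ideal.map_map,
      ← Localization.AtPrime.map_eq_maximalIdeal, hp, Ideal.Quotient.algebraMap_eq,
      Ideal.map_comap_of_surjective _ Ideal.Quotient.mk_surjective]
  unfold IsSerreLocal
  rw [← hmax, ← depthIn_eq_of_surjective hsurj e'.toAddEquiv (fun r x ↦ by
    simp [Algebra.smul_def]), ← mDim_eq_of_linearEquiv_of_surjective e' hsurj]

lemma isSerreMod_quotient_iff {R : Type*} [CommRing R] (r : ℕ) (I : Ideal R) :
    IsSerreMod r R (R ⧸ I) ↔ IsSerreRing r (R ⧸ I) := by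
  constructor
  · intro h q _
    exact (serre_atPrime_comap_iff r I q _ rfl).mp (h _)
  · intro h p _
    by_cases hI : I ≤ p
    · have : (p.map (Ideal.Quotient.mk I)).IsPrime :=
        Ideal.map_isPrime_of_surjective Ideal.Quotient.mk_surjective (by simpa using hI)
      refine (serre_atPrime_comap_iff r I (p.map (Ideal.Quotient.mk I)) p ?_).mpr (h _)
      rw [Ideal.comap_map_of_surjective _ Ideal.Quotient.mk_surjective, ← RingHom.ker_eq_comap_bot,
        Ideal.mk_ker, sup_eq_left.mpr hI]
    · obtain ⟨x, hxI, hxp⟩ := SetLike.not_le_iff_exists.mp hI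
      have hsub : Subsingleton (LocalizedModule p.primeCompl (R ⧸ I)) := by
        rw [IsLocalizedModule.subsingleton_iff p.primeCompl
          (LocalizedModule.mkLinearMap p.primeCompl (R ⧸ I))]
        refine fun m ↦ ⟨x, hxp, ?_⟩
        rw [Algebra.smul_def, Ideal.Quotient.algebraMap_eq,
          Ideal.Quotient.eq_zero_iff_mem.mpr hxI, zero_mul]
      have hbot : mDim (Localization p.primeCompl)
          (LocalizedModule p.primeCompl (R ⧸ I)) = ⊥ := by
        unfold mDim
        rw [Module.annihilator_eq_top_iff.mpr hsub]
        exact ringKrullDim_eq_bot_of_subsingleton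
      rw [hbot]
      simp

lemma nonempty_localization_comap_ringEquiv {D E : Type*} [CommRing D] [CommRing E]
    (π : D →+* E) (hπ : Function.Surjective π) (u : D) (hu : ∀ x, π x = 0 → u * x = 0)
    (Q : Ideal E) [Q.IsPrime] (huQ : π u ∉ Q) :
    Nonempty (Localization.AtPrime (Q.comap π) ≃+* Localization.AtPrime Q) := by
  let : Algebra D (Localization.AtPrime Q) :=
    ((algebraMap E (Localization.AtPrime Q)).comp π).toAlgebra
  have hmap (x : D) : algebraMap D (Localization.AtPrime Q) x = algebraMap E _ (π x) := rfl
  have : IsLocalization (Q.comap π).primeCompl (Localization.AtPrime Q) := by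
    refine ⟨⟨fun s ↦ ?_, fun z ↦ ?_, fun {a b} hab ↦ ?_⟩⟩
    · exact IsLocalization.map_units (Localization.AtPrime Q)
        (⟨π s, s.2⟩ : Q.primeCompl)
    · obtain ⟨⟨x, s⟩, h⟩ := IsLocalization.surj Q.primeCompl z
      obtain ⟨d, rfl⟩ := hπ x
      obtain ⟨t, ht⟩ := hπ s
      refine ⟨⟨d, ⟨t, ?_⟩⟩, ?_⟩
      · simp only [Ideal.mem_primeCompl_iff, Ideal.mem_comap, ht]
        exact s.2
      · simpa [hmap, ht] using h
    · obtain ⟨s, hs⟩ := IsLocalization.exists_of_eq (M := Q.primeCompl) hab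
      obtain ⟨t, ht⟩ := hπ s
      refine ⟨⟨u * t, ?_⟩, ?_⟩
      · intro h
        change π (u * t) ∈ Q at h
        rw [map_mul, ht] at h
        exact (Ideal.IsPrime.mem_or_mem ‹_› h).elim huQ s.2
      · have := hu (t * a - t * b) (by simp [ht, hs])
        linear_combination this
  exact ⟨(IsLocalization.algEquiv (Q.comap π).primeCompl _ _).toRingEquiv⟩

lemma isPrime_map_mvPolynomial_C {σ C : Type*} [CommRing C] (q : Ideal C) [q.IsPrime] :
    (q.map (MvPolynomial.C : C →+* MvPolynomial σ C)).IsPrime := by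
  rw [← Ideal.mk_ker (I := q), ← MvPolynomial.ker_map]
  exact RingHom.ker_isPrime _

lemma comap_map_mvPolynomial_C {σ C : Type*} [CommRing C] (q : Ideal C) :
    (q.map (MvPolynomial.C : C →+* MvPolynomial σ C)).comap MvPolynomial.C = q := by
  classical
  ext x
  rw [Ideal.mem_comap, MvPolynomial.mem_map_C_iff]
  refine ⟨fun h ↦ by simpa using h 0, fun h m ↦ ?_⟩
  rw [MvPolynomial.coeff_C]
  split_ifs
  exacts [h, q.zero_mem]

lemma height_le_height_map_mvPolynomial_C {σ C : Type*} [CommRing C] (q : Ideal C) [q.IsPrime] :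
    q.height ≤ (q.map (MvPolynomial.C : C →+* MvPolynomial σ C)).height := by
  have := isPrime_map_mvPolynomial_C (σ := σ) q
  let f : PrimeSpectrum C → PrimeSpectrum (MvPolynomial σ C) := fun p ↦
    ⟨p.asIdeal.map MvPolynomial.C, isPrime_map_mvPolynomial_C p.asIdeal⟩
  have hf : StrictMono f := by
    refine Monotone.strictMono_of_injective (fun p p' h ↦ Ideal.map_mono h) fun p p' h ↦ ?_
    have := congrArg (fun x ↦ x.asIdeal.comap MvPolynomial.C) h
    simp only [f, comap_map_mvPolynomial_C] at this
    exact PrimeSpectrum.ext this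
  have hle := Order.height_le_height_apply_of_strictMono f hf ⟨q, ‹_›⟩
  rwa [← PrimeSpectrum.height_eq_orderHeight, ← PrimeSpectrum.height_eq_orderHeight] at hle

lemma IsSerreLocal.of_mvPolynomial {r : ℕ} {σ : Type} [Finite σ] {C : Type*} [CommRing C]
    [IsNoetherianRing C] (q : Ideal C) [q.IsPrime]
    [(q.map (MvPolynomial.C : C →+* MvPolynomial σ C)).IsPrime]
    (h : IsSerreLocal r
      (Localization.AtPrime (q.map (MvPolynomial.C : C →+* MvPolynomial σ C)))) :
    IsSerreLocal r (Localization.AtPrime q) := by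
  set Q := q.map (MvPolynomial.C : C →+* MvPolynomial σ C) with hQ
  have : Q.LiesOver q := ⟨(comap_map_mvPolynomial_C q).symm⟩
  let := Localization.AtPrime.algebraOfLiesOver q Q
  have : IsLocalHom (algebraMap (Localization.AtPrime q) (Localization.AtPrime Q)) :=
    Localization.isLocalHom_localRingHom _ _ _ _
  have : Module.FaithfullyFlat (Localization.AtPrime q) (Localization.AtPrime Q) :=
    Module.FaithfullyFlat.of_flat_of_isLocalHom
  have hmax : (maximalIdeal (Localization.AtPrime q)).map
      (algebraMap (Localization.AtPrime q) (Localization.AtPrime Q)) =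
      maximalIdeal (Localization.AtPrime Q) := by
    rw [← Localization.AtPrime.map_eq_maximalIdeal, Ideal.map_map, ← IsScalarTower.algebraMap_eq,
      IsScalarTower.algebraMap_eq C (MvPolynomial σ C) (Localization.AtPrime Q), ← Ideal.map_map,
      MvPolynomial.algebraMap_eq, ← hQ, Localization.AtPrime.map_eq_maximalIdeal]
  have hdim : ringKrullDim (Localization.AtPrime q) ≤ ringKrullDim (Localization.AtPrime Q) := by
    rw [IsLocalization.AtPrime.ringKrullDim_eq_height q,
      IsLocalization.AtPrime.ringKrullDim_eq_height Q]
    exact_mod_cast height_le_height_map_mvPolynomial_C q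
  calc _ ≤ _ := min_le_min_left _ hdim
    _ ≤ _ := h
    _ ≤ _ := by exact_mod_cast depthIn_le_of_faithfullyFlat hmax

lemma IsSerreRing.of_surjective_mvPolynomial {r : ℕ} {σ : Type} [Finite σ] {C D : Type*}
    [CommRing C] [IsNoetherianRing C] [CommRing D] (π : D →+* MvPolynomial σ C)
    (hπ : Function.Surjective π) (u : D) (hu : ∀ x, π x = 0 → u * x = 0)
    (hπu : ∀ (q : Ideal C) [q.IsPrime], π u ∉ q.map MvPolynomial.C) (h : IsSerreRing r D) :
    IsSerreRing r C := by
  intro q _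
  have := isPrime_map_mvPolynomial_C (σ := σ) q
  obtain ⟨e⟩ := nonempty_localization_comap_ringEquiv π hπ u hu _ (hπu q)
  exact .of_mvPolynomial q ((h _).of_ringEquiv e)

end SerreRing

section Link

lemma prod_X_mem_srIdeal {k : Type*} [Field k] {V : Type*} {Δ : Set (Finset V)} {G : Finset V}
    (hG : G ∉ Δ) :
    (∏ i ∈ G, X i : MvPolynomial V k) ∈ srIdeal k Δ :=
  Ideal.subset_span ⟨G, hG, rfl⟩

variable {k : Type*} [Field k] {V : Type*} [DecidableEq V] {Δ : Set (Finset V)} {F : Finset V}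

/-- The `k`-algebra map from the polynomial ring of `Δ` to a polynomial ring over the
Stanley-Reisner ring of the link of `F`, with one new variable for each vertex of `F`. -/
noncomputable def linkMap (k : Type*) [Field k] (Δ : Set (Finset V)) (F : Finset V) :
    MvPolynomial V k →ₐ[k]
      MvPolynomial {i // i ∈ F} (MvPolynomial V k ⧸ srIdeal k (link Δ F)) :=
  aeval fun i ↦ if h : i ∈ F then X ⟨i, h⟩ else C (Ideal.Quotient.mk _ (X i))

lemma linkMap_C (a : k) : linkMap k Δ F (C a) = C (Ideal.Quotient.mk _ (C a)) :=
  (linkMap k Δ F).commutes a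

lemma linkMap_X_of_mem {i : V} (h : i ∈ F) : linkMap k Δ F (X i) = X ⟨i, h⟩ := by
  simp [linkMap, h]

lemma linkMap_X_of_notMem {i : V} (h : i ∉ F) :
    linkMap k Δ F (X i) = C (Ideal.Quotient.mk _ (X i)) := by
  simp [linkMap, h]

lemma srIdeal_le_ker_linkMap (hΔ : IsComplex Δ) :
    srIdeal k Δ ≤ RingHom.ker (linkMap k Δ F) := by
  refine Ideal.span_le.mpr ?_
  rintro _ ⟨G, hG, rfl⟩
  have hlink : G \ F ∉ link Δ F := fun h ↦
    hG (hΔ _ h.2 G (by rw [Finset.union_sdiff_self_eq_union]; exact Finset.subset_union_right))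
  have hzero : linkMap k Δ F (∏ i ∈ G \ F, X i) = 0 := by
    rw [map_prod, Finset.prod_congr rfl fun i hi ↦
      linkMap_X_of_notMem (Finset.mem_sdiff.mp hi).2, ← map_prod, ← map_prod,
      Ideal.Quotient.eq_zero_iff_mem.mpr (prod_X_mem_srIdeal hlink), map_zero]
  rw [SetLike.mem_coe, RingHom.mem_ker, ← Finset.prod_inter_mul_prod_sdiff G F, map_mul, hzero,
    mul_zero]

lemma linkMap_surjective : Function.Surjective (linkMap k Δ F) := by
  have hC (f : MvPolynomial V k) :
      C (Ideal.Quotient.mk (srIdeal k (link Δ F)) f) ∈ (linkMap k Δ F).range := by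
    induction f using MvPolynomial.induction_on with
    | C a => exact ⟨C a, linkMap_C a⟩
    | add p q hp hq => simpa only [map_add] using add_mem hp hq
    | mul_X p i hp =>
      rw [map_mul, map_mul]
      refine mul_mem hp ?_
      by_cases hi : i ∈ F
      · have hX : (X i : MvPolynomial V k) ∈ srIdeal k (link Δ F) := by
          simpa using prod_X_mem_srIdeal (k := k) (Δ := link Δ F) (G := {i})
            fun h ↦ by simpa [hi] using h.1
        rw [Ideal.Quotient.eq_zero_iff_mem.mpr hX, map_zero]
        exact zero_mem _
      · exact ⟨X i, linkMap_X_of_notMem hi⟩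
  intro f
  suffices f ∈ (linkMap k Δ F).range from this
  induction f using MvPolynomial.induction_on with
  | C a =>
    obtain ⟨a, rfl⟩ := Ideal.Quotient.mk_surjective a
    exact hC a
  | add p q hp hq => exact add_mem hp hq
  | mul_X p i hp => exact mul_mem hp ⟨X i, linkMap_X_of_mem i.2⟩

lemma prod_X_mul_mem_srIdeal_of_linkMap_eq_zero {f : MvPolynomial V k}
    (hf : linkMap k Δ F f = 0) : (∏ i ∈ F, X i) * f ∈ srIdeal k Δ := by
  let J : Ideal (MvPolynomial V k) := (srIdeal k Δ).colon {∏ i ∈ F, X i}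
  have hJ (g : MvPolynomial V k) : g ∈ J ↔ (∏ i ∈ F, X i) * g ∈ srIdeal k Δ := by
    rw [Submodule.mem_colon_singleton, smul_eq_mul, mul_comm]
  let φ : MvPolynomial V k →+* MvPolynomial V k ⧸ J :=
    eval₂Hom ((Ideal.Quotient.mk J).comp C) fun i ↦ if i ∈ F then 0 else Ideal.Quotient.mk J (X i)
  have hφ : ∀ g ∈ srIdeal k (link Δ F), φ g = 0 := by
    suffices srIdeal k (link Δ F) ≤ RingHom.ker φ from fun g hg ↦ this hg
    refine Ideal.span_le.mpr ?_
    rintro _ ⟨G, hG, rfl⟩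
    rw [SetLike.mem_coe, RingHom.mem_ker, map_prod]
    by_cases hGF : F ∩ G = ∅
    · rw [Finset.prod_congr rfl (g := fun i ↦ Ideal.Quotient.mk J (X i)) fun i hi ↦ ?_,
        ← map_prod, Ideal.Quotient.eq_zero_iff_mem, hJ,
        ← Finset.prod_union (Finset.disjoint_iff_inter_eq_empty.mpr hGF)]
      · exact prod_X_mem_srIdeal fun h ↦ hG ⟨hGF, h⟩
      · have : i ∉ F := fun h ↦ by
          simpa [hGF] using Finset.mem_inter.mpr ⟨h, hi⟩
        simp [φ, this]
    · obtain ⟨i, hi⟩ := Finset.nonempty_iff_ne_empty.mpr hGF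
      rw [Finset.mem_inter] at hi
      exact Finset.prod_eq_zero hi.2 (by simp [φ, hi.1])
  let ρ := eval₂Hom (Ideal.Quotient.lift _ φ hφ)
    fun i : {i // i ∈ F} ↦ Ideal.Quotient.mk J (X i)
  have hρ : ρ.comp (linkMap k Δ F : MvPolynomial V k →+* _) = Ideal.Quotient.mk J := by
    refine MvPolynomial.ringHom_ext (fun a ↦ ?_) fun i ↦ ?_
    · rw [RingHom.comp_apply, RingHom.coe_coe, linkMap_C, coe_eval₂Hom, eval₂_C,
        Ideal.Quotient.lift_mk]
      simp [φ]
    · by_cases hi : i ∈ F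
      · simp [ρ, linkMap_X_of_mem hi]
      · rw [RingHom.comp_apply, RingHom.coe_coe, linkMap_X_of_notMem hi, coe_eval₂Hom, eval₂_C,
          Ideal.Quotient.lift_mk]
        simp [φ, hi]
  rw [← hJ, ← Ideal.Quotient.eq_zero_iff_mem, ← hρ]
  simp [hf]

lemma linkMap_prod_X_notMem_map_C (q : Ideal (MvPolynomial V k ⧸ srIdeal k (link Δ F)))
    [q.IsPrime] : linkMap k Δ F (∏ i ∈ F, X i) ∉ q.map C := by
  have := isPrime_map_mvPolynomial_C (σ := {i // i ∈ F}) q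
  rw [map_prod, Ideal.IsPrime.prod_mem_iff]
  rintro ⟨i, hi, h⟩
  rw [linkMap_X_of_mem hi, mem_map_C_iff] at h
  exact ‹q.IsPrime›.one_notMem (by simpa using h (Finsupp.single ⟨i, hi⟩ 1))

end Link

/-- **Links of `S_r` complexes are `S_r`.**
Let `Δ` be a `(d-1)`-dimensional simplicial complex on `[n]` which satisfies Serre's
condition `S_r` (`r ≥ 2`) over a field `k`.  Then for every face `F ∈ Δ`, the link
`lk_Δ F` also satisfies Serre's condition `S_r` over `k`. -/
theorem isSerreComplex_link (k : Type*) [Field k] (n d r : ℕ)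
    (Δ : Set (Finset (Fin n))) (hcomplex : IsComplex Δ) (hdim : HasDim Δ d)
    (hr : 2 ≤ r) (hserre : IsSerreComplex k Δ r) :
    ∀ F ∈ Δ, IsSerreComplex k (link Δ F) r := by
  intro F hF
  let π := Ideal.Quotient.lift (srIdeal k Δ) (linkMap k Δ F).toRingHom
    fun f hf ↦ srIdeal_le_ker_linkMap hcomplex hf
  refine (isSerreMod_quotient_iff r _).mpr (.of_surjective_mvPolynomial π
    (Ideal.Quotient.lift_surjective_of_surjective _ _ linkMap_surjective)
    (Ideal.Quotient.mk _ (∏ i ∈ F, X i)) (fun x hx ↦ ?_)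
    (fun q _ ↦ linkMap_prod_X_notMem_map_C q) ((isSerreMod_quotient_iff r _).mp hserre))
  obtain ⟨f, rfl⟩ := Ideal.Quotient.mk_surjective x
  rw [← map_mul, Ideal.Quotient.eq_zero_iff_mem]
  exact prod_X_mul_mem_srIdeal_of_linkMap_eq_zero hx

end SeqSr
end

section
/- Let Δ be a simplicial complex on [n] and let i, r be integers with 2 ≤ r ≤ i+1. If Δ satisfies Serre's condition S_r over a field k, then the i-skeleton Δ^{(i)} also satisfies Serre's condition S_r over k. -/
open MvPolynomial

namespace SeqSr

universe u

open CategoryTheory Abelian in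
/-- The groups `Ext i (A ⧸ I) M` vanish for all `i < t`. -/
def ExtVanishing {A : Type u} [CommRing A] (I : Ideal A) (t : ℕ) (M : Type u)
    [AddCommGroup M] [Module A M] : Prop :=
  ∀ i < t, Subsingleton (Ext (ModuleCat.of A (A ⧸ I)) (ModuleCat.of A M) i)

namespace ExtVanishing

variable {A : Type u} [CommRing A] {I : Ideal A} {K M N : Type u}
  [AddCommGroup K] [Module A K] [AddCommGroup M] [Module A M] [AddCommGroup N] [Module A N]

lemma mono {s t : ℕ} (hst : s ≤ t) (h : ExtVanishing I t M) : ExtVanishing I s M :=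
  fun i hi ↦ h i (hi.trans_le hst)

open CategoryTheory Abelian in
lemma of_linearEquiv {t : ℕ} (e : M ≃ₗ[A] N) (h : ExtVanishing I t M) :
    ExtVanishing I t N := by
  intro i hi
  have := h i hi
  refine ⟨fun x y ↦ ?_⟩
  have key : ∀ z : Ext (ModuleCat.of A (A ⧸ I)) (ModuleCat.of A N) i, z = 0 := fun z ↦ by
    have h0 : z.comp (Ext.mk₀ e.symm.toModuleIso.hom) (add_zero i) = 0 := Subsingleton.elim _ _
    have h1 : (z.comp (Ext.mk₀ e.symm.toModuleIso.hom) (add_zero i)).comp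
        (Ext.mk₀ e.symm.toModuleIso.inv) (add_zero i) = z := by
      simp only [Ext.comp_assoc_of_second_deg_zero, Ext.mk₀_comp_mk₀, Iso.hom_inv_id,
        Ext.comp_mk₀_id]
    rw [← h1, h0, Ext.zero_comp]
  rw [key x, key y]

open CategoryTheory Abelian in
lemma of_exact {t : ℕ} (f : K →ₗ[A] M) (g : M →ₗ[A] N) (hf : Function.Injective f)
    (hfg : Function.Exact f g) (hg : Function.Surjective g)
    (hK : ExtVanishing I (t + 1) K) (hM : ExtVanishing I t M) : ExtVanishing I t N := by
  intro i hi
  have hS : (ModuleCat.shortComplexOfCompEqZero f g hfg.linearMap_comp_eq_zero).ShortExact :=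
    { exact := ModuleCat.shortComplex_exact _ hfg
      mono_f := (ModuleCat.mono_iff_injective _).2 hf
      epi_g := (ModuleCat.epi_iff_surjective _).2 hg }
  have zero1 := AddCommGrpCat.isZero_of_iff_subsingleton.mpr (hM i hi)
  have zero2 := AddCommGrpCat.isZero_of_iff_subsingleton.mpr (hK (i + 1) (by omega))
  exact AddCommGrpCat.subsingleton_of_isZero <| ShortComplex.Exact.isZero_of_both_zeros
    (Ext.covariant_sequence_exact₃' _ hS i (i + 1) rfl)
    (zero1.eq_zero_of_src _) (zero2.eq_zero_of_tgt _)

lemma of_le_depthIn [IsLocalRing A] [IsNoetherianRing A] [Module.Finite A M] [Nontrivial M]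
    {t : ℕ} (h : (t : ℕ∞) ≤ depthIn A (IsLocalRing.maximalIdeal A) M) :
    ExtVanishing (IsLocalRing.maximalIdeal A) t M := by
  intro i hi
  obtain ⟨_, ⟨rs, hmem, hreg, rfl⟩, hlt⟩ :=
    lt_sSup_iff.1 (lt_of_lt_of_le (Nat.cast_lt.2 hi) h)
  refine ModuleCat.subsingleton_ext_of_exists_isRegular _ _ ?_ _ ?_ rs hmem hreg i
    (Nat.cast_lt.1 hlt)
  · rw [Module.support_eq_zeroLocus, Ideal.annihilator_quotient]
  · exact (Submodule.top_ne_ideal_smul_of_le_jacobson_annihilator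
      (IsLocalRing.maximalIdeal_le_jacobson _)).symm.lt_top

lemma le_depthIn [IsLocalRing A] [IsNoetherianRing A] [Module.Finite A M] [Nontrivial M]
    {t : ℕ} (h : ExtVanishing (IsLocalRing.maximalIdeal A) t M) :
    (t : ℕ∞) ≤ depthIn A (IsLocalRing.maximalIdeal A) M := by
  obtain ⟨rs, hlen, hmem, hreg⟩ := ModuleCat.exists_isRegular_of_exists_subsingleton_ext
    (IsLocalRing.maximalIdeal A) t (ModuleCat.of A M)
    (Submodule.top_ne_ideal_smul_of_le_jacobson_annihilator
      (IsLocalRing.maximalIdeal_le_jacobson _)).symm.lt_top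
    (ModuleCat.of A (A ⧸ IsLocalRing.maximalIdeal A))
    (by rw [Module.support_eq_zeroLocus, Ideal.annihilator_quotient]) h
  exact le_sSup ⟨rs, hmem, hreg, by rw [hlen]⟩

end ExtVanishing

section Localized

variable {R : Type u} [CommRing R] (p : Ideal R) [p.IsPrime]

lemma extVanishing_localized_quotient_sup_span {I P : Ideal R} {f : R} {t : ℕ}
    {J : Ideal (Localization p.primeCompl)}
    (hcolon : ∀ a, a * f ∈ I ↔ a ∈ P)
    (hP : ExtVanishing J (t + 1) (LocalizedModule p.primeCompl (R ⧸ P)))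
    (hI : ExtVanishing J t (LocalizedModule p.primeCompl (R ⧸ I))) :
    ExtVanishing J t (LocalizedModule p.primeCompl (R ⧸ (I ⊔ Ideal.span {f}))) := by
  let φ : (R ⧸ P) →ₗ[R] (R ⧸ I) := Submodule.mapQ P I (LinearMap.mulRight R f)
    fun a ha ↦ (hcolon a).2 ha
  let ψ : (R ⧸ I) →ₗ[R] (R ⧸ (I ⊔ Ideal.span {f})) :=
    Submodule.factor le_sup_left
  have hφ : Function.Injective φ := by
    rw [← LinearMap.ker_eq_bot, LinearMap.ker_eq_bot']
    intro x hx
    obtain ⟨a, rfl⟩ := Submodule.Quotient.mk_surjective _ x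
    have : a * f ∈ I := (Submodule.Quotient.mk_eq_zero I).1 hx
    exact (Submodule.Quotient.mk_eq_zero P).2 ((hcolon a).1 this)
  have hψ : Function.Surjective ψ := Submodule.factor_surjective _
  have hex : Function.Exact φ ψ := by
    intro x
    obtain ⟨a, rfl⟩ := Submodule.Quotient.mk_surjective _ x
    constructor
    · intro hx
      have : a ∈ I ⊔ Ideal.span {f} := (Submodule.Quotient.mk_eq_zero _).1 hx
      obtain ⟨b, hb, c, hc, rfl⟩ := Submodule.mem_sup.1 this
      obtain ⟨d, rfl⟩ := Ideal.mem_span_singleton'.1 hc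
      refine ⟨Submodule.Quotient.mk d, ?_⟩
      change Submodule.Quotient.mk (d * f) = _
      rw [Submodule.Quotient.eq]
      simpa using I.neg_mem hb
    · rintro ⟨y, hy⟩
      obtain ⟨d, rfl⟩ := Submodule.Quotient.mk_surjective _ y
      rw [← hy]
      exact (Submodule.Quotient.mk_eq_zero _).2
        (Ideal.mem_sup_right (Ideal.mul_mem_left _ d (Ideal.mem_span_singleton_self f)))
  exact ExtVanishing.of_exact (LocalizedModule.map p.primeCompl φ)
    (LocalizedModule.map p.primeCompl ψ) (LocalizedModule.map_injective _ _ hφ)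
    (LocalizedModule.map_exact _ _ _ hex) (LocalizedModule.map_surjective _ _ hψ) hP hI

end Localized

section RegularLocal

open IsLocalRing RingTheory.Sequence
open scoped Pointwise

lemma exists_mem_span_singleton_sup_erase {R : Type*} [CommRing R] [IsLocalRing R]
    [DecidableEq R] {s : Finset R} (hs : Ideal.span (s : Set R) = maximalIdeal R) {x : R}
    (hx : x ∈ maximalIdeal R) (hx2 : x ∉ maximalIdeal R ^ 2) :
    ∃ y ∈ s, y ∈ Ideal.span {x} ⊔ Ideal.span ((s.erase y : Finset R) : Set R) := by
  rw [← hs] at hx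
  obtain ⟨c, -, hc⟩ := Submodule.mem_span_finset.1 hx
  by_cases h : ∃ y ∈ s, IsUnit (c y)
  · obtain ⟨y, hy, u, hu⟩ := h
    refine ⟨y, hy, ?_⟩
    rw [← Finset.add_sum_erase s _ hy] at hc
    have : y = ↑u⁻¹ * (x - ∑ z ∈ s.erase y, c z • z) := by
      rw [← hc, ← hu]; simp
    have hmem : ↑u⁻¹ * (x - ∑ z ∈ s.erase y, c z • z) ∈
        Ideal.span {x} ⊔ Ideal.span ((s.erase y : Finset R) : Set R) := by
      refine Ideal.mul_mem_left _ _ (sub_mem ?_ ?_)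
      · exact Ideal.mem_sup_left (Ideal.mem_span_singleton_self x)
      · exact Ideal.mem_sup_right
          (sum_mem fun z hz ↦ Ideal.mul_mem_left _ _ (Ideal.subset_span hz))
    rwa [← this] at hmem
  · push Not at h
    refine absurd ?_ hx2
    rw [← hc, pow_two]
    exact sum_mem fun y hy ↦ Ideal.mul_mem_mul ((mem_maximalIdeal _).2 (h y hy))
      (hs ▸ Ideal.subset_span hy)

lemma isDomain_of_isDomain_quotient_span_singleton {R : Type*} [CommRing R] [IsLocalRing R]
    [IsNoetherianRing R] {x : R} (hx : x ∈ maximalIdeal R) (hmin : ∀ q ∈ minimalPrimes R, x ∉ q)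
    [IsDomain (R ⧸ Ideal.span {x})] : IsDomain R := by
  have hp : (Ideal.span {x}).IsPrime := (Ideal.Quotient.isDomain_iff_prime _).1 inferInstance
  obtain ⟨q, hq, hqx⟩ := Ideal.exists_minimalPrimes_le (I := ⊥) (J := Ideal.span {x}) bot_le
  have hqp : q.IsPrime := hq.1.1
  have hbot : q = ⊥ := by
    refine Submodule.eq_bot_of_le_smul_of_le_jacobson_bot (maximalIdeal R) q
      (IsNoetherian.noetherian q) (fun a ha ↦ ?_) (maximalIdeal_le_jacobson _)
    obtain ⟨b, rfl⟩ := Ideal.mem_span_singleton'.1 (hqx ha)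
    rw [mul_comm]
    exact Submodule.smul_mem_smul hx ((hqp.mem_or_mem ha).resolve_right (hmin q hq))
  rw [hbot] at hqp
  exact (IsDomain.of_bot_isPrime R)

lemma exists_mem_maximalIdeal_notMem_sq_notMem_minimalPrimes {R : Type*} [CommRing R]
    [IsLocalRing R] [IsNoetherianRing R] (hdim : 0 < ringKrullDim R) :
    ∃ x ∈ maximalIdeal R, x ∉ maximalIdeal R ^ 2 ∧ ∀ q ∈ minimalPrimes R, x ∉ q := by
  by_contra! hcon
  have hfin : (insert (maximalIdeal R ^ 2) (minimalPrimes R)).Finite :=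
    (minimalPrimes.finite_of_isNoetherianRing R).insert _
  have hsub : (maximalIdeal R : Set R) ⊆
      ⋃ J ∈ insert (maximalIdeal R ^ 2) (minimalPrimes R), (J : Set R) := by
    intro x hx
    by_cases hx2 : x ∈ maximalIdeal R ^ 2
    · exact Set.mem_biUnion (Set.mem_insert _ _) hx2
    · obtain ⟨q, hq, hxq⟩ := hcon x hx hx2
      exact Set.mem_biUnion (Set.mem_insert_of_mem _ hq) hxq
  obtain ⟨J, hJ, hle⟩ := (Ideal.subset_union_prime_finite hfin (f := id)
    (maximalIdeal R ^ 2) (maximalIdeal R ^ 2)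
    fun J hJ hne _ ↦ ((Set.mem_insert_iff.1 hJ).resolve_left hne).1.1).1 hsub
  have hmax : maximalIdeal R ∈ minimalPrimes R := by
    obtain rfl | hJ := Set.mem_insert_iff.1 hJ
    · have hbot : maximalIdeal R = ⊥ :=
        Submodule.eq_bot_of_le_smul_of_le_jacobson_bot (maximalIdeal R) _
          (IsNoetherian.noetherian _) (by simpa [pow_two] using hle) (maximalIdeal_le_jacobson _)
      exact ⟨⟨inferInstance, bot_le⟩, fun _ _ _ ↦ hbot.trans_le bot_le⟩
    · have := hJ.1.1
      rwa [(maximalIdeal.isMaximal R).eq_of_le this.ne_top hle]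
  rw [← maximalIdeal_height_eq_ringKrullDim, Ideal.height_eq_zero_iff.2 hmax] at hdim
  exact lt_irrefl _ hdim

theorem exists_isRegular_of_span_eq_maximalIdeal (d : ℕ) : ∀ (R : Type u) [CommRing R]
    [IsLocalRing R] [IsNoetherianRing R] (s : Finset R),
    Ideal.span (s : Set R) = maximalIdeal R → s.card ≤ d → (d : WithBot ℕ∞) ≤ ringKrullDim R →
    IsDomain R ∧ ∃ rs : List R, rs.length = d ∧ (∀ r ∈ rs, r ∈ maximalIdeal R) ∧
      IsRegular R rs := by
  classical
  induction d with
  | zero =>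
    intro R _ _ _ s hs hcard _
    have hbot : maximalIdeal R = ⊥ := by
      rw [← hs, Finset.card_eq_zero.1 (Nat.le_zero.1 hcard)]; simp
    have : (⊥ : Ideal R).IsPrime := hbot ▸ inferInstance
    exact ⟨IsDomain.of_bot_isPrime R, [], rfl, by simp, IsRegular.nil R R⟩
  | succ d ih =>
    intro R _ _ _ s hs hcard hdim
    obtain ⟨x, hx, hx2, hmin⟩ := exists_mem_maximalIdeal_notMem_sq_notMem_minimalPrimes
      (R := R) (lt_of_lt_of_le (by exact_mod_cast Nat.succ_pos d) hdim)
    obtain ⟨y, hy, hyx⟩ := exists_mem_span_singleton_sup_erase hs hx hx2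
    have hne : Nontrivial (R ⧸ Ideal.span {x}) := Ideal.Quotient.nontrivial_iff.2
      (ne_top_of_le_ne_top (maximalIdeal.isMaximal R).ne_top
        ((Ideal.span_singleton_le_iff_mem _).2 hx))
    have hlocal : IsLocalRing (R ⧸ Ideal.span {x}) :=
      IsLocalRing.of_surjective' _ Ideal.Quotient.mk_surjective
    have hcomap : (maximalIdeal (R ⧸ Ideal.span {x})).comap
        (Ideal.Quotient.mk (Ideal.span {x})) = maximalIdeal R :=
      eq_maximalIdeal (Ideal.comap_isMaximal_of_surjective _ Ideal.Quotient.mk_surjective)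
    have hmap : (maximalIdeal R).map (Ideal.Quotient.mk (Ideal.span {x})) =
        maximalIdeal (R ⧸ Ideal.span {x}) := by
      rw [← hcomap, Ideal.map_comap_of_surjective _ Ideal.Quotient.mk_surjective]
    have hspan : Ideal.span (((s.erase y).image (Ideal.Quotient.mk (Ideal.span {x})) :
        Finset (R ⧸ Ideal.span {x})) : Set (R ⧸ Ideal.span {x})) = maximalIdeal _ := by
      rw [Finset.coe_image, ← Ideal.map_span, ← hmap]
      refine le_antisymm (Ideal.map_mono ?_) ?_
      · rw [← hs]
        exact Ideal.span_mono (by simp)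
      · have hle : maximalIdeal R ≤
            Ideal.span {x} ⊔ Ideal.span ((s.erase y : Finset R) : Set R) := by
          rw [← hs, Ideal.span_le]
          intro z hz
          by_cases hzy : z = y
          · exact hzy ▸ hyx
          · exact Ideal.mem_sup_right (Ideal.subset_span (by simpa [hzy] using hz))
        refine (Ideal.map_mono hle).trans ?_
        rw [Ideal.map_sup, Ideal.map_quotient_self, bot_sup_eq]
    obtain ⟨hdom, rs, hlen, hmem, hreg⟩ := ih (R ⧸ Ideal.span {x})
      ((s.erase y).image (Ideal.Quotient.mk (Ideal.span {x}))) hspan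
      (Finset.card_image_le.trans (by rw [Finset.card_erase_of_mem hy]; omega))
      (by
        have h1 := hdim.trans (ringKrullDim_le_ringKrullDim_quotSMulTop_succ hx)
        rw [← Submodule.ideal_span_singleton_smul, smul_eq_mul, Ideal.mul_top] at h1
        push_cast at h1
        exact ENat.WithBot.add_le_add_one_right_iff.1 h1)
    have hR := isDomain_of_isDomain_quotient_span_singleton hx hmin
    have hx0 : x ≠ 0 := fun h ↦ hx2 (h ▸ zero_mem _)
    refine ⟨hR, ?_⟩
    obtain ⟨rs, rfl⟩ := List.map_surjective_iff.2
      (Ideal.Quotient.mk_surjective (I := Ideal.span {x})) rs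
    refine ⟨x :: rs, by simpa using hlen, ?_, ?_⟩
    · simp only [List.mem_cons, forall_eq_or_imp]
      refine ⟨hx, fun r hr ↦ ?_⟩
      rw [← hcomap]
      exact hmem _ (List.mem_map_of_mem hr)
    · refine (isRegular_cons_iff R x rs).2 ⟨fun a b h ↦ mul_left_cancel₀ hx0 h, ?_⟩
      have hx_top : x • (⊤ : Submodule R R) = Ideal.span {x} := by
        rw [← Submodule.ideal_span_singleton_smul, smul_eq_mul, Ideal.mul_top]
      refine ((Submodule.quotEquivOfEq _ _ hx_top).toAddEquiv.isRegular_congr ?_).2 hreg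
      refine List.forall₂_map_right_iff.2 (List.forall₂_same.2 fun r _ z ↦ ?_)
      obtain ⟨z, rfl⟩ := Submodule.mkQ_surjective _ z
      rfl

end RegularLocal

section CoordinatePrimes

variable {k σ : Type*} [Field k]

lemma ker_aeval_ite_eq_span_X_image (T : Set σ) [DecidablePred (· ∈ T)] :
    RingHom.ker (aeval fun v ↦ if v ∈ T then 0 else X v :
      MvPolynomial σ k →ₐ[k] MvPolynomial σ k) = Ideal.span (X '' T) := by
  set φ : MvPolynomial σ k →ₐ[k] MvPolynomial σ k := aeval fun v ↦ if v ∈ T then 0 else X v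
  have hφ : (Ideal.Quotient.mkₐ k (Ideal.span (X '' T))).comp φ =
      Ideal.Quotient.mkₐ k (Ideal.span (X '' T)) := by
    refine MvPolynomial.algHom_ext fun v ↦ ?_
    by_cases hv : v ∈ T
    · have : Ideal.Quotient.mk (Ideal.span (X '' T)) (X v : MvPolynomial σ k) = 0 :=
        Ideal.Quotient.eq_zero_iff_mem.2 (Ideal.subset_span ⟨v, hv, rfl⟩)
      simp [φ, hv, this]
    · simp [φ, hv]
  refine le_antisymm (fun f hf ↦ ?_) (Ideal.span_le.2 ?_)
  · rw [← Ideal.Quotient.eq_zero_iff_mem, ← Ideal.Quotient.mkₐ_eq_mk k, ← hφ]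
    simp [(RingHom.mem_ker).1 hf]
  · rintro _ ⟨v, hv, rfl⟩
    simp [φ, hv]

instance isPrime_span_X_image (T : Set σ) :
    (Ideal.span (X '' T : Set (MvPolynomial σ k))).IsPrime := by
  classical
  rw [← ker_aeval_ite_eq_span_X_image]
  exact RingHom.ker_isPrime _

lemma X_mem_span_X_image_iff {T : Set σ} {w : σ} :
    (X w : MvPolynomial σ k) ∈ Ideal.span (X '' T) ↔ w ∈ T := by
  classical
  rw [← ker_aeval_ite_eq_span_X_image, RingHom.mem_ker]
  by_cases hw : w ∈ T <;> simp [hw]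

lemma prod_X_mem_span_X_image_iff {T : Set σ} {F : Finset σ} :
    ∏ v ∈ F, (X v : MvPolynomial σ k) ∈ Ideal.span (X '' T) ↔ ∃ v ∈ F, v ∈ T := by
  simp [Ideal.IsPrime.prod_mem_iff, X_mem_span_X_image_iff]

end CoordinatePrimes

section CoordinateQuotients

open IsLocalRing

lemma extVanishing_self_of_isRegularLocalRing (A : Type u) [CommRing A] [IsRegularLocalRing A] :
    ExtVanishing (maximalIdeal A) (maximalIdeal A).spanFinrank A := by
  obtain ⟨s, hcard, hs⟩ := Submodule.FG.exists_span_finset_card_eq_spanFinrank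
    (IsNoetherian.noetherian (maximalIdeal A))
  obtain ⟨-, rs, hlen, hmem, hreg⟩ := exists_isRegular_of_span_eq_maximalIdeal _ A s hs
    hcard.le IsRegularLocalRing.spanFinrank_maximalIdeal.le
  exact ExtVanishing.of_le_depthIn (le_sSup ⟨rs, hmem, hreg, by rw [hlen]⟩)

lemma extVanishing_localized_quotient_bot {R : Type u} [CommRing R] (p : Ideal R) [p.IsPrime]
    [IsRegularLocalRing (Localization p.primeCompl)] :
    ExtVanishing (maximalIdeal (Localization p.primeCompl))
      (maximalIdeal (Localization p.primeCompl)).spanFinrank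
      (LocalizedModule p.primeCompl (R ⧸ (⊥ : Ideal R))) := by
  refine (extVanishing_self_of_isRegularLocalRing (Localization p.primeCompl)).of_linearEquiv ?_
  exact (IsLocalizedModule.linearEquiv p.primeCompl
    (Algebra.linearMap R (Localization p.primeCompl))
    (LocalizedModule.mkLinearMap p.primeCompl (R ⧸ (⊥ : Ideal R)) ∘ₗ
      (Submodule.quotEquivOfEqBot (⊥ : Ideal R) rfl).symm.toLinearMap)).extendScalarsOfIsLocalization
        p.primeCompl (Localization p.primeCompl)

lemma extVanishing_localized_quotient_span_X_image {k : Type u} [Field k] {n : ℕ}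
    (p : Ideal (MvPolynomial (Fin n) k)) [p.IsPrime] (T : Finset (Fin n)) (t : ℕ)
    (h : t + T.card ≤ (maximalIdeal (Localization p.primeCompl)).spanFinrank) :
    ExtVanishing (maximalIdeal (Localization p.primeCompl)) t
      (LocalizedModule p.primeCompl
        (MvPolynomial (Fin n) k ⧸
          (Ideal.span (X '' (T : Set (Fin n))) : Ideal (MvPolynomial (Fin n) k)))) := by
  classical
  induction T using Finset.induction_on generalizing t with
  | empty =>
    rw [Finset.coe_empty, Set.image_empty, Ideal.span_empty]
    have : IsRegularLocalRing (Localization p.primeCompl) :=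
      IsRegularRing.isRegularLocalRing_localization p
    exact (extVanishing_localized_quotient_bot p).mono (by simpa using h)
  | insert w T hw ih =>
    rw [Finset.card_insert_of_notMem hw] at h
    rw [Finset.coe_insert, Set.image_insert_eq, Set.insert_eq, Ideal.span_union, sup_comm]
    refine extVanishing_localized_quotient_sup_span p (fun a ↦ ⟨fun ha ↦ ?_, fun ha ↦ ?_⟩)
      (ih (t + 1) (by omega)) (ih t (by omega))
    · exact (Ideal.IsPrime.mem_or_mem inferInstance ha).resolve_right
        fun hX ↦ hw (Finset.mem_coe.1 (X_mem_span_X_image_iff.1 hX))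
    · exact Ideal.mul_mem_right _ _ ha

end CoordinateQuotients

section StanleyReisner

variable {k : Type u} [Field k] {σ : Type*} {Δ Γ : Set (Finset σ)}

lemma prod_X_mem_srIdeal_s1 {F : Finset σ} (hF : F ∉ Δ) :
    ∏ v ∈ F, (X v : MvPolynomial σ k) ∈ srIdeal k Δ :=
  Ideal.subset_span ⟨F, hF, rfl⟩

lemma srIdeal_anti (h : Γ ⊆ Δ) : srIdeal k Δ ≤ srIdeal k Γ :=
  Ideal.span_mono fun _ ⟨F, hF, hm⟩ ↦ ⟨F, fun hF' ↦ hF (h hF'), hm⟩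

lemma srIdeal_diff_singleton (F : Finset σ) :
    srIdeal k (Δ \ {F}) = srIdeal k Δ ⊔ Ideal.span {∏ v ∈ F, X v} := by
  rw [srIdeal, srIdeal, ← Ideal.span_union]
  congr 1
  ext m
  simp only [Set.mem_sdiff, Set.mem_singleton_iff, Set.mem_ofPred_eq, Set.mem_union]
  constructor
  · rintro ⟨G, hG, rfl⟩
    by_cases h : G = F
    · exact Or.inr (by rw [h])
    · exact Or.inl ⟨G, fun h' ↦ hG ⟨h', h⟩, rfl⟩
  · rintro (⟨G, hG, rfl⟩ | rfl)
    · exact ⟨G, fun h ↦ hG h.1, rfl⟩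
    · exact ⟨F, fun h ↦ h.2 rfl, rfl⟩

lemma srIdeal_le_span_X_image_compl (hΔ : IsComplex Δ) {F : Finset σ} (hF : F ∈ Δ) :
    srIdeal k Δ ≤ Ideal.span (X '' (F : Set σ)ᶜ) := by
  refine Ideal.span_le.2 ?_
  rintro _ ⟨G, hG, rfl⟩
  refine prod_X_mem_span_X_image_iff.2 ?_
  by_contra! h
  exact hG (hΔ F hF G fun v hv ↦ by simpa using h v hv)

lemma mul_prod_X_mem_srIdeal_iff (hΔ : IsComplex Δ) {F : Finset σ} (hF : IsFacet Δ F)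
    (a : MvPolynomial σ k) :
    a * ∏ v ∈ F, X v ∈ srIdeal k Δ ↔ a ∈ Ideal.span (X '' (F : Set σ)ᶜ) := by
  classical
  refine ⟨fun h ↦ ?_, fun h ↦ ?_⟩
  · refine (Ideal.IsPrime.mem_or_mem inferInstance
      (srIdeal_le_span_X_image_compl hΔ hF.1 h)).resolve_right fun h ↦ ?_
    obtain ⟨v, hv, hv'⟩ := prod_X_mem_span_X_image_iff.1 h
    exact hv' hv
  · induction h using Submodule.span_induction with
    | mem a ha =>
      obtain ⟨v, hv, rfl⟩ := ha
      rw [← Finset.prod_insert (fun h ↦ hv h)]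
      refine prod_X_mem_srIdeal_s1 fun h ↦ hv ?_
      rw [hF.2 _ h (Finset.subset_insert _ _)]
      exact Finset.mem_insert_self _ _
    | zero => simp
    | add a b _ _ ha hb => rw [add_mul]; exact add_mem ha hb
    | smul c a _ ha => rw [smul_eq_mul, mul_assoc]; exact Ideal.mul_mem_left _ _ ha

end StanleyReisner

section Faces

open IsLocalRing

variable {k : Type u} [Field k] {n : ℕ} (p : Ideal (MvPolynomial (Fin n) k)) [p.IsPrime]

lemma extVanishing_localized_quotient_srIdeal_of_subset {Δ Γ : Set (Finset (Fin n))}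
    (hΔ : IsComplex Δ) (hΓ : IsComplex Γ) (hsub : Γ ⊆ Δ) {t : ℕ}
    (hcard : ∀ F ∈ Δ \ Γ,
      t + 1 + Fᶜ.card ≤ (maximalIdeal (Localization p.primeCompl)).spanFinrank)
    (h : ExtVanishing (maximalIdeal (Localization p.primeCompl)) t
      (LocalizedModule p.primeCompl (MvPolynomial (Fin n) k ⧸ srIdeal k Δ))) :
    ExtVanishing (maximalIdeal (Localization p.primeCompl)) t
      (LocalizedModule p.primeCompl (MvPolynomial (Fin n) k ⧸ srIdeal k Γ)) := by
  induction hN : (Δ \ Γ).ncard generalizing Δ with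
  | zero =>
    rw [Set.ncard_eq_zero (Set.toFinite _), Set.sdiff_eq_empty] at hN
    rwa [hsub.antisymm hN]
  | succ N ih =>
    have hne : (Δ \ Γ).Nonempty := by
      rw [← Set.ncard_pos (Set.toFinite _), hN]; omega
    obtain ⟨F, hF, hmax⟩ := Set.exists_max_image (Δ \ Γ) Finset.card (Set.toFinite _) hne
    have hfacet : IsFacet Δ F := ⟨hF.1, fun G hG hFG ↦ Finset.eq_of_subset_of_card_le hFG
      (hmax G ⟨hG, fun hG' ↦ hF.2 (hΓ G hG' F hFG)⟩)⟩
    refine ih (Δ := Δ \ {F}) ?_ ?_ (fun G hG ↦ hcard G ⟨hG.1.1, hG.2⟩) ?_ ?_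
    · rintro G ⟨hG, hGF⟩ H hHG
      refine ⟨hΔ G hG H hHG, ?_⟩
      rintro rfl
      exact hGF (hfacet.2 G hG hHG).symm
    · exact fun G hG ↦ ⟨hsub hG, fun hGF ↦ hF.2 (hGF ▸ hG)⟩
    · rw [srIdeal_diff_singleton]
      refine extVanishing_localized_quotient_sup_span p (mul_prod_X_mem_srIdeal_iff hΔ hfacet)
        ?_ h
      rw [← Finset.coe_compl]
      exact extVanishing_localized_quotient_span_X_image p _ _ (hcard F hF)
    · rw [sdiff_right_comm, Set.ncard_sdiff_singleton_of_mem hF, hN]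
      rfl

end Faces

section Dimension

lemma exists_isPrime_height_add_le_of_le_ringKrullDim_quotient {A : Type*} [CommRing A]
    {I : Ideal A} {t : ℕ} (h : (t : WithBot ℕ∞) ≤ ringKrullDim (A ⧸ I)) :
    ∃ Q : Ideal A, Q.IsPrime ∧ I ≤ Q ∧ ((Q.height + t : ℕ∞) : WithBot ℕ∞) ≤ ringKrullDim A := by
  obtain ⟨l, hl⟩ := Order.le_krullDim_iff.1 h
  have hmono : StrictMono (PrimeSpectrum.comap (Ideal.Quotient.mk I)) :=
    fun P Q hPQ ↦ lt_of_le_of_ne (Ideal.comap_mono hPQ.le)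
      ((PrimeSpectrum.comap_injective_of_surjective _ Ideal.Quotient.mk_surjective).ne hPQ.ne)
  set q := PrimeSpectrum.comap (Ideal.Quotient.mk I) l.head
  have hq : (t : ℕ∞) ≤ Order.coheight q := by
    rw [← hl]
    exact Order.length_le_coheight_head (p := l.map _ hmono)
  refine ⟨q.asIdeal, q.2, fun a ha ↦ ?_, ?_⟩
  · change Ideal.Quotient.mk I a ∈ l.head.asIdeal
    rw [Ideal.Quotient.eq_zero_iff_mem.2 ha]
    exact zero_mem _
  · have : Nonempty (PrimeSpectrum A) := ⟨q⟩
    rw [PrimeSpectrum.height_eq_orderHeight, ringKrullDim,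
      Order.krullDim_eq_iSup_height_add_coheight_of_nonempty, WithBot.coe_le_coe]
    exact le_trans (by gcongr) (le_iSup (fun a ↦ Order.height a + Order.coheight a) q)

lemma card_le_height_span_X_image {k σ : Type*} [Field k] (T : Finset σ) :
    (T.card : ℕ∞) ≤ (Ideal.span (X '' (T : Set σ) : Set (MvPolynomial σ k))).height := by
  classical
  induction T using Finset.induction_on with
  | empty => simp
  | insert w T hw ih =>
    rw [Finset.card_insert_of_notMem hw]
    push_cast
    refine le_trans (by gcongr) (Ideal.height_add_one_le_of_lt_of_isPrime
      (I := Ideal.span (X '' (T : Set σ))) (lt_of_le_of_ne (Ideal.span_mono ?_) fun h ↦ hw ?_))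
    · exact Set.image_mono (Set.subset_insert _ _)
    · rw [← Finset.mem_coe, ← X_mem_span_X_image_iff (k := k), h]
      exact Ideal.subset_span ⟨w, Set.mem_insert _ _, rfl⟩

lemma exists_natCast_eq_min_mDim (A M : Type*) [CommRing A] [AddCommGroup M] [Module A M]
    [Nontrivial M] (r : ℕ) :
    ∃ t : ℕ, (t : WithBot ℕ∞) = min ((r : ℕ∞) : WithBot ℕ∞) (mDim A M) := by
  have : Nontrivial (A ⧸ Module.annihilator A M) := Ideal.Quotient.nontrivial_iff.2
    fun h ↦ not_subsingleton M (Module.annihilator_eq_top_iff.1 h)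
  have h0 : (0 : WithBot ℕ∞) ≤ mDim A M := ringKrullDim_nonneg_of_nontrivial
  generalize mDim A M = d at h0
  induction d with
  | bot => exact absurd h0 (by simp)
  | coe d =>
    obtain ⟨t, ht⟩ := ENat.ne_top_iff_exists.1
      (ne_top_of_le_ne_top (ENat.natCast_ne_top r) (min_le_left (r : ℕ∞) d))
    exact ⟨t, by rw [← WithBot.coe_min, ← ht]; rfl⟩

lemma mDim_le_of_surjective {A M N : Type*} [CommRing A] [AddCommGroup M] [Module A M]
    [AddCommGroup N] [Module A N] (f : M →ₗ[A] N) (hf : Function.Surjective f) :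
    mDim A N ≤ mDim A M :=
  ringKrullDim_le_of_surjective (Ideal.Quotient.factor (f.annihilator_le_of_surjective hf))
    (Ideal.Quotient.factor_surjective _)

lemma exists_mem_add_card_compl_le {k : Type*} [Field k] {n : ℕ}
    (p : Ideal (MvPolynomial (Fin n) k)) [p.IsPrime] {Γ : Set (Finset (Fin n))} {t : ℕ}
    (h : (t : WithBot ℕ∞) ≤ mDim (Localization p.primeCompl)
      (LocalizedModule p.primeCompl (MvPolynomial (Fin n) k ⧸ srIdeal k Γ))) :
    ∃ G ∈ Γ, ((t + Gᶜ.card : ℕ) : WithBot ℕ∞) ≤ ringKrullDim (Localization p.primeCompl) := by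
  classical
  obtain ⟨Q, hQ, hle, hheight⟩ := exists_isPrime_height_add_le_of_le_ringKrullDim_quotient h
  set q := Q.under (MvPolynomial (Fin n) k)
  have hsr : srIdeal k Γ ≤ q := by
    intro a ha
    refine hle (Module.mem_annihilator.2 fun m ↦ ?_)
    induction m using LocalizedModule.induction_on with
    | h m s =>
      obtain ⟨m, rfl⟩ := Submodule.Quotient.mk_surjective _ m
      rw [algebraMap_smul, LocalizedModule.smul'_mk, ← Submodule.Quotient.mk_smul,
        (Submodule.Quotient.mk_eq_zero _).2
          (smul_eq_mul a m ▸ Ideal.mul_mem_right m _ ha : a • m ∈ srIdeal k Γ),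
        LocalizedModule.zero_mk]
  refine ⟨Finset.univ.filter fun v ↦ X v ∉ q, ?_, ?_⟩
  · by_contra hG
    obtain ⟨v, hv, hvq⟩ := (Ideal.IsPrime.prod_mem_iff).1 (hsr (prod_X_mem_srIdeal_s1 hG))
    exact (Finset.mem_filter.1 hv).2 hvq
  · refine le_trans ?_ hheight
    rw [← IsLocalization.height_under p.primeCompl Q, add_comm]
    have : (Finset.univ.filter fun v ↦ X v ∉ q)ᶜ.card ≤ q.height := by
      refine (card_le_height_span_X_image (k := k) _).trans (Ideal.height_mono ?_)
      rw [Ideal.span_le]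
      rintro _ ⟨v, hv, rfl⟩
      simpa using hv
    exact_mod_cast add_le_add_left this (t : ℕ∞)

end Dimension

lemma IsComplex.skeleton {V : Type*} {Δ : Set (Finset V)} (hΔ : IsComplex Δ) (i : ℕ) :
    IsComplex (skeleton Δ i) :=
  fun F hF G hG ↦ ⟨hΔ F hF.1 G hG, (Finset.card_le_card hG).trans hF.2⟩

/-- **Skeletons of `S_r` complexes are `S_r`.**
Let `Δ` be a simplicial complex on `[n]` and let `i`, `r` be integers with
`2 ≤ r ≤ i + 1`.  If `Δ` satisfies Serre's condition `S_r` over a field `k`, then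
the `i`-skeleton `Δ⁽ⁱ⁾` also satisfies Serre's condition `S_r` over `k`. -/
theorem isSerreComplex_skeleton (k : Type*) [Field k] (n i r : ℕ)
    (Δ : Set (Finset (Fin n))) (hcomplex : IsComplex Δ)
    (hr2 : 2 ≤ r) (hri : r ≤ i + 1) (hserre : IsSerreComplex k Δ r) :
    IsSerreComplex k (skeleton Δ i) r := by
  intro p _
  have hsub : skeleton Δ i ⊆ Δ := Set.sep_subset _ _
  have hΓ := hcomplex.skeleton i
  set Γ := skeleton Δ i
  have : IsRegularLocalRing (Localization p.primeCompl) :=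
    IsRegularRing.isRegularLocalRing_localization p
  let f := LocalizedModule.map p.primeCompl (Submodule.factor (srIdeal_anti (k := k) hsub))
  have hf : Function.Surjective f :=
    LocalizedModule.map_surjective _ _ (Submodule.factor_surjective _)
  have hp : p.map (algebraMap _ (Localization p.primeCompl)) =
      IsLocalRing.maximalIdeal (Localization p.primeCompl) :=
    Localization.AtPrime.map_eq_maximalIdeal
  rcases subsingleton_or_nontrivial
    (LocalizedModule p.primeCompl (MvPolynomial (Fin n) k ⧸ srIdeal k Γ)) with hM | hM
  · have : mDim (Localization p.primeCompl)
        (LocalizedModule p.primeCompl (MvPolynomial (Fin n) k ⧸ srIdeal k Γ)) = ⊥ := by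
      rw [mDim, Module.annihilator_eq_top_iff.2 hM]
      exact ringKrullDim_eq_bot_of_subsingleton
    rw [this]
    exact (min_le_right _ _).trans bot_le
  have hN : Nontrivial (LocalizedModule p.primeCompl (MvPolynomial (Fin n) k ⧸ srIdeal k Δ)) :=
    hf.nontrivial
  obtain ⟨t, ht⟩ := exists_natCast_eq_min_mDim (Localization p.primeCompl)
    (LocalizedModule p.primeCompl (MvPolynomial (Fin n) k ⧸ srIdeal k Γ)) r
  obtain ⟨G, hG, hGt⟩ := exists_mem_add_card_compl_le p (ht.trans_le (min_le_right _ _))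
  rw [← IsRegularLocalRing.spanFinrank_maximalIdeal] at hGt
  replace hGt : t + Gᶜ.card ≤
      (IsLocalRing.maximalIdeal (Localization p.primeCompl)).spanFinrank := by
    exact_mod_cast hGt
  have hΔt := (ht.trans_le (min_le_min_left _ (mDim_le_of_surjective f hf))).trans (hserre p)
  rw [hp] at hΔt
  rw [hp, ← ht]
  have key := extVanishing_localized_quotient_srIdeal_of_subset p hcomplex hΓ hsub
    (t := t) (fun F hF ↦ ?_) (ExtVanishing.of_le_depthIn (by exact_mod_cast hΔt))
  · exact_mod_cast key.le_depthIn
  · have h1 : G.card ≤ i + 1 := hG.2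
    have h2 : ¬ F.card ≤ i + 1 := fun h ↦ hF.2 ⟨hF.1, h⟩
    have h3 := F.card_le_univ
    rw [Finset.card_compl] at hGt ⊢
    omega

end SeqSr
end

section
/- Let Δ be a simplicial complex on [n] and r ≥ 2 an integer. Then Δ satisfies Serre's condition S_r over a field k if and only if Δ is sequentially S_r over k and Δ is pure. -/
open MvPolynomial

namespace SeqSr

/-! ### Stanley-Reisner ideals and face primes -/

/-- The prime ideal generated by the variables outside `G`. -/
noncomputable def facePrime (k : Type*) [Field k] {V : Type*} (G : Finset V) :
    Ideal (MvPolynomial V k) :=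
  Ideal.span (X '' {i : V | i ∉ G})

section FacePrime

variable {k : Type*} [Field k] {V : Type*}

lemma mem_facePrime {G : Finset V} {f : MvPolynomial V k} :
    f ∈ facePrime k G ↔ ∀ m ∈ f.support, ¬ m.support ⊆ G := by
  simp [facePrime, mem_ideal_span_X_image, Finset.subset_iff, and_comm]

lemma X_mem_facePrime {G : Finset V} {i : V} :
    (X i : MvPolynomial V k) ∈ facePrime k G ↔ i ∉ G := by
  rw [mem_facePrime, support_X]
  simp [Finsupp.support_single]

lemma facePrime_anti {G H : Finset V} (h : G ⊆ H) : facePrime k H ≤ facePrime k G := fun _ hf ↦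
  mem_facePrime.2 fun m hm hmG ↦ mem_facePrime.1 hf m hm (hmG.trans h)

lemma facePrime_lt_facePrime {G H : Finset V} (h : G ⊂ H) :
    facePrime k H < facePrime k G := by
  obtain ⟨i, hi, hiG⟩ := Finset.exists_of_ssubset h
  exact lt_of_le_of_ne (facePrime_anti h.subset) fun he ↦
    X_mem_facePrime.1 (he ▸ X_mem_facePrime.2 hiG : (X i : MvPolynomial V k) ∈ facePrime k H) hi

instance facePrime_isPrime (G : Finset V) : (facePrime k G).IsPrime := by
  classical
  let φ : MvPolynomial V k →ₐ[k] MvPolynomial V k := aeval fun i ↦ if i ∈ G then X i else 0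
  have hker : facePrime k G = RingHom.ker φ := by
    apply le_antisymm
    · rw [facePrime, Ideal.span_le]
      rintro _ ⟨i, hi, rfl⟩
      simpa [φ, RingHom.mem_ker] using fun h ↦ absurd h hi
    · intro f hf
      have hφ : (Ideal.Quotient.mkₐ k (facePrime k G)).comp φ =
          Ideal.Quotient.mkₐ k (facePrime k G) := by
        ext i
        by_cases hi : i ∈ G
        · simp [φ, hi]
        · simpa [φ, hi] using (Ideal.Quotient.eq_zero_iff_mem.2 (X_mem_facePrime.2 hi)).symm
      have := DFunLike.congr_fun hφ f
      rw [AlgHom.comp_apply, show φ f = 0 from hf, map_zero] at this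
      exact Ideal.Quotient.eq_zero_iff_mem.1 this.symm
  rw [hker]
  exact RingHom.ker_isPrime _

lemma mem_srIdeal {Δ : Set (Finset V)} (hΔ : IsComplex Δ) {f : MvPolynomial V k} :
    f ∈ srIdeal k Δ ↔ ∀ m ∈ f.support, m.support ∉ Δ := by
  classical
  have hset : {m : MvPolynomial V k | ∃ F : Finset V, F ∉ Δ ∧ m = ∏ i ∈ F, X i} =
      (fun s ↦ monomial s (1 : k)) ''
        ((fun F : Finset V ↦ ∑ i ∈ F, Finsupp.single i 1) '' Δᶜ) := by
    ext m
    simp only [Set.mem_ofPred_eq, Set.mem_image, Set.mem_compl_iff, exists_exists_and_eq_and]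
    refine exists_congr fun F ↦ and_congr_right fun _ ↦ ?_
    rw [monomial_sum_one, eq_comm]
    rfl
  have hle (F : Finset V) (m : V →₀ ℕ) :
      ∑ i ∈ F, Finsupp.single i 1 ≤ m ↔ F ⊆ m.support := by
    simp only [Finsupp.le_def, Finsupp.finsetSum_apply, Finsupp.single_apply,
      Finset.sum_ite_eq', Finset.subset_iff, Finsupp.mem_support_iff]
    refine forall_congr' fun i ↦ ?_
    split_ifs with h <;> simp [h, Nat.one_le_iff_ne_zero]
  rw [srIdeal, hset, mem_ideal_span_monomial_image]
  refine forall₂_congr fun m _ ↦ ?_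
  simp only [Set.mem_image, Set.mem_compl_iff, exists_exists_and_eq_and, hle]
  exact ⟨fun ⟨F, hF, hFm⟩ hm ↦ hF (hΔ _ hm _ hFm), fun h ↦ ⟨_, h, subset_rfl⟩⟩

lemma isHomogeneousIdeal_srIdeal {Δ : Set (Finset V)} (hΔ : IsComplex Δ) :
    IsHomogeneousIdeal k (srIdeal k Δ) := fun f hf i ↦ by
  rw [mem_srIdeal hΔ] at hf ⊢
  refine fun m hm ↦ hf m ?_
  rw [mem_support_iff, coeff_homogeneousComponent] at hm
  exact mem_support_iff.2 fun h ↦ hm (by simp [h])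

lemma srIdeal_le_facePrime {Δ : Set (Finset V)} (hΔ : IsComplex Δ) {G : Finset V} (hG : G ∈ Δ) :
    srIdeal k Δ ≤ facePrime k G := fun _ hf ↦
  mem_facePrime.2 fun m hm hmG ↦ (mem_srIdeal hΔ).1 hf m hm (hΔ _ hG _ hmG)

lemma exists_isFacet_superset [Finite V] {Δ : Set (Finset V)} {F : Finset V} (hF : F ∈ Δ) :
    ∃ G, IsFacet Δ G ∧ F ⊆ G := by
  obtain ⟨G, hFG, hG⟩ := (Set.toFinite Δ).exists_le_maximal hF
  exact ⟨G, ⟨hG.prop, fun H hH hGH ↦ hG.eq_of_le hH hGH⟩, hFG⟩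

lemma mem_srIdeal_of_forall_facePrime [Finite V] {Δ : Set (Finset V)} (hΔ : IsComplex Δ)
    {f : MvPolynomial V k} (hf : ∀ G, IsFacet Δ G → f ∈ facePrime k G) : f ∈ srIdeal k Δ := by
  refine (mem_srIdeal hΔ).2 fun m hm hmΔ ↦ ?_
  obtain ⟨G, hG, hmG⟩ := exists_isFacet_superset hmΔ
  exact mem_facePrime.1 (hf G hG) m hm hmG

lemma exists_facePrime_le [Finite V] {Δ : Set (Finset V)} (hΔ : IsComplex Δ)
    {Q : Ideal (MvPolynomial V k)} [hQ : Q.IsPrime] (hIQ : srIdeal k Δ ≤ Q) :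
    ∃ G, IsFacet Δ G ∧ facePrime k G ≤ Q := by
  have hfin : {G | IsFacet Δ G}.Finite := Set.toFinite _
  have : hfin.toFinset.inf (facePrime k) ≤ Q := fun f hf ↦ hIQ <|
    mem_srIdeal_of_forall_facePrime hΔ fun G hG ↦
      (Finset.inf_le (f := facePrime k) (hfin.mem_toFinset.2 hG)) hf
  obtain ⟨G, hG, hGQ⟩ := (Ideal.IsPrime.inf_le' hQ).1 this
  exact ⟨G, hfin.mem_toFinset.1 hG, hGQ⟩

lemma ringKrullDim_quotient_facePrime_eq [Finite V] {G H : Finset V} (h : G.card = H.card) :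
    ringKrullDim (MvPolynomial V k ⧸ facePrime k G) =
      ringKrullDim (MvPolynomial V k ⧸ facePrime k H) := by
  classical
  obtain ⟨σ, hσ⟩ : ∃ σ : Equiv.Perm V, ∀ i, σ i ∈ H ↔ i ∈ G := by
    let e : {i // i ∈ G} ≃ {i // i ∈ H} := Finset.equivOfCardEq h
    refine ⟨e.extendSubtype, fun i ↦ ⟨fun hi ↦ ?_, fun hi ↦ e.extendSubtype_mem i hi⟩⟩
    by_contra hiG
    exact e.extendSubtype_not_mem i hiG hi
  let e : MvPolynomial V k ≃+* MvPolynomial V k := (renameEquiv k σ).toRingEquiv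
  refine ringKrullDim_eq_of_ringEquiv (Ideal.quotientEquiv _ _ e ?_)
  rw [facePrime, facePrime, Ideal.map_span, ← Set.image_comp]
  congr 1
  ext f
  constructor
  · rintro ⟨i, hi, rfl⟩
    exact ⟨σ.symm i, by simpa [← hσ] using hi, by simp [e]⟩
  · rintro ⟨i, hi, rfl⟩
    exact ⟨σ i, by simpa [hσ] using hi, by simp [e]⟩

end FacePrime

/-! ### Dimension -/

lemma mDim_eq_bot {A M : Type*} [CommRing A] [AddCommGroup M] [Module A M] [Subsingleton M] :
    mDim A M = ⊥ := by
  have : Subsingleton (A ⧸ Module.annihilator A M) :=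
    Ideal.Quotient.subsingleton_iff.2 (Module.annihilator_eq_top_iff.2 inferInstance)
  exact ringKrullDim_eq_bot_of_subsingleton

lemma ringKrullDim_quotient_anti {A : Type*} [CommRing A] {I J : Ideal A} (h : I ≤ J) :
    ringKrullDim (A ⧸ J) ≤ ringKrullDim (A ⧸ I) :=
  ringKrullDim_le_of_surjective _ (Ideal.Quotient.factor_surjective h)

lemma two_le_mDim {A M : Type*} [CommRing A] [AddCommGroup M] [Module A M]
    {q₀ q₁ q₂ : PrimeSpectrum A} (h₀ : Module.annihilator A M ≤ q₀.asIdeal)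
    (h₁ : q₀ < q₁) (h₂ : q₁ < q₂) : 2 ≤ mDim A M := by
  rw [mDim, ringKrullDim_quotient]
  let Z := PrimeSpectrum.zeroLocus (Module.annihilator A M : Set A)
  let x₀ : Z := ⟨q₀, h₀⟩
  let x₁ : Z := ⟨q₁, h₀.trans h₁.le⟩
  let x₂ : Z := ⟨q₂, h₀.trans (h₁.trans h₂).le⟩
  exact Order.LTSeries.length_le_krullDim (⟨2, ![x₀, x₁, x₂], by
    simp only [Fin.forall_fin_two]
    exact ⟨h₁, h₂⟩⟩ : LTSeries Z)

lemma ringKrullDim_quotient_le_of_forall_prime {A : Type*} [CommRing A] {I : Ideal A}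
    {d : WithBot ℕ∞}
    (h : ∀ Q : Ideal A, Q.IsPrime → I ≤ Q → ∃ P : Ideal A, P ≤ Q ∧ ringKrullDim (A ⧸ P) ≤ d) :
    ringKrullDim (A ⧸ I) ≤ d := by
  rw [ringKrullDim_quotient]
  refine iSup_le fun s ↦ ?_
  obtain ⟨P, hPQ, hPd⟩ := h s.head.1.asIdeal s.head.1.isPrime s.head.2
  refine le_trans ?_ (ringKrullDim_quotient P ▸ hPd)
  have hs (i) : (s i).1 ∈ PrimeSpectrum.zeroLocus (P : Set A) :=
    hPQ.trans (s.head_le i)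
  exact Order.LTSeries.length_le_krullDim
    (⟨s.length, fun i ↦ ⟨(s i).1, hs i⟩, fun i ↦ s.step i⟩ :
      LTSeries (PrimeSpectrum.zeroLocus (P : Set A)))

/-! ### Invariance of Serre's condition -/

lemma isSerreMod_of_linearEquiv {r : ℕ} {A M N : Type*} [CommRing A] [AddCommGroup M]
    [Module A M] [AddCommGroup N] [Module A N] (e : M ≃ₗ[A] N) (h : IsSerreMod r A M) :
    IsSerreMod r A N := by
  intro p hp
  let e' : LocalizedModule p.primeCompl M ≃ₗ[Localization p.primeCompl]
      LocalizedModule p.primeCompl N :=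
    IsLocalizedModule.mapEquiv p.primeCompl (LocalizedModule.mkLinearMap _ M)
      (LocalizedModule.mkLinearMap _ N) _ e
  have hdim : mDim (Localization p.primeCompl) (LocalizedModule p.primeCompl M) =
      mDim (Localization p.primeCompl) (LocalizedModule p.primeCompl N) := by
    rw [mDim, mDim, e'.annihilator_eq]
  simpa only [hdim, depthIn, e'.isRegular_congr] using h p

lemma isSerreMod_of_subsingleton {r : ℕ} {A M : Type*} [CommRing A] [AddCommGroup M]
    [Module A M] [Subsingleton M] : IsSerreMod r A M := by
  intro p hp
  have : Subsingleton (LocalizedModule p.primeCompl M) := inferInstance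
  rw [mDim_eq_bot]
  simp

/-- The subquotient `A / I` of `A` is the quotient `A ⧸ I`. -/
noncomputable def subquotTopEquiv {A : Type*} [CommRing A] (I : Ideal A) :
    subquot I ⊤ ≃ₗ[A] (A ⧸ I) :=
  Submodule.Quotient.equiv _ _ Submodule.topEquiv (by
    ext x
    simp)

/-! ### Depth of a local module with decomposable punctured support -/

section Depth

open scoped Pointwise

variable {A M : Type*} [CommRing A] [AddCommGroup M] [Module A M]

lemma smul_eq_zero_of_mem_of_smul_eq_zero {𝔞 𝔟 : Ideal A} {e : M}
    (hinf : ∀ c ∈ 𝔞 ⊓ 𝔟, c • e = 0) {a b : A} (hb : b ∈ 𝔟)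
    (hreg : IsSMulRegular M (a + b)) (ha : a • e = 0) {c : A} (hc : c ∈ 𝔞) : c • e = 0 := by
  refine hreg.right_eq_zero_of_smul ?_
  have hcb : (b * c) • e = 0 := hinf _ ⟨Ideal.mul_mem_left _ _ hc, Ideal.mul_mem_right _ _ hb⟩
  rw [smul_smul, add_mul, add_smul, hcb, add_zero, mul_comm, mul_smul, ha, smul_zero]

/-- If the support of a cyclic module over a local ring is the union of two closed sets meeting
only in the closed point, then one of them is redundant as soon as there is a regular sequence of
length two. -/
lemma forall_smul_eq_zero_of_isSMulRegular [IsLocalRing A] {𝔞 𝔟 : Ideal A} {e : M}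
    (hgen : ∀ m : M, ∃ a : A, m = a • e) (hinf : ∀ c ∈ 𝔞 ⊓ 𝔟, c • e = 0)
    (ha : ∀ c : A, c • e = 0 → c ∈ 𝔞) {x y : A}
    (hx : x ∈ 𝔞 ⊔ 𝔟) (hy : y ∈ 𝔞 ⊔ 𝔟) (hxreg : IsSMulRegular M x)
    (hyreg : IsSMulRegular (QuotSMulTop x M) y) :
    (∀ c ∈ 𝔞, c • e = 0) ∨ ∀ c ∈ 𝔟, c • e = 0 := by
  obtain ⟨a, haa, b, hbb, rfl⟩ := Submodule.mem_sup.1 hx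
  obtain ⟨a', haa', b', hbb', rfl⟩ := Submodule.mem_sup.1 hy
  have hzero {c d : A} (hc : c ∈ 𝔞) (hd : d ∈ 𝔟) : (c * d) • e = 0 :=
    hinf _ ⟨Ideal.mul_mem_right _ _ hc, Ideal.mul_mem_left _ _ hd⟩
  have hmem : a • e ∈ (a + b) • (⊤ : Submodule A M) := by
    rw [← Submodule.Quotient.mk_eq_zero]
    refine hyreg.right_eq_zero_of_smul ?_
    rw [← Submodule.Quotient.mk_smul, Submodule.Quotient.mk_eq_zero,
      Submodule.mem_smul_pointwise_iff_exists]
    refine ⟨a' • e, trivial, ?_⟩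
    rw [smul_smul, smul_smul, ← sub_eq_zero, ← sub_smul,
      show (a + b) * a' - (a' + b') * a = a' * b - a * b' by ring, sub_smul,
      hzero haa' hbb, hzero haa hbb', sub_zero]
  obtain ⟨m, -, hm⟩ := Submodule.mem_smul_pointwise_iff_exists _ _ _ |>.1 hmem
  obtain ⟨s, rfl⟩ := hgen m
  have hrel : ((1 - s) * a - s * b) • e = 0 := by
    rw [show (1 - s) * a - s * b = a - (a + b) * s by ring, sub_smul, mul_smul, hm, sub_self]
  have hsb : (s * b) • e = 0 := by
    refine hinf _ ⟨?_, Ideal.mul_mem_left _ _ hbb⟩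
    simpa using 𝔞.sub_mem (𝔞.mul_mem_left (1 - s) haa) (ha _ hrel)
  have hsa : ((1 - s) * a) • e = 0 := by
    rwa [sub_smul, hsb, sub_zero] at hrel
  rcases IsLocalRing.isUnit_or_isUnit_one_sub_self s with hs | hs
  · right
    intro c hc
    rw [mul_smul, hs.smul_eq_zero] at hsb
    exact smul_eq_zero_of_mem_of_smul_eq_zero (fun c hc ↦ hinf c hc.symm) haa
      (add_comm a b ▸ hxreg) hsb hc
  · left
    intro c hc
    rw [mul_smul, hs.smul_eq_zero] at hsa
    exact smul_eq_zero_of_mem_of_smul_eq_zero hinf hbb hxreg hsa hc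

lemma exists_isSMulRegular_of_two_le_depthIn {I : Ideal A} (h : 2 ≤ depthIn A I M) :
    ∃ x ∈ I, ∃ y ∈ I, IsSMulRegular M x ∧ IsSMulRegular (QuotSMulTop x M) y := by
  obtain ⟨_, ⟨rs, hrs, hreg, rfl⟩, hlt⟩ :=
    lt_sSup_iff.1 (lt_of_lt_of_le (by norm_num : (1 : ℕ∞) < 2) h)
  match rs, hrs, hreg, hlt with
  | [], _, _, hlt => simp at hlt
  | [_], _, _, hlt => simp at hlt
  | x :: y :: rs, hrs, hreg, _ =>
    rw [RingTheory.Sequence.isRegular_cons_iff, RingTheory.Sequence.isRegular_cons_iff] at hreg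
    exact ⟨x, hrs x (by simp), y, hrs y (by simp), hreg.1, hreg.2.1⟩

end Depth

/-! ### Localizations of cyclic modules -/

section Localization

variable {A : Type*} [CommRing A] {I p : Ideal A} [p.IsPrime]

lemma smul_mk_one_eq_zero_iff {c : A} :
    algebraMap A (Localization p.primeCompl) c •
      (LocalizedModule.mk (Ideal.Quotient.mk I 1) 1 : LocalizedModule p.primeCompl (A ⧸ I)) = 0 ↔
      ∃ u ∉ p, u * c ∈ I := by
  rw [algebraMap_smul, LocalizedModule.smul'_mk, ← LocalizedModule.zero_mk 1, LocalizedModule.mk_eq]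
  simp only [one_smul, smul_zero, Subtype.exists, Submonoid.mk_smul]
  refine exists_congr fun u ↦ ?_
  rw [← Ideal.Quotient.eq_zero_iff_mem (I := I), exists_prop]
  refine and_congr_right fun _ ↦ ?_
  simp [Algebra.smul_def]

lemma exists_eq_smul_mk_one (m : LocalizedModule p.primeCompl (A ⧸ I)) :
    ∃ c : Localization p.primeCompl, m = c • LocalizedModule.mk (Ideal.Quotient.mk I 1) 1 := by
  induction m using LocalizedModule.induction_on with | h m s
  obtain ⟨a, rfl⟩ := Ideal.Quotient.mk_surjective m
  refine ⟨Localization.mk a s, ?_⟩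
  rw [LocalizedModule.mk_smul_mk, mul_one]
  congr 1
  simp [Algebra.smul_def]

lemma annihilator_localizedModule_le {P : Ideal A} (hIP : I ≤ P) [hP : P.IsPrime] (hPp : P ≤ p)
    {q : Ideal (Localization p.primeCompl)} (hq : q.under A = P) :
    Module.annihilator (Localization p.primeCompl) (LocalizedModule p.primeCompl (A ⧸ I)) ≤ q := by
  rw [← IsLocalization.map_under p.primeCompl _ (Module.annihilator _ _), Ideal.map_le_iff_le_comap]
  intro c hc
  obtain ⟨u, hu, huc⟩ := smul_mk_one_eq_zero_iff.1 (Module.mem_annihilator.1 hc _)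
  have hcP := (hP.mem_or_mem (hIP huc)).resolve_left fun h ↦ hu (hPp h)
  exact hq.ge hcP

lemma two_le_mDim_localizedModule {P₀ P₁ : Ideal A} [hP₀ : P₀.IsPrime] [hP₁ : P₁.IsPrime]
    (hI : I ≤ P₀) (h₀ : P₀ < P₁) (h₁ : P₁ < p) :
    2 ≤ mDim (Localization p.primeCompl) (LocalizedModule p.primeCompl (A ⧸ I)) := by
  let e := (IsLocalization.AtPrime.primeSpectrumOrderIso (Localization p.primeCompl) p).symm
  let c₀ : Set.Iic (⟨p, ‹_›⟩ : PrimeSpectrum A) := ⟨⟨P₀, hP₀⟩, (h₀.trans h₁).le⟩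
  let c₁ : Set.Iic (⟨p, ‹_›⟩ : PrimeSpectrum A) := ⟨⟨P₁, hP₁⟩, h₁.le⟩
  let c₂ : Set.Iic (⟨p, ‹_›⟩ : PrimeSpectrum A) := ⟨⟨p, ‹_›⟩, le_refl p⟩
  have h01 : c₀ < c₁ := h₀
  have h12 : c₁ < c₂ := h₁
  refine two_le_mDim (q₀ := e c₀) ?_ (e.lt_iff_lt.2 h01) (e.lt_iff_lt.2 h12)
  exact annihilator_localizedModule_le hI (h₀.trans h₁).le
    (congrArg (fun c ↦ c.1.asIdeal) (e.symm_apply_apply c₀))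

/-- If locally at `p` the ideal `I` is an intersection `𝔞 ∩ 𝔟` with `𝔞 + 𝔟 ⊇ p`, and neither of
them is redundant, then `A ⧸ I` has depth at most one at `p`. -/
lemma not_two_le_depthIn {𝔞 𝔟 : Ideal A} (hIa : ∀ c, ∀ u ∉ p, u * c ∈ I → c ∈ 𝔞)
    (hinf : ∀ c ∈ 𝔞 ⊓ 𝔟, ∃ u ∉ p, u * c ∈ I) (hsup : p ≤ 𝔞 ⊔ 𝔟)
    {a b : A} (haa : a ∈ 𝔞) (ha : ∀ u ∉ p, u * a ∉ I) (hbb : b ∈ 𝔟) (hb : ∀ u ∉ p, u * b ∉ I) :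
    ¬ 2 ≤ depthIn (Localization p.primeCompl)
      (Ideal.map (algebraMap A (Localization p.primeCompl)) p)
      (LocalizedModule p.primeCompl (A ⧸ I)) := by
  intro hdepth
  obtain ⟨x, hx, y, hy, hxreg, hyreg⟩ := exists_isSMulRegular_of_two_le_depthIn hdepth
  let φ := algebraMap A (Localization p.primeCompl)
  have hmap : p.map φ ≤ 𝔞.map φ ⊔ 𝔟.map φ := by
    rw [← Ideal.map_sup]
    exact Ideal.map_mono hsup
  have key := forall_smul_eq_zero_of_isSMulRegular (𝔞 := 𝔞.map φ) (𝔟 := 𝔟.map φ)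
    exists_eq_smul_mk_one (fun c hc ↦ ?_) (fun c hc ↦ ?_) (hmap hx) (hmap hy) hxreg hyreg
  · rcases key with h | h
    · obtain ⟨u, hu, hua⟩ := smul_mk_one_eq_zero_iff.1 (h _ (Ideal.mem_map_of_mem φ haa))
      exact ha u hu hua
    · obtain ⟨u, hu, hub⟩ := smul_mk_one_eq_zero_iff.1 (h _ (Ideal.mem_map_of_mem φ hbb))
      exact hb u hu hub
  · rw [← IsLocalization.map_inf p.primeCompl] at hc
    have hle : (𝔞 ⊓ 𝔟).map φ ≤ LinearMap.ker (LinearMap.toSpanSingleton _ _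
        (LocalizedModule.mk (Ideal.Quotient.mk I 1) 1 : LocalizedModule p.primeCompl (A ⧸ I))) :=
      Ideal.map_le_iff_le_comap.2 fun d hd ↦ smul_mk_one_eq_zero_iff.2 (hinf d hd)
    exact hle hc
  · obtain ⟨c, s, rfl⟩ := IsLocalization.exists_mk'_eq p.primeCompl c
    have : φ c • (LocalizedModule.mk (Ideal.Quotient.mk I 1) 1 :
        LocalizedModule p.primeCompl (A ⧸ I)) = 0 := by
      rw [← IsLocalization.mk'_spec' (Localization p.primeCompl) c s, mul_smul, hc, smul_zero]
    obtain ⟨u, hu, huc⟩ := smul_mk_one_eq_zero_iff.1 this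
    exact (IsLocalization.mk'_mem_map_algebraMap_iff p.primeCompl _ _ _ _).2
      ⟨1, p.primeCompl.one_mem, by simpa using hIa c u hu huc⟩

end Localization

/-! ### Purity of complexes satisfying Serre's condition -/

section Pure

variable {k : Type*} [Field k] {V : Type*} [Finite V] {Δ : Set (Finset V)}

lemma exists_maximal_not_isPure (h : ¬ IsPure Δ) :
    ∃ F G H, IsFacet Δ G ∧ IsFacet Δ H ∧ F ⊆ G ∧ F ⊆ H ∧ G.card < H.card ∧
      ∀ F', F ⊂ F' → ∀ G' H', IsFacet Δ G' → IsFacet Δ H' → F' ⊆ G' → F' ⊆ H' →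
        G'.card = H'.card := by
  let S : Set (Finset V) :=
    {F | ∃ G H, IsFacet Δ G ∧ IsFacet Δ H ∧ F ⊆ G ∧ F ⊆ H ∧ G.card ≠ H.card}
  have hS : S.Nonempty := by
    simp only [IsPure, not_forall] at h
    obtain ⟨G, H, hG, hH, hne⟩ := h
    exact ⟨∅, G, H, hG, hH, G.empty_subset, H.empty_subset, hne⟩
  obtain ⟨F, ⟨G, H, hG, hH, hFG, hFH, hne⟩, hmax⟩ := (Set.toFinite S).exists_maximal hS
  have hF' (F') (hF' : F ⊂ F') (G' H') (hG' : IsFacet Δ G') (hH' : IsFacet Δ H')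
      (hFG' : F' ⊆ G') (hFH' : F' ⊆ H') : G'.card = H'.card := by
    by_contra hne'
    exact hF'.not_subset (hmax ⟨G', H', hG', hH', hFG', hFH', hne'⟩ hF'.subset)
  rcases hne.lt_or_gt with hlt | hlt
  · exact ⟨F, G, H, hG, hH, hFG, hFH, hlt, hF'⟩
  · exact ⟨F, H, G, hH, hG, hFH, hFG, hlt, hF'⟩

lemma isPure_of_isSerreComplex (hΔ : IsComplex Δ) {r : ℕ} (hr : 2 ≤ r)
    (h : IsSerreComplex k Δ r) : IsPure Δ := by
  classical
  by_contra hpure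
  obtain ⟨F, G, H, hG, hH, hFG, hFH, hlt, hmax⟩ := exists_maximal_not_isPure hpure
  have hFGss : F ⊂ G := hFG.ssubset_of_ne fun he ↦
    hlt.ne (congrArg Finset.card (hG.2 H hH.1 (he ▸ hFH)))
  have hFHss : F ⊂ H := hFH.ssubset_of_ne fun he ↦ by
    have := Finset.card_le_card hFG
    rw [he] at this
    exact this.not_gt hlt
  have hdisj {G' H' : Finset V} (hG' : IsFacet Δ G') (hH' : IsFacet Δ H') (hFG' : F ⊆ G')
      (hFH' : F ⊆ H') (hne : G'.card ≠ H'.card) {i : V} (hi : i ∉ F) (hiG : i ∈ G') :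
      i ∉ H' := fun hiH ↦ hne <|
    hmax (insert i F) (Finset.ssubset_insert hi) G' H' hG' hH'
      (Finset.insert_subset hiG hFG') (Finset.insert_subset hiH hFH')
  let 𝔞 : Ideal (MvPolynomial V k) :=
    ⨅ (G' : Finset V) (_ : IsFacet Δ G' ∧ F ⊆ G' ∧ G'.card = G.card), facePrime k G'
  let 𝔟 : Ideal (MvPolynomial V k) :=
    ⨅ (H' : Finset V) (_ : IsFacet Δ H' ∧ F ⊆ H' ∧ H'.card ≠ G.card), facePrime k H'
  have mem_a {f} : f ∈ 𝔞 ↔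
      ∀ G', IsFacet Δ G' ∧ F ⊆ G' ∧ G'.card = G.card → f ∈ facePrime k G' := by
    simp only [𝔞, Submodule.mem_iInf]
  have mem_b {f} : f ∈ 𝔟 ↔
      ∀ H', IsFacet Δ H' ∧ F ⊆ H' ∧ H'.card ≠ G.card → f ∈ facePrime k H' := by
    simp only [𝔟, Submodule.mem_iInf]
  have hnot {G' : Finset V} (hG' : IsFacet Δ G') (hFG' : F ⊆ G') {f u : MvPolynomial V k}
      (hu : u ∉ facePrime k F) (huf : u * f ∈ srIdeal k Δ) : f ∈ facePrime k G' :=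
    ((facePrime_isPrime G').mem_or_mem (srIdeal_le_facePrime hΔ hG'.1 huf)).resolve_left
      fun h ↦ hu (facePrime_anti hFG' h)
  obtain ⟨j, hjG, hjF⟩ := Finset.exists_of_ssubset hFGss
  obtain ⟨i, hiH, hiF⟩ := Finset.exists_of_ssubset hFHss
  have hdepth := not_two_le_depthIn (I := srIdeal k Δ) (p := facePrime k F) (𝔞 := 𝔞) (𝔟 := 𝔟)
    (a := X i) (b := X j)
    (fun c u hu huc ↦ mem_a.2 fun G' hG' ↦ hnot hG'.1 hG'.2.1 hu huc)
    (fun c hc ↦ ?_) ?_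
    (mem_a.2 fun G' hG' ↦ X_mem_facePrime.2 <|
      hdisj hH hG'.1 hFH hG'.2.1 (hG'.2.2 ▸ hlt.ne') hiF hiH)
    (fun u hu hui ↦ X_mem_facePrime.1 (hnot hH hFH hu hui) hiH)
    (mem_b.2 fun H' hH' ↦ X_mem_facePrime.2 <|
      hdisj hG hH'.1 hFG hH'.2.1 hH'.2.2.symm hjF hjG)
    (fun u hu huj ↦ X_mem_facePrime.1 (hnot hG hFG hu huj) hjG)
  · have hss : insert i F ⊂ H := by
      refine (Finset.insert_subset hiH hFH).ssubset_of_ne fun he ↦ ?_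
      have h₁ := Finset.card_lt_card hFGss
      rw [← he, Finset.card_insert_of_notMem hiF] at hlt
      omega
    have hdim := two_le_mDim_localizedModule (srIdeal_le_facePrime hΔ hH.1)
      (facePrime_lt_facePrime (k := k) hss)
      (facePrime_lt_facePrime (k := k) (Finset.ssubset_insert hiF))
    have hr' : ((2 : ℕ∞) : WithBot ℕ∞) ≤ ((r : ℕ∞) : WithBot ℕ∞) :=
      WithBot.coe_le_coe.2 (by exact_mod_cast hr)
    exact hdepth (WithBot.coe_le_coe.1 ((le_min hr' hdim).trans (h (facePrime k F))))
  · refine ⟨∏ v ∈ F, X v, fun hmem ↦ ?_, mem_srIdeal_of_forall_facePrime hΔ fun G' hG' ↦ ?_⟩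
    · obtain ⟨v, hv, hvF⟩ := ((facePrime_isPrime F).prod_mem_iff).1 hmem
      exact X_mem_facePrime.1 hvF hv
    · by_cases hFG' : F ⊆ G'
      · refine Ideal.mul_mem_left _ _ ?_
        by_cases hcard : G'.card = G.card
        · exact mem_a.1 hc.1 G' ⟨hG', hFG', hcard⟩
        · exact mem_b.1 hc.2 G' ⟨hG', hFG', hcard⟩
      · obtain ⟨v, hv, hvG'⟩ := Finset.not_subset.1 hFG'
        exact Ideal.mul_mem_right _ _ <|
          Ideal.mem_of_dvd _ (Finset.dvd_prod_of_mem _ hv) (X_mem_facePrime.2 hvG')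
  · refine Ideal.span_le.2 ?_
    rintro _ ⟨v, hvF, rfl⟩
    by_cases hv : (X v : MvPolynomial V k) ∈ 𝔞
    · exact Ideal.mem_sup_left hv
    · refine Ideal.mem_sup_right (mem_b.2 fun H' hH' ↦ X_mem_facePrime.2 ?_)
      simp only [mem_a, X_mem_facePrime, not_forall, not_not] at hv
      obtain ⟨G', hG', hvG'⟩ := hv
      exact hdisj hG'.1 hH'.1 hG'.2.1 hH'.2.1 (hG'.2.2 ▸ hH'.2.2.symm) hvF hvG'

end Pure

/-! ### Dimensions of subquotients of pure Stanley-Reisner rings -/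

lemma mDim_subquot_le {A : Type*} [CommRing A] {I J J' : Ideal A} (hIJ : I ≤ J) :
    mDim A (subquot J J') ≤ ringKrullDim (A ⧸ I) := by
  refine ringKrullDim_quotient_anti fun a ha ↦ Module.mem_annihilator.2 fun m ↦ ?_
  obtain ⟨x, rfl⟩ := Submodule.Quotient.mk_surjective _ m
  rw [← Submodule.Quotient.mk_smul, Submodule.Quotient.mk_eq_zero]
  exact J.mul_mem_right _ (hIJ ha)

lemma ringKrullDim_le_mDim_subquot {k : Type*} [Field k] {V : Type*} [Finite V]
    {Δ : Set (Finset V)} (hΔ : IsComplex Δ) (hpure : IsPure Δ) {J : Ideal (MvPolynomial V k)}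
    (hJ : srIdeal k Δ < J) :
    ringKrullDim (MvPolynomial V k ⧸ srIdeal k Δ) ≤
      mDim (MvPolynomial V k) (subquot (srIdeal k Δ) J) := by
  obtain ⟨f, hfJ, hf⟩ := SetLike.exists_of_lt hJ
  obtain ⟨G, hG, hfG⟩ : ∃ G, IsFacet Δ G ∧ f ∉ facePrime k G := by
    by_contra! h
    exact hf (mem_srIdeal_of_forall_facePrime hΔ h)
  calc ringKrullDim (MvPolynomial V k ⧸ srIdeal k Δ)
      ≤ ringKrullDim (MvPolynomial V k ⧸ facePrime k G) := by
        refine ringKrullDim_quotient_le_of_forall_prime fun Q hQ hIQ ↦ ?_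
        obtain ⟨H, hH, hHQ⟩ := exists_facePrime_le hΔ hIQ
        exact ⟨_, hHQ, (ringKrullDim_quotient_facePrime_eq (hpure H G hH hG)).le⟩
    _ ≤ _ := ringKrullDim_quotient_anti fun a ha ↦ by
        have haf := Module.mem_annihilator.1 ha (Submodule.Quotient.mk ⟨f, hfJ⟩)
        rw [← Submodule.Quotient.mk_smul, Submodule.Quotient.mk_eq_zero] at haf
        exact ((facePrime_isPrime G).mem_or_mem
          (srIdeal_le_facePrime hΔ hG.1 haf)).resolve_right hfG

/-- **`S_r` = sequentially `S_r` + pure.**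
Let `Δ` be a simplicial complex on `[n]` and `r ≥ 2` an integer.  Then `Δ` satisfies
Serre's condition `S_r` over a field `k` if and only if `Δ` is sequentially `S_r`
over `k` and `Δ` is pure. -/
theorem isSerreComplex_iff_isSeqSerre_and_isPure (k : Type*) [Field k] (n r : ℕ)
    (Δ : Set (Finset (Fin n))) (hcomplex : IsComplex Δ) (hr : 2 ≤ r) :
    IsSerreComplex k Δ r ↔ (IsSeqSerre k Δ r ∧ IsPure Δ) := by
  constructor
  · refine fun h ↦ ⟨?_, isPure_of_isSerreComplex hcomplex hr h⟩
    by_cases hI : srIdeal k Δ = ⊤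
    · exact ⟨0, fun _ ↦ srIdeal k Δ, rfl, hI, fun _ _ ↦ isHomogeneousIdeal_srIdeal hcomplex,
        by simp, by simp, by simp⟩
    · refine ⟨1, fun i ↦ if i = 0 then srIdeal k Δ else ⊤, rfl, rfl, fun i _ ↦ ?_, ?_, ?_, ?_⟩
      · by_cases hi : i = 0
        · simpa [hi] using isHomogeneousIdeal_srIdeal hcomplex
        · simp [hi, IsHomogeneousIdeal]
      · simpa using lt_top_iff_ne_top.2 hI
      · intro i hi
        obtain rfl : i = 0 := by omega
        exact isSerreMod_of_linearEquiv (subquotTopEquiv _).symm h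
      · omega
  · rintro ⟨⟨t, J, h0, ht, -, hlt, hserre, hdim⟩, hpure⟩
    match t with
    | 0 =>
      have : Subsingleton (MvPolynomial (Fin n) k ⧸ srIdeal k Δ) :=
        Ideal.Quotient.subsingleton_iff.2 (h0.symm.trans ht)
      exact isSerreMod_of_subsingleton
    | 1 =>
      have := hserre 0 one_pos
      rw [h0, zero_add, ht] at this
      exact isSerreMod_of_linearEquiv (subquotTopEquiv _) this
    | t + 2 =>
      have hJ := h0 ▸ hlt 0 (by omega)
      have hdim := hdim 0 (by omega)
      rw [h0] at hdim
      exact absurd (hdim.trans_le (mDim_subquot_le hJ.le))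
        (ringKrullDim_le_mDim_subquot hcomplex hpure hJ).not_gt

end SeqSr
end

section
/- Let I be an ideal of R = k[x_1,…,x_n] generated by squarefree monomials and r ≥ 1 an integer. Then I is componentwise linear in the first r steps if and only if I is squarefree componentwise linear in the first r steps. -/
open MvPolynomial

namespace SeqSr

/-! ### Resolutions which are linear in the first `r` steps -/

/-- A homogeneous ideal `I` of the polynomial ring is *linear in the first `r`
steps* if, for some integer `d`, the graded Betti numbers satisfy
`β_{i,i+t}(I) = 0` for all `0 ≤ i < r` and all `t ≠ d`.  Equivalently (and this is
how we state it), there is a partial graded free resolution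
`F_{r-1} → ⋯ → F_1 → F_0 → I → 0`, exact at `F_0, …, F_{r-2}`, in which `F_0` is
free on generators mapping to homogeneous elements of degree `d` of `I` and the
entries of the matrices of the maps `F_{i+1} → F_i` in the given bases are
homogeneous of degree `1`. -/
def IdealLinearFirstSteps (k : Type*) [Field k] {V : Type*}
    (I : Ideal (MvPolynomial V k)) (r : ℕ) : Prop :=
  ∃ (d : ℕ) (ι : ℕ → Type)
    (φ0 : ((ι 0) →₀ MvPolynomial V k) →ₗ[MvPolynomial V k] MvPolynomial V k)
    (φ : ∀ i : ℕ, ((ι (i + 1)) →₀ MvPolynomial V k) →ₗ[MvPolynomial V k]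
      ((ι i) →₀ MvPolynomial V k)),
    LinearMap.range φ0 = I ∧
    (∀ a : ι 0, (φ0 (Finsupp.single a 1)).IsHomogeneous d) ∧
    (∀ i : ℕ, i + 2 ≤ r → ∀ (a : ι (i + 1)) (b : ι i),
      ((φ i) (Finsupp.single a 1) b).IsHomogeneous 1) ∧
    (2 ≤ r → LinearMap.ker φ0 = LinearMap.range (φ 0)) ∧
    (∀ i : ℕ, i + 3 ≤ r → LinearMap.ker (φ i) = LinearMap.range (φ (i + 1)))

/-- `I_{⟨j⟩}`: the ideal generated by all homogeneous elements of degree `j`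
belonging to `I`. -/
noncomputable def idealComponent (k : Type*) [Field k] {V : Type*}
    (I : Ideal (MvPolynomial V k)) (j : ℕ) : Ideal (MvPolynomial V k) :=
  Ideal.span {f | f ∈ I ∧ f.IsHomogeneous j}

/-- `I` is componentwise linear in the first `r` steps: for every `j ≥ 0` the ideal
`I_{⟨j⟩}` is linear in the first `r` steps. -/
def ComponentwiseLinearFirstSteps (k : Type*) [Field k] {V : Type*}
    (I : Ideal (MvPolynomial V k)) (r : ℕ) : Prop :=
  ∀ j : ℕ, IdealLinearFirstSteps k (idealComponent k I j) r

/-- `I_{[j]}`: the ideal generated by the squarefree monomials of degree `j`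
belonging to `I`. -/
noncomputable def sqfreeComponent (k : Type*) [Field k] {V : Type*}
    (I : Ideal (MvPolynomial V k)) (j : ℕ) : Ideal (MvPolynomial V k) :=
  Ideal.span {f | f ∈ I ∧ ∃ F : Finset V, F.card = j ∧ f = ∏ i ∈ F, X i}

/-- `I` is squarefree componentwise linear in the first `r` steps: for every `j`
the ideal `I_{[j]}` is linear in the first `r` steps. -/
def SqfreeComponentwiseLinearFirstSteps (k : Type*) [Field k] {V : Type*}
    (I : Ideal (MvPolynomial V k)) (r : ℕ) : Prop :=
  ∀ j : ℕ, IdealLinearFirstSteps k (sqfreeComponent k I j) r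

/-! ### The Koszul differential -/

/-- The sign of the vertex `v` relative to the face `G` in the Koszul differential. -/
def koszulSign {n : ℕ} (v : Fin n) (G : Finset (Fin n)) : ℤ :=
  (-1) ^ (G.filter (· < v)).card

theorem koszulSign_mul_self {n : ℕ} (v : Fin n) (G : Finset (Fin n)) :
    koszulSign v G * koszulSign v G = 1 := by
  rw [koszulSign, ← pow_add, ← two_mul, pow_mul]
  simp

theorem koszulSign_insert {n : ℕ} {u v : Fin n} {G : Finset (Fin n)} (hu : u ∉ G) :
    koszulSign v (insert u G) = if u < v then -koszulSign v G else koszulSign v G := by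
  unfold koszulSign
  rw [Finset.filter_insert]
  split_ifs with h
  · rw [Finset.card_insert_of_notMem (by simp [hu]), pow_succ]
    ring
  · rfl

theorem koszulSign_swap {n : ℕ} {u v : Fin n} {G : Finset (Fin n)} (hu : u ∉ G) (hv : v ∉ G)
    (huv : u ≠ v) :
    koszulSign v G * koszulSign u (insert v G) = -(koszulSign u G * koszulSign v (insert u G)) := by
  rw [koszulSign_insert hu, koszulSign_insert hv]
  rcases lt_or_gt_of_ne huv with h | h
  · simp [h, h.not_gt, mul_comm]
  · simp [h, h.not_gt, mul_comm]

/-- The Koszul differential of the sequence `x` with coefficients in `M`; a chain assigns a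
coefficient in `M` to each exterior monomial, i.e. to each finite set of indices. -/
def koszulD {n : ℕ} {A M : Type*} [CommRing A] [AddCommGroup M] [Module A M] (x : Fin n → A)
    (z : Finset (Fin n) → M) (G : Finset (Fin n)) : M :=
  ∑ v ∈ Gᶜ, koszulSign v G • x v • z (insert v G)

section Koszul

variable {n : ℕ} {A M : Type*} [CommRing A] [AddCommGroup M] [Module A M] (x : Fin n → A)

theorem koszulD_sub (z w : Finset (Fin n) → M) :
    koszulD x (fun G => z G - w G) = fun G => koszulD x z G - koszulD x w G := by
  funext G
  simp only [koszulD, smul_sub, Finset.sum_sub_distrib]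

theorem map_koszulD {B N : Type*} [CommRing B] [AddCommGroup N] [Module B N] {y : Fin n → B}
    {f g : M →+ N} (hfg : ∀ v m, f (x v • m) = y v • g m) (z : Finset (Fin n) → M)
    (G : Finset (Fin n)) :
    f (koszulD x z G) = koszulD y (fun H => g (z H)) G := by
  simp only [koszulD, map_sum, map_zsmul, hfg]

theorem koszulD_mem (N : Submodule A M) {z : Finset (Fin n) → M} (hz : ∀ G, z G ∈ N)
    (G : Finset (Fin n)) : koszulD x z G ∈ N :=
  N.sum_mem fun _ _ => zsmul_mem (N.smul_mem _ (hz _)) _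

theorem koszulD_koszulD (z : Finset (Fin n) → M) (G : Finset (Fin n)) :
    koszulD x (koszulD x z) G = 0 := by
  have key : koszulD x (koszulD x z) G = ∑ p ∈ (Gᶜ ×ˢ Gᶜ).filter (fun p => p.1 ≠ p.2),
      (koszulSign p.1 G * koszulSign p.2 (insert p.1 G)) •
        (x p.1 * x p.2) • z (insert p.2 (insert p.1 G)) := by
    rw [Finset.sum_filter, Finset.sum_product]
    refine Finset.sum_congr rfl fun v hv => ?_
    rw [koszulD, ← Finset.sum_filter, Finset.smul_sum, Finset.smul_sum]
    refine Finset.sum_congr ?_ fun u _ => ?_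
    · ext u
      simp only [Finset.mem_compl, Finset.mem_insert, Finset.mem_filter]
      grind
    · rw [mul_smul, mul_smul, smul_comm (x v) (koszulSign u _)]
  rw [key]
  refine Finset.sum_involution (fun p _ => (p.2, p.1)) ?_ ?_ ?_ ?_
  · rintro ⟨v, u⟩ hp
    simp only [Finset.mem_filter, Finset.mem_product, Finset.mem_compl, ne_eq] at hp
    simp only
    rw [koszulSign_swap hp.1.2 hp.1.1 (Ne.symm hp.2), Finset.insert_comm u v G, mul_comm (x u),
      neg_smul, neg_add_cancel]
  · rintro ⟨v, u⟩ hp - h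
    simp only [Finset.mem_filter, ne_eq] at hp
    exact hp.2 (Prod.ext_iff.1 h).2
  · rintro ⟨v, u⟩ hp
    simp only [Finset.mem_filter, Finset.mem_product, ne_eq] at hp ⊢
    exact ⟨hp.1.symm, Ne.symm hp.2⟩
  · rintro ⟨v, u⟩ _
    rfl

/-- The part of a chain in homological degree `i`. -/
def chainPart (i : ℕ) (z : Finset (Fin n) → M) (G : Finset (Fin n)) : M :=
  if G.card = i then z G else 0

theorem koszulD_chainPart (i : ℕ) (z : Finset (Fin n) → M) :
    koszulD x (chainPart (i + 1) z) = chainPart i (koszulD x z) := by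
  funext G
  simp only [chainPart, koszulD]
  split_ifs with h
  · refine Finset.sum_congr rfl fun v hv => ?_
    rw [if_pos (by rw [Finset.card_insert_of_notMem (Finset.mem_compl.1 hv), h])]
  · refine Finset.sum_eq_zero fun v hv => ?_
    rw [if_neg, smul_zero, smul_zero]
    rwa [Finset.card_insert_of_notMem (Finset.mem_compl.1 hv), Nat.add_right_cancel_iff]

theorem koszulD_eq_zero_of_card {i : ℕ} {z : Finset (Fin n) → M}
    (hz : ∀ G, G.card ≠ i + 1 → z G = 0) (G : Finset (Fin n)) (hG : G.card ≠ i) :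
    koszulD x z G = 0 := by
  refine Finset.sum_eq_zero fun v hv => ?_
  rw [hz, smul_zero, smul_zero]
  rwa [Finset.card_insert_of_notMem (Finset.mem_compl.1 hv), ne_eq, Nat.add_right_cancel_iff]

/-- The cone over a simplicial chain with apex `v`. -/
def coneChain (v : Fin n) (c : Finset (Fin n) → M) (G : Finset (Fin n)) : M :=
  if v ∈ G then koszulSign v (G.erase v) • c (G.erase v) else 0

theorem koszulD_coneChain (v : Fin n) {c : Finset (Fin n) → M}
    (hc : koszulD (fun _ => (1 : A)) c = 0) : koszulD (fun _ => (1 : A)) (coneChain v c) = c := by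
  funext G
  simp only [koszulD, one_smul]
  by_cases hv : v ∈ G
  · have h := congrFun hc (G.erase v)
    simp only [koszulD, one_smul, Pi.zero_apply] at h
    have hcompl : (G.erase v)ᶜ = insert v Gᶜ := by
      ext u
      simp only [Finset.mem_compl, Finset.mem_erase, Finset.mem_insert]
      tauto
    rw [hcompl, Finset.sum_insert (by simpa using hv), Finset.insert_erase hv] at h
    have h2 := congrArg (koszulSign v (G.erase v) • ·) h
    simp only [smul_add, smul_zero, smul_smul, koszulSign_mul_self, one_smul,
      Finset.smul_sum] at h2
    rw [← sub_eq_zero, ← neg_eq_zero, neg_sub, ← h2, sub_eq_add_neg, ← Finset.sum_neg_distrib]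
    congr 1
    refine Finset.sum_congr rfl fun u hu => ?_
    have huG : u ∉ G := Finset.mem_compl.1 hu
    have huv : u ≠ v := fun h => huG (h ▸ hv)
    have hue : (insert u G).erase v = insert u (G.erase v) := by
      rw [Finset.erase_insert_of_ne huv]
    rw [coneChain, if_pos (Finset.mem_insert_of_mem hv), hue, smul_smul, ← neg_smul]
    congr 1
    have h1 := koszulSign_swap (u := u) (v := v) (G := G.erase v)
      (fun h => huG (Finset.mem_of_mem_erase h)) (Finset.notMem_erase v G) huv
    rw [Finset.insert_erase hv] at h1
    have hs := koszulSign_mul_self v (G.erase v)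
    have ht := koszulSign_mul_self v (insert u (G.erase v))
    generalize koszulSign v (G.erase v) = a at *
    generalize koszulSign v (insert u (G.erase v)) = b at *
    linear_combination (-(a * b)) * h1 + koszulSign u G * b * hs +
      a * koszulSign u (G.erase v) * ht
  · rw [Finset.sum_eq_single_of_mem v (Finset.mem_compl.2 hv)]
    · rw [coneChain, if_pos (Finset.mem_insert_self v G), Finset.erase_insert hv, smul_smul,
        koszulSign_mul_self, one_smul]
    · intro u _ huv
      rw [coneChain, if_neg, smul_zero]
      simp [hv, Ne.symm huv]

end Koszul

/-! ### Multigraded strands of the Koszul complex -/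

/-- The exponent vector of the squarefree monomial with support `G`. -/
noncomputable def indExp {n : ℕ} (G : Finset (Fin n)) : Fin n →₀ ℕ :=
  ∑ i ∈ G, Finsupp.single i 1

theorem indExp_apply {n : ℕ} (G : Finset (Fin n)) (v : Fin n) :
    indExp G v = if v ∈ G then 1 else 0 := by
  simp [indExp, Finsupp.finsetSum_apply, Finsupp.single_apply]

theorem indExp_insert {n : ℕ} {G : Finset (Fin n)} {v : Fin n} (hv : v ∉ G) :
    indExp (insert v G) = Finsupp.single v 1 + indExp G := by
  rw [indExp, Finset.sum_insert hv, indExp]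

theorem degree_indExp {n : ℕ} (G : Finset (Fin n)) : (indExp G).degree = G.card := by
  simp [indExp, map_sum]

theorem support_indExp {n : ℕ} (G : Finset (Fin n)) : (indExp G).support = G := by
  ext v
  simp [indExp_apply]

section Strand

variable {k : Type*} [Field k] {n : ℕ}

theorem prod_X_eq_monomial (G : Finset (Fin n)) :
    ∏ i ∈ G, (X i : MvPolynomial (Fin n) k) = monomial (indExp G) 1 := by
  rw [indExp, monomial_sum_one]
  rfl

/-- The strand of a Koszul chain over the polynomial ring in multidegree `a`. -/
noncomputable def strand (a : Fin n →₀ ℕ) (z : Finset (Fin n) → MvPolynomial (Fin n) k)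
    (G : Finset (Fin n)) : k :=
  open Classical in if indExp G ≤ a then coeff (a - indExp G) (z G) else 0

theorem strand_add_indExp (b : Fin n →₀ ℕ) (z : Finset (Fin n) → MvPolynomial (Fin n) k)
    (G : Finset (Fin n)) : strand (b + indExp G) z G = coeff b (z G) := by
  rw [strand, if_pos le_add_self, add_tsub_cancel_right]

theorem exists_of_strand_ne_zero {a : Fin n →₀ ℕ} {z : Finset (Fin n) → MvPolynomial (Fin n) k}
    {G : Finset (Fin n)} (h : strand a z G ≠ 0) : ∃ b ∈ (z G).support, b + indExp G = a := by
  unfold strand at h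
  split_ifs at h with hG
  · exact ⟨a - indExp G, mem_support_iff.2 h, tsub_add_cancel_of_le hG⟩
  · exact absurd rfl h

theorem strand_ext {z w : Finset (Fin n) → MvPolynomial (Fin n) k}
    (h : ∀ a, strand a z = strand a w) : z = w := by
  funext G
  ext b
  rw [← strand_add_indExp, ← strand_add_indExp, h]

theorem koszulD_strand (a : Fin n →₀ ℕ) (z : Finset (Fin n) → MvPolynomial (Fin n) k) :
    koszulD (fun _ => (1 : k)) (strand a z) =
      strand a (koszulD (X : Fin n → MvPolynomial (Fin n) k) z) := by
  funext G
  by_cases hG : indExp G ≤ a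
  · rw [strand, if_pos hG]
    simp only [koszulD, coeff_sum, smul_eq_mul, one_mul]
    refine Finset.sum_congr rfl fun v hv => ?_
    have hv' : v ∉ G := Finset.mem_compl.1 hv
    have hcoeff (p : MvPolynomial (Fin n) k) (m : ℤ) (b : Fin n →₀ ℕ) :
        coeff b (m • p) = m • coeff b p := map_zsmul (coeffAddMonoidHom b) m p
    rw [hcoeff, coeff_X_mul', strand]
    have hle : indExp (insert v G) ≤ a ↔ v ∈ (a - indExp G).support := by
      rw [indExp_insert hv', ← le_tsub_iff_right hG, Finsupp.single_le_iff, Finsupp.mem_support_iff,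
        Nat.one_le_iff_ne_zero]
    simp only [hle]
    rw [indExp_insert hv', tsub_tsub, add_comm]
  · rw [strand, if_neg hG]
    refine Finset.sum_eq_zero fun v hv => ?_
    rw [strand, if_neg, smul_zero, smul_zero]
    intro h
    rw [indExp_insert (Finset.mem_compl.1 hv)] at h
    exact hG (le_add_self.trans h)

/-- A Koszul chain is the boundary of a chain with monomials satisfying `B` as soon as all its
strands are boundaries of simplicial chains supported on the corresponding complexes. -/
theorem exists_koszulD_eq_of_strand (B : (Fin n →₀ ℕ) → Prop)
    (z : Finset (Fin n) → MvPolynomial (Fin n) k)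
    (h : ∀ a, ∃ c : Finset (Fin n) → k, (∀ G, c G ≠ 0 → ∃ b, B b ∧ b + indExp G = a) ∧
      koszulD (fun _ => (1 : k)) c = strand a z) :
    ∃ w : Finset (Fin n) → MvPolynomial (Fin n) k,
      (∀ G, ∀ b ∈ (w G).support, B b) ∧ koszulD (X : Fin n → MvPolynomial (Fin n) k) w = z := by
  classical
  have h' : ∀ a, ∃ c : Finset (Fin n) → k, (∀ G, c G ≠ 0 → ∃ b, B b ∧ b + indExp G = a) ∧
      koszulD (fun _ => (1 : k)) c = strand a z ∧ (strand a z = 0 → c = 0) := by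
    intro a
    by_cases ha : strand a z = 0
    · refine ⟨0, by simp, ?_, fun _ => rfl⟩
      rw [ha]
      funext G
      simp [koszulD]
    · obtain ⟨c, h1, h2⟩ := h a
      exact ⟨c, h1, h2, fun h => absurd h ha⟩
  choose c hcB hcz hc0 using h'
  let S : Finset (Fin n →₀ ℕ) :=
    Finset.univ.biUnion fun G => (z G).support.image (· + indExp G)
  have hS : ∀ a, a ∉ S → c a = 0 := by
    intro a ha
    refine hc0 a (funext fun G => ?_)
    by_contra hG
    obtain ⟨b, hb, hba⟩ := exists_of_strand_ne_zero hG
    exact ha (Finset.mem_biUnion.2 ⟨G, Finset.mem_univ G, Finset.mem_image.2 ⟨b, hb, hba⟩⟩)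
  let w : Finset (Fin n) → MvPolynomial (Fin n) k := fun G =>
    ∑ b ∈ S.image (· - indExp G), monomial b (c (b + indExp G) G)
  have hw : ∀ G b, coeff b (w G) = c (b + indExp G) G := by
    intro G b
    simp only [w, coeff_sum, coeff_monomial, Finset.sum_ite_eq']
    split_ifs with hb
    · rfl
    · rw [hS, Pi.zero_apply]
      exact fun hb' => hb (Finset.mem_image.2 ⟨_, hb', add_tsub_cancel_right b _⟩)
  refine ⟨w, fun G b hb => ?_, strand_ext fun a => ?_⟩
  · rw [mem_support_iff, hw] at hb
    obtain ⟨b', hb', h⟩ := hcB _ _ hb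
    rwa [← add_right_cancel h]
  · rw [← koszulD_strand, ← hcz]
    congr 1
    funext G
    by_cases hG : indExp G ≤ a
    · rw [strand, if_pos hG, hw, tsub_add_cancel_of_le hG]
    · rw [strand, if_neg hG]
      by_contra hne
      obtain ⟨b, -, hb⟩ := hcB a G (Ne.symm hne)
      exact hG (hb ▸ le_add_self)

/-- Acyclicity of the Koszul complex of the polynomial ring. -/
theorem exists_koszulD_eq (z : Finset (Fin n) → MvPolynomial (Fin n) k)
    (hz : koszulD (X : Fin n → MvPolynomial (Fin n) k) z = 0)
    (h0 : coeff 0 (z ∅) = 0) : ∃ w, koszulD (X : Fin n → MvPolynomial (Fin n) k) w = z := by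
  obtain ⟨w, -, hw⟩ := exists_koszulD_eq_of_strand (fun _ => True) z fun a => by
    by_cases ha : a = 0
    · refine ⟨0, by simp, funext fun G => ?_⟩
      have : strand a z G = 0 := by
        by_contra hne
        obtain ⟨b, hb, hba⟩ := exists_of_strand_ne_zero hne
        rw [ha, add_eq_zero] at hba
        obtain rfl : G = ∅ := by rw [← support_indExp G, hba.2, Finsupp.support_zero]
        rw [hba.1, mem_support_iff] at hb
        exact hb h0
      rw [this]
      simp [koszulD]
    · obtain ⟨v, hv⟩ := Finsupp.support_nonempty_iff.2 ha
      refine ⟨coneChain v (strand a z), fun G hG => ⟨a - indExp G, trivial, ?_⟩, ?_⟩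
      · unfold coneChain at hG
        split_ifs at hG with hvG
        · obtain ⟨b, -, hb⟩ := exists_of_strand_ne_zero (right_ne_zero_of_smul hG)
          refine tsub_add_cancel_of_le fun u => ?_
          have hbu := DFunLike.congr_fun hb u
          rw [Finsupp.add_apply, indExp_apply] at hbu
          rw [indExp_apply]
          by_cases huv : u = v
          · subst huv
            have := Nat.one_le_iff_ne_zero.2 (Finsupp.mem_support_iff.1 hv)
            split_ifs
            all_goals omega
          · simp only [Finset.mem_erase, huv, ne_eq, not_false_eq_true, true_and] at hbu
            omega
        · exact absurd rfl hG
      · apply koszulD_coneChain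
        rw [koszulD_strand, hz]
        funext G
        simp [strand]
  exact ⟨w, hw⟩

end Strand

/-! ### Graded submodules of free modules -/

section Graded

variable {k : Type*} [Field k] {n : ℕ} {ι κ : Type*}

theorem homogeneousComponent_add_mul {f g : MvPolynomial (Fin n) k} {e : ℕ}
    (hg : g.IsHomogeneous e) (s : ℕ) :
    homogeneousComponent (s + e) (f * g) = homogeneousComponent s f * g := by
  ext b
  rw [coeff_homogeneousComponent, coeff_mul, coeff_mul]
  have h : ∀ p ∈ Finset.HasAntidiagonal.antidiagonal b, coeff p.1 (homogeneousComponent s f) * coeff p.2 g =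
      if b.degree = s + e then coeff p.1 f * coeff p.2 g else 0 := fun p hp => by
    rw [coeff_homogeneousComponent, ← Finset.HasAntidiagonal.mem_antidiagonal.1 hp, map_add]
    by_cases h : p.2.degree = e
    · simp [h]
    · simp [hg.coeff_eq_zero h]
  rw [Finset.sum_congr rfl h]
  split_ifs
  · rfl
  · rw [Finset.sum_const_zero]

theorem homogeneousComponent_mul_of_lt {f g : MvPolynomial (Fin n) k} {e s : ℕ}
    (hg : g.IsHomogeneous e) (hs : s < e) : homogeneousComponent s (f * g) = 0 := by
  ext b
  rw [coeff_homogeneousComponent, coeff_mul, coeff_zero]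
  split_ifs with hb
  · refine Finset.sum_eq_zero fun p hp => ?_
    rw [← Finset.HasAntidiagonal.mem_antidiagonal.1 hp, map_add] at hb
    rw [hg.coeff_eq_zero (by omega), mul_zero]
  · rfl

/-- All coordinates of `y` are homogeneous of degree `s`. -/
def IsHomogeneousVec (s : ℕ) (y : ι →₀ MvPolynomial (Fin n) k) : Prop :=
  ∀ a, (y a).IsHomogeneous s

/-- The coordinatewise homogeneous component of degree `s`. -/
noncomputable def vecComponent (s : ℕ) :
    (ι →₀ MvPolynomial (Fin n) k) →+ (ι →₀ MvPolynomial (Fin n) k) :=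
  Finsupp.mapRange.addMonoidHom (homogeneousComponent s).toAddMonoidHom

theorem vecComponent_apply (s : ℕ) (y : ι →₀ MvPolynomial (Fin n) k) (a : ι) :
    vecComponent s y a = homogeneousComponent s (y a) := rfl

theorem isHomogeneousVec_vecComponent (s : ℕ) (y : ι →₀ MvPolynomial (Fin n) k) :
    IsHomogeneousVec s (vecComponent s y) := fun a =>
  homogeneousComponent_isHomogeneous s (y a)

theorem vecComponent_eq_self {s : ℕ} {y : ι →₀ MvPolynomial (Fin n) k}
    (hy : IsHomogeneousVec s y) : vecComponent s y = y :=
  Finsupp.ext fun a => homogeneousComponent_eq_self (hy a)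

theorem exists_sum_vecComponent (y : ι →₀ MvPolynomial (Fin n) k) :
    ∃ m, ∑ s ∈ Finset.range m, vecComponent s y = y := by
  refine ⟨(y.support.sup fun a => (y a).totalDegree) + 1, Finsupp.ext fun a => ?_⟩
  rw [Finsupp.finsetSum_apply]
  simp only [vecComponent_apply]
  conv_rhs => rw [← sum_homogeneousComponent (y a)]
  symm
  by_cases ha : a ∈ y.support
  · refine Finset.sum_subset (Finset.range_subset_range.2 (Nat.succ_le_succ
      (Finset.le_sup (f := fun a => (y a).totalDegree) ha))) fun s _ hs => ?_
    exact homogeneousComponent_eq_zero _ _ (by simpa [Nat.lt_succ_iff] using hs)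
  · simp [Finsupp.notMem_support_iff.1 ha]

theorem vecComponent_X_smul (s : ℕ) (v : Fin n) (y : ι →₀ MvPolynomial (Fin n) k) :
    vecComponent (s + 1) ((X v : MvPolynomial (Fin n) k) • y) =
      (X v : MvPolynomial (Fin n) k) • vecComponent s y :=
  Finsupp.ext fun a => by
    rw [vecComponent_apply, Finsupp.smul_apply, Finsupp.smul_apply, vecComponent_apply,
      smul_eq_mul, smul_eq_mul, mul_comm, homogeneousComponent_add_mul (isHomogeneous_X k v),
      mul_comm]

theorem vecComponent_zero_X_smul (v : Fin n) (y : ι →₀ MvPolynomial (Fin n) k) :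
    vecComponent 0 ((X v : MvPolynomial (Fin n) k) • y) = 0 :=
  Finsupp.ext fun a => by
    rw [vecComponent_apply, Finsupp.smul_apply, smul_eq_mul, mul_comm,
      homogeneousComponent_mul_of_lt (isHomogeneous_X k v) one_pos, Finsupp.zero_apply]

/-- The linear map `φ` sends the basis vectors to vectors with homogeneous coordinates
of degree `e`. -/
def IsHomogeneousMap (e : ℕ) (φ : (ι →₀ MvPolynomial (Fin n) k) →ₗ[MvPolynomial (Fin n) k]
    (κ →₀ MvPolynomial (Fin n) k)) : Prop :=
  ∀ a, IsHomogeneousVec e (φ (Finsupp.single a 1))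

theorem IsHomogeneousMap.vecComponent_add {e : ℕ}
    {φ : (ι →₀ MvPolynomial (Fin n) k) →ₗ[MvPolynomial (Fin n) k] (κ →₀ MvPolynomial (Fin n) k)}
    (hφ : IsHomogeneousMap e φ) (s : ℕ) (y : ι →₀ MvPolynomial (Fin n) k) :
    vecComponent (s + e) (φ y) = φ (vecComponent s y) := by
  induction y using Finsupp.induction_linear with
  | zero => simp
  | add y z hy hz => simp only [map_add, hy, hz]
  | single a f =>
    have h1 : ∀ g : MvPolynomial (Fin n) k,
        φ (Finsupp.single a g) = g • φ (Finsupp.single a 1) := fun g => by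
      rw [← map_smul, Finsupp.smul_single, smul_eq_mul, mul_one]
    have h2 : vecComponent s (Finsupp.single a f) =
        Finsupp.single a (homogeneousComponent s f) :=
      Finsupp.mapRange_single (hf := map_zero _)
    rw [h2, h1 f, h1 (homogeneousComponent s f)]
    ext1 b
    rw [vecComponent_apply, Finsupp.smul_apply, smul_eq_mul, homogeneousComponent_add_mul (hφ a b) s, Finsupp.smul_apply,
      smul_eq_mul]

theorem IsHomogeneousMap.vecComponent_of_lt {e : ℕ}
    {φ : (ι →₀ MvPolynomial (Fin n) k) →ₗ[MvPolynomial (Fin n) k] (κ →₀ MvPolynomial (Fin n) k)}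
    (hφ : IsHomogeneousMap e φ) {s : ℕ} (hs : s < e) (y : ι →₀ MvPolynomial (Fin n) k) :
    vecComponent s (φ y) = 0 := by
  induction y using Finsupp.induction_linear with
  | zero => simp
  | add y z hy hz => simp only [map_add, hy, hz, add_zero]
  | single a f =>
    have h1 : φ (Finsupp.single a f) = f • φ (Finsupp.single a 1) := by
      rw [← map_smul, Finsupp.smul_single, smul_eq_mul, mul_one]
    rw [h1]
    ext1 b
    rw [vecComponent_apply, Finsupp.smul_apply, smul_eq_mul, homogeneousComponent_mul_of_lt (hφ a b) hs, Finsupp.zero_apply]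

/-- A graded submodule contains the homogeneous components of its elements. -/
def IsGradedSub (N : Submodule (MvPolynomial (Fin n) k) (ι →₀ MvPolynomial (Fin n) k)) : Prop :=
  ∀ y ∈ N, ∀ s, vecComponent s y ∈ N

theorem IsHomogeneousMap.isGradedSub_ker {e : ℕ}
    {φ : (ι →₀ MvPolynomial (Fin n) k) →ₗ[MvPolynomial (Fin n) k] (κ →₀ MvPolynomial (Fin n) k)}
    (hφ : IsHomogeneousMap e φ) : IsGradedSub (LinearMap.ker φ) := fun y hy s => by
  rw [LinearMap.mem_ker] at hy ⊢
  rw [← hφ.vecComponent_add, hy, map_zero]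

/-- Acyclicity of the Koszul complex of a free module. -/
theorem exists_koszulD_eq_free (z : Finset (Fin n) → ι →₀ MvPolynomial (Fin n) k)
    (hz : koszulD (X : Fin n → MvPolynomial (Fin n) k) z = 0) (h0 : vecComponent 0 (z ∅) = 0) :
    ∃ w, koszulD (X : Fin n → MvPolynomial (Fin n) k) w = z := by
  classical
  have hcoord (w : Finset (Fin n) → ι →₀ MvPolynomial (Fin n) k) (a : ι) (G : Finset (Fin n)) :
      koszulD (X : Fin n → MvPolynomial (Fin n) k) w G a =
        koszulD (X : Fin n → MvPolynomial (Fin n) k) (fun G => w G a) G :=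
    map_koszulD (X : Fin n → MvPolynomial (Fin n) k) (f := Finsupp.applyAddHom a)
      (g := Finsupp.applyAddHom a) (fun _ _ => rfl) w G
  have h : ∀ a : ι, ∃ w : Finset (Fin n) → MvPolynomial (Fin n) k,
      koszulD (X : Fin n → MvPolynomial (Fin n) k) w = fun G => z G a := fun a => by
    refine exists_koszulD_eq _ (funext fun G => ?_) ?_
    · rw [← hcoord, hz]
      rfl
    · have := DFunLike.congr_fun h0 a
      rw [vecComponent_apply, homogeneousComponent_zero] at this
      exact C_injective _ _ (this.trans C_0.symm)
  choose w hw using h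
  let S : Finset ι := Finset.univ.biUnion fun G => (z G).support
  refine ⟨fun G => Finsupp.onFinset S (fun a => if a ∈ S then w a G else 0) fun a ha => ?_, ?_⟩
  · by_contra hS
    exact ha (if_neg hS)
  · funext G
    ext1 a
    rw [hcoord]
    simp only [Finsupp.onFinset_apply]
    by_cases ha : a ∈ S
    · simp only [ha, if_true]
      exact congrFun (hw a) G
    · simp only [ha, if_false]
      have : z G a = 0 := by
        by_contra hne
        exact ha (Finset.mem_biUnion.2 ⟨G, Finset.mem_univ G, Finsupp.mem_support_iff.2 hne⟩)
      rw [this]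
      simp [koszulD]

/-- The Koszul homology of the graded submodule `N` in homological degrees less than `r` is
concentrated in internal degree `e`. -/
def KoszulLinear (N : Submodule (MvPolynomial (Fin n) k) (ι →₀ MvPolynomial (Fin n) k))
    (e r : ℕ) : Prop :=
  ∀ i < r, ∀ s, s ≠ e → ∀ z : Finset (Fin n) → ι →₀ MvPolynomial (Fin n) k,
    (∀ G, z G ∈ N) → (∀ G, IsHomogeneousVec s (z G)) → (∀ G, G.card ≠ i → z G = 0) →
    koszulD (X : Fin n → MvPolynomial (Fin n) k) z = 0 →
    ∃ w : Finset (Fin n) → ι →₀ MvPolynomial (Fin n) k,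
      (∀ G, w G ∈ N) ∧ koszulD (X : Fin n → MvPolynomial (Fin n) k) w = z

/-- Dimension shifting: from the syzygies to the module. -/
theorem koszulLinear_range {e r : ℕ}
    {φ : (ι →₀ MvPolynomial (Fin n) k) →ₗ[MvPolynomial (Fin n) k] (κ →₀ MvPolynomial (Fin n) k)}
    (hφ : IsHomogeneousMap e φ) (hker : KoszulLinear (LinearMap.ker φ) 1 r) :
    KoszulLinear (LinearMap.range φ) e (r + 1) := by
  intro i hi s hs z hzN hzs hzi hz
  have hφd : ∀ (w : Finset (Fin n) → ι →₀ MvPolynomial (Fin n) k) (G : Finset (Fin n)),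
      φ (koszulD (X : Fin n → MvPolynomial (Fin n) k) w G) =
        koszulD (X : Fin n → MvPolynomial (Fin n) k) (fun H => φ (w H)) G :=
    map_koszulD (X : Fin n → MvPolynomial (Fin n) k) (f := φ.toAddMonoidHom)
      (g := φ.toAddMonoidHom) (fun v m => map_smul φ (X v) m)
  suffices h : ∃ w, (fun G => φ (koszulD (X : Fin n → MvPolynomial (Fin n) k) w G)) = z by
    obtain ⟨w, hw⟩ := h
    refine ⟨fun G => φ (w G), fun G => LinearMap.mem_range_self _ _, ?_⟩
    rw [← hw]
    funext G
    rw [hφd]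
  choose y hy using fun G => LinearMap.mem_range.1 (hzN G)
  rcases lt_or_gt_of_ne hs with hse | hse
  · refine ⟨0, funext fun G => ?_⟩
    rw [← vecComponent_eq_self (hzs G), ← hy, hφ.vecComponent_of_lt hse]
    simp [koszulD]
  obtain ⟨t, rfl⟩ := Nat.exists_eq_add_of_lt hse
  let z' : Finset (Fin n) → ι →₀ MvPolynomial (Fin n) k :=
    chainPart i fun G => vecComponent (t + 1) (y G)
  have hz' : ∀ G, φ (z' G) = z G := by
    intro G
    simp only [z', chainPart]
    split_ifs with hG
    · rw [← hφ.vecComponent_add, hy, vecComponent_eq_self]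
      convert hzs G using 1
      omega
    · rw [map_zero, hzi G hG]
  have hz's : ∀ G, IsHomogeneousVec (t + 1) (z' G) := by
    intro G
    simp only [z', chainPart]
    split_ifs
    · exact isHomogeneousVec_vecComponent _ _
    · exact fun a => isHomogeneous_zero _ _ _
  have hz'i : ∀ G, G.card ≠ i → z' G = 0 := fun G hG => if_neg hG
  have hzero : ∀ y : ι →₀ MvPolynomial (Fin n) k, IsHomogeneousVec (t + 1) y →
      vecComponent 0 y = 0 := fun y hy => Finsupp.ext fun a => by
    rw [vecComponent_apply, homogeneousComponent_of_mem ((mem_homogeneousSubmodule _ _).2 (hy a)),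
      if_neg (Nat.succ_ne_zero t).symm, Finsupp.zero_apply]
  have hshift : ∀ G, IsHomogeneousVec (t + 2) (koszulD (X : Fin n → MvPolynomial (Fin n) k) z' G) :=
      by
    intro G
    have := map_koszulD (X : Fin n → MvPolynomial (Fin n) k) (f := vecComponent (t + 1 + 1))
      (g := vecComponent (t + 1)) (fun v m => vecComponent_X_smul (ι := ι) (k := k) (t + 1) v m)
      z' G
    simp only [vecComponent_eq_self (hz's _)] at this
    rw [← this]
    exact isHomogeneousVec_vecComponent _ _
  have hcyc : ∃ w, (∀ G, w G ∈ LinearMap.ker φ) ∧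
      koszulD (X : Fin n → MvPolynomial (Fin n) k) w =
        koszulD (X : Fin n → MvPolynomial (Fin n) k) z' ∧ vecComponent 0 (w ∅) = 0 := by
    rcases i with _ | i
    · refine ⟨0, by simp, funext fun G => ?_, by simp⟩
      symm
      simp only [koszulD, Pi.zero_apply, smul_zero, Finset.sum_const_zero]
      refine Finset.sum_eq_zero fun v hv => ?_
      rw [hz'i _ (by simp), smul_zero, smul_zero]
    · obtain ⟨w, hwN, hw⟩ := hker i (by omega) (t + 2) (by omega)
        (koszulD (X : Fin n → MvPolynomial (Fin n) k) z')
        (fun G => by rw [LinearMap.mem_ker, hφd]; simp only [hz']; exact congrFun hz G) hshift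
        (koszulD_eq_zero_of_card _ hz'i) (funext fun G => koszulD_koszulD _ _ G)
      refine ⟨chainPart (i + 1) w, fun G => ?_, ?_, ?_⟩
      · unfold chainPart
        split_ifs
        exacts [hwN G, zero_mem _]
      · rw [koszulD_chainPart, hw]
        funext G
        unfold chainPart
        split_ifs with hG
        · rfl
        · exact (koszulD_eq_zero_of_card _ hz'i G hG).symm
      · simp [chainPart]
  obtain ⟨w, hwN, hw, hw0⟩ := hcyc
  obtain ⟨u, hu⟩ := exists_koszulD_eq_free (fun G => z' G - w G)
    (by rw [koszulD_sub, hw]; funext G; exact sub_self _)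
    (by rw [map_sub, hw0, hzero _ (hz's ∅), sub_zero])
  refine ⟨u, funext fun G => ?_⟩
  rw [hu, map_sub, hz', LinearMap.mem_ker.1 (hwN G), sub_zero]

/-- Dimension shifting: from the module to the syzygies. -/
theorem koszulLinear_ker {e r : ℕ}
    {φ : (ι →₀ MvPolynomial (Fin n) k) →ₗ[MvPolynomial (Fin n) k] (κ →₀ MvPolynomial (Fin n) k)}
    (hφ : IsHomogeneousMap e φ) (hmin : ∀ y ∈ LinearMap.ker φ, IsHomogeneousVec 0 y → y = 0)
    (hrange : KoszulLinear (LinearMap.range φ) e (r + 1)) :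
    KoszulLinear (LinearMap.ker φ) 1 r := by
  intro i hi s hs z hzN hzs hzi hz
  have hφd : ∀ (w : Finset (Fin n) → ι →₀ MvPolynomial (Fin n) k) (G : Finset (Fin n)),
      φ (koszulD (X : Fin n → MvPolynomial (Fin n) k) w G) =
        koszulD (X : Fin n → MvPolynomial (Fin n) k) (fun H => φ (w H)) G :=
    map_koszulD (X : Fin n → MvPolynomial (Fin n) k) (f := φ.toAddMonoidHom)
      (g := φ.toAddMonoidHom) (fun v m => map_smul φ (X v) m)
  rcases s with _ | s
  · refine ⟨0, fun G => zero_mem _, funext fun G => ?_⟩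
    rw [hmin _ (hzN G) (hzs G)]
    simp [koszulD]
  obtain ⟨w, hw⟩ := exists_koszulD_eq_free z hz (Finsupp.ext fun a => by
    rw [vecComponent_apply,
      homogeneousComponent_of_mem ((mem_homogeneousSubmodule _ _).2 (hzs ∅ a)),
      if_neg (Nat.succ_ne_zero s).symm, Finsupp.zero_apply])
  let w' : Finset (Fin n) → ι →₀ MvPolynomial (Fin n) k :=
    chainPart (i + 1) fun G => vecComponent s (w G)
  have hw' : koszulD (X : Fin n → MvPolynomial (Fin n) k) w' = z := by
    simp only [w']
    rw [koszulD_chainPart]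
    funext G
    unfold chainPart
    split_ifs with hG
    · rw [← map_koszulD (X : Fin n → MvPolynomial (Fin n) k) (f := vecComponent (s + 1))
        (fun v m => vecComponent_X_smul s v m), hw, vecComponent_eq_self (hzs G)]
    · exact (hzi G hG).symm
  have hw's : ∀ G, IsHomogeneousVec (s + e) (φ (w' G)) := by
    intro G
    simp only [w', chainPart]
    split_ifs
    · rw [← hφ.vecComponent_add]
      exact isHomogeneousVec_vecComponent _ _
    · rw [map_zero]
      exact fun a => isHomogeneous_zero _ _ _
  obtain ⟨u, huN, hu⟩ := hrange (i + 1) (by omega) (s + e) (by omega) (fun G => φ (w' G))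
    (fun G => LinearMap.mem_range_self _ _) hw's
    (fun G hG => by simp only [w', chainPart, if_neg hG, map_zero])
    (funext fun G => by rw [← hφd, hw', LinearMap.mem_ker.1 (hzN G)]; rfl)
  choose u' hu' using fun G => LinearMap.mem_range.1 (huN G)
  refine ⟨fun G => w' G - koszulD (X : Fin n → MvPolynomial (Fin n) k) u' G, fun G => ?_, ?_⟩
  · rw [LinearMap.mem_ker, map_sub, hφd]
    simp only [hu', hu, sub_self]
  · rw [koszulD_sub, hw']
    funext G
    rw [koszulD_koszulD, sub_zero]

end Graded

/-! ### Linear resolutions and Koszul homology -/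

section Resolution

variable {k : Type*} [Field k] {n : ℕ} {ι : Type*}

/-- An ideal, viewed as a submodule of the free module on one generator. -/
noncomputable def idealSub (J : Ideal (MvPolynomial (Fin n) k)) :
    Submodule (MvPolynomial (Fin n) k) (Unit →₀ MvPolynomial (Fin n) k) :=
  Submodule.map (Finsupp.lsingle ()) J

theorem mem_idealSub {J : Ideal (MvPolynomial (Fin n) k)} {y : Unit →₀ MvPolynomial (Fin n) k} :
    y ∈ idealSub J ↔ y () ∈ J := by
  constructor
  · rintro ⟨f, hf, rfl⟩
    simpa using hf
  · exact fun h => ⟨y (), h, Finsupp.ext fun _ => by simp⟩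

theorem exists_koszulLinear_of_linear {J : Ideal (MvPolynomial (Fin n) k)} {r : ℕ} (hr : 1 ≤ r)
    (h : IdealLinearFirstSteps k J r) : ∃ d, KoszulLinear (idealSub J) d r := by
  obtain ⟨d, ι, φ0, φ, hφ0, hd, h1, hex0, hex⟩ := h
  have hstep : ∀ p i, i + 2 + p = r → KoszulLinear (LinearMap.range (φ i)) 1 (p + 1) := by
    intro p
    induction p with
    | zero =>
      intro i hi
      exact koszulLinear_range (h1 i (by omega)) fun j hj => absurd hj (Nat.not_lt_zero j)
    | succ p ih =>
      intro i hi
      refine koszulLinear_range (h1 i (by omega)) ?_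
      rw [hex i (by omega)]
      exact ih (i + 1) (by omega)
  let ψ : (ι 0 →₀ MvPolynomial (Fin n) k) →ₗ[MvPolynomial (Fin n) k]
    (Unit →₀ MvPolynomial (Fin n) k) := Finsupp.lsingle () ∘ₗ φ0
  have hψ : IsHomogeneousMap d ψ := fun a b => by
    simpa [ψ] using hd a
  have hker : LinearMap.ker ψ = LinearMap.ker φ0 :=
    LinearMap.ker_comp_of_ker_eq_bot _
      (LinearMap.ker_eq_bot.2 (Finsupp.single_injective ()))
  have hrange : LinearMap.range ψ = idealSub J := by
    rw [LinearMap.range_comp, hφ0, idealSub]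
  refine ⟨d, ?_⟩
  obtain ⟨q, rfl⟩ := Nat.exists_eq_add_of_le' hr
  rw [← hrange]
  refine koszulLinear_range hψ ?_
  rw [hker]
  rcases q with _ | q
  · exact fun j hj => absurd hj (Nat.not_lt_zero j)
  · rw [hex0 (by omega)]
    exact hstep q 0 (by omega)

/-- The vectors with homogeneous coordinates of degree `e` in a submodule of a free module. -/
def homogeneousPart (N : Submodule (MvPolynomial (Fin n) k) (ι →₀ MvPolynomial (Fin n) k))
    (e : ℕ) : Submodule k (ι →₀ MvPolynomial (Fin n) k) where
  carrier := {y | y ∈ N ∧ IsHomogeneousVec e y}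
  zero_mem' := ⟨zero_mem _, fun _ => isHomogeneous_zero _ _ _⟩
  add_mem' hx hy := ⟨add_mem hx.1 hy.1, fun a => (hx.2 a).add (hy.2 a)⟩
  smul_mem' c _ hy := ⟨N.smul_of_tower_mem c hy.1, fun a =>
    (homogeneousSubmodule (Fin n) k e).smul_mem c (hy.2 a)⟩

theorem exists_basis_of_finite {K M : Type*} [Field K] [AddCommGroup M] [Module K M]
    (V : Submodule K M) [Module.Finite K V] :
    ∃ (m : ℕ) (b : Fin m → M), LinearIndependent K b ∧ Submodule.span K (Set.range b) = V := by
  let b := Module.finBasis K V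
  refine ⟨_, fun i => (b i : M), b.linearIndependent.map' V.subtype (Submodule.ker_subtype _), ?_⟩
  have h := congrArg (Submodule.map V.subtype) b.span_eq
  rw [Submodule.map_span, ← Set.range_comp, Submodule.map_top, Submodule.range_subtype] at h
  exact h

theorem finite_homogeneousPart [Finite ι]
    (N : Submodule (MvPolynomial (Fin n) k) (ι →₀ MvPolynomial (Fin n) k)) (e : ℕ) :
    Module.Finite k (homogeneousPart N e) := by
  let g : homogeneousPart N e →ₗ[k] (ι → homogeneousSubmodule (Fin n) k e) :=
    { toFun := fun y a => ⟨y.1 a, y.2.2 a⟩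
      map_add' := fun _ _ => rfl
      map_smul' := fun _ _ => rfl }
  have hg : Function.Injective g := fun x y hxy => Subtype.ext <| Finsupp.ext fun a =>
    congrArg Subtype.val (congrFun hxy a)
  have : Module.Finite k (homogeneousSubmodule (Fin n) k e) :=
    Module.Finite.iff_fg.2 (homogeneousSubmodule_fg _ _ e)
  exact Module.Finite.of_injective g hg

theorem exists_basis_homogeneousPart [Finite ι]
    (N : Submodule (MvPolynomial (Fin n) k) (ι →₀ MvPolynomial (Fin n) k)) (e : ℕ) :
    ∃ (m : ℕ) (b : Fin m → ι →₀ MvPolynomial (Fin n) k), LinearIndependent k b ∧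
      Submodule.span k (Set.range b) = homogeneousPart N e :=
  have := finite_homogeneousPart N e
  exists_basis_of_finite (homogeneousPart N e)

/-- The generators of degree `e` of a submodule of a free module of finite rank. -/
theorem exists_presentation [Finite ι]
    (N : Submodule (MvPolynomial (Fin n) k) (ι →₀ MvPolynomial (Fin n) k)) (e : ℕ) :
    ∃ (m : ℕ) (φ : (Fin m →₀ MvPolynomial (Fin n) k) →ₗ[MvPolynomial (Fin n) k]
      (ι →₀ MvPolynomial (Fin n) k)),
      IsHomogeneousMap e φ ∧ (∀ y ∈ LinearMap.ker φ, IsHomogeneousVec 0 y → y = 0) ∧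
      LinearMap.range φ ≤ N ∧ ∀ y ∈ N, IsHomogeneousVec e y → y ∈ LinearMap.range φ := by
  obtain ⟨m, b, hb, hspan⟩ := exists_basis_homogeneousPart N e
  have hbN : ∀ i, b i ∈ N ∧ IsHomogeneousVec e (b i) := fun i => by
    have : b i ∈ homogeneousPart N e := hspan ▸ Submodule.subset_span ⟨i, rfl⟩
    exact this
  refine ⟨m, Finsupp.linearCombination _ b, fun i => ?_, fun y hy hy0 => ?_, ?_,
    fun y hyN hye => ?_⟩
  · rw [Finsupp.linearCombination_single, one_smul]
    exact (hbN i).2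
  · have hC : ∀ i, y i = C (coeff 0 (y i)) := fun i => by
      rw [← homogeneousComponent_zero, homogeneousComponent_eq_self (hy0 i)]
    have hsum : ∑ i, coeff 0 (y i) • b i = 0 := by
      rw [LinearMap.mem_ker, Finsupp.linearCombination_apply,
        Finsupp.sum_fintype _ _ fun i => zero_smul _ (b i)] at hy
      rw [← hy]
      refine Finset.sum_congr rfl fun i _ => ?_
      conv_rhs => rw [hC i]
      ext1 a
      rw [Finsupp.smul_apply, Finsupp.smul_apply, smul_eq_mul, C_mul']
    have hlin := Fintype.linearIndependent_iff.1 hb _ hsum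
    exact Finsupp.ext fun i => by rw [hC, hlin i, C_0, Finsupp.zero_apply]
  · rw [Finsupp.range_linearCombination, Submodule.span_le]
    rintro _ ⟨i, rfl⟩
    exact (hbN i).1
  · rw [Finsupp.range_linearCombination]
    have hy : y ∈ homogeneousPart N e := ⟨hyN, hye⟩
    rw [← hspan] at hy
    exact Submodule.span_le_restrictScalars k (MvPolynomial (Fin n) k) _ hy

theorem le_of_koszulLinear
    {N S : Submodule (MvPolynomial (Fin n) k) (ι →₀ MvPolynomial (Fin n) k)} {e r : ℕ}
    (hN : IsGradedSub N) (h : KoszulLinear N e (r + 1))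
    (hS : ∀ y ∈ N, IsHomogeneousVec e y → y ∈ S) : N ≤ S := by
  have key : ∀ s, ∀ y ∈ N, IsHomogeneousVec s y → y ∈ S := by
    intro s
    induction s with
    | zero =>
      intro y hy hys
      by_cases hse : 0 = e
      · exact hS y hy (hse ▸ hys)
      obtain ⟨w, -, hw⟩ := h 0 (Nat.succ_pos r) 0 hse (chainPart 0 fun _ => y)
        (fun G => by unfold chainPart; split_ifs; exacts [hy, zero_mem _])
        (fun G => by
          unfold chainPart
          split_ifs
          exacts [hys, fun a => isHomogeneous_zero _ _ _])
        (fun G hG => if_neg hG)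
        (funext fun G => by
          refine Finset.sum_eq_zero fun v hv => ?_
          simp [chainPart])
      have hy0 := congrArg (vecComponent 0) (congrFun hw ∅)
      rw [chainPart, if_pos Finset.card_empty, vecComponent_eq_self hys] at hy0
      rw [← hy0]
      simp only [koszulD, map_sum, map_zsmul, vecComponent_zero_X_smul, smul_zero,
        Finset.sum_const_zero, zero_mem]
    | succ s ih =>
      intro y hy hys
      by_cases hse : s + 1 = e
      · exact hS y hy (hse ▸ hys)
      obtain ⟨w, hwN, hw⟩ := h 0 (Nat.succ_pos r) (s + 1) hse (chainPart 0 fun _ => y)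
        (fun G => by unfold chainPart; split_ifs; exacts [hy, zero_mem _])
        (fun G => by
          unfold chainPart
          split_ifs
          exacts [hys, fun a => isHomogeneous_zero _ _ _])
        (fun G hG => if_neg hG)
        (funext fun G => by
          refine Finset.sum_eq_zero fun v hv => ?_
          simp [chainPart])
      have hy0 := congrArg (vecComponent (s + 1)) (congrFun hw ∅)
      rw [chainPart, if_pos Finset.card_empty, vecComponent_eq_self hys,
        map_koszulD _ (fun v m => vecComponent_X_smul s v m)] at hy0
      rw [← hy0]
      exact koszulD_mem _ S (fun G => ih _ (hN _ (hwN G) s) (isHomogeneousVec_vecComponent _ _)) ∅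
  intro y hy
  obtain ⟨m, hm⟩ := exists_sum_vecComponent y
  rw [← hm]
  exact sum_mem fun s _ => key s _ (hN y hy s) (isHomogeneousVec_vecComponent _ _)

theorem linear_of_koszulLinear {J : Ideal (MvPolynomial (Fin n) k)} {d r : ℕ} (hr : 1 ≤ r)
    (hJ : IsGradedSub (idealSub J)) (h : KoszulLinear (idealSub J) d r) :
    IdealLinearFirstSteps k J r := by
  obtain ⟨q, rfl⟩ := Nat.exists_eq_add_of_le' hr
  have hex := fun s : (m : ℕ) × Submodule (MvPolynomial (Fin n) k)
    (Fin m →₀ MvPolynomial (Fin n) k) => exists_presentation s.2 1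
  choose m φ hφ hφmin hφle hφge using hex
  obtain ⟨m0, ψ, hψ, hψmin, hψle, hψge⟩ := exists_presentation (idealSub J) d
  let seq : ℕ → (m : ℕ) × Submodule (MvPolynomial (Fin n) k)
    (Fin m →₀ MvPolynomial (Fin n) k) :=
    fun i => Nat.rec ⟨m0, LinearMap.ker ψ⟩ (fun _ s => ⟨m s, LinearMap.ker (φ s)⟩) i
  have hrange : LinearMap.range ψ = idealSub J := le_antisymm hψle (le_of_koszulLinear hJ h hψge)
  have hgr : ∀ i, IsGradedSub (seq i).2 := by
    rintro (_ | i)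
    exacts [hψ.isGradedSub_ker, (hφ (seq i)).isGradedSub_ker]
  have hseq : ∀ p i, i + 1 + p = q → KoszulLinear (seq i).2 1 (p + 1) ∧
      LinearMap.range (φ (seq i)) = (seq i).2 := by
    suffices H : ∀ i p, i + 1 + p = q → KoszulLinear (seq i).2 1 (p + 1) from fun p i hi =>
      ⟨H i p hi, le_antisymm (hφle _) (le_of_koszulLinear (hgr i) (H i p hi) (hφge _))⟩
    intro i
    induction i with
    | zero =>
      intro p hp
      refine koszulLinear_ker hψ hψmin ?_
      rw [hrange]
      convert h using 1
      omega
    | succ i ih =>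
      intro p hp
      have hi := ih (p + 1) (by omega)
      refine koszulLinear_ker (hφ (seq i)) (hφmin _) ?_
      rw [le_antisymm (hφle _) (le_of_koszulLinear (hgr i) hi (hφge _))]
      exact hi
  refine ⟨d, fun i => Fin (seq i).1, Finsupp.lapply () ∘ₗ ψ, fun i => φ (seq i), ?_,
    fun a => hψ a (), fun i _ a b => hφ (seq i) a b, fun h2 => ?_, fun i h3 => ?_⟩
  · rw [LinearMap.range_comp, hrange]
    ext f
    constructor
    · rintro ⟨y, hy, rfl⟩
      exact mem_idealSub.1 hy
    · exact fun hf => ⟨Finsupp.single () f, mem_idealSub.2 (by simpa using hf), by simp⟩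
  · rw [LinearMap.ker_comp_of_ker_eq_bot]
    · exact (hseq (q - 1) 0 (by omega)).2.symm
    · refine LinearMap.ker_eq_bot.2 fun x y hxy => Finsupp.ext fun u => ?_
      exact hxy
  · exact (hseq (q - 2 - i) (i + 1) (by omega)).2.symm

end Resolution

section Monomial

variable {k : Type*} [Field k] {n : ℕ}

/-- The multigraded form of `KoszulLinear` for the monomial ideal with set of exponents `B`. -/
def MonomialLinear (k : Type*) [Field k] {n : ℕ} (B : (Fin n →₀ ℕ) → Prop) (d r : ℕ) : Prop :=
  ∀ i < r, ∀ a : Fin n →₀ ℕ, a.degree ≠ i + d → ∀ c : Finset (Fin n) → k,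
    (∀ G, c G ≠ 0 → G.card = i ∧ ∃ b, B b ∧ b + indExp G = a) →
    koszulD (fun _ => (1 : k)) c = 0 →
    ∃ c' : Finset (Fin n) → k, (∀ G, c' G ≠ 0 → ∃ b, B b ∧ b + indExp G = a) ∧
      koszulD (fun _ => (1 : k)) c' = c

theorem koszulD_zero {A M : Type*} [CommRing A] [AddCommGroup M] [Module A M] (x : Fin n → A) :
    koszulD x (0 : Finset (Fin n) → M) = 0 := by
  funext G
  simp [koszulD]

theorem strand_monomial {a : Fin n →₀ ℕ} {c : Finset (Fin n) → k}
    (hc : ∀ G, c G ≠ 0 → indExp G ≤ a) (a' : Fin n →₀ ℕ) :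
    strand a' (fun G => monomial (a - indExp G) (c G)) = if a' = a then c else 0 := by
  classical
  funext G
  by_cases hG : c G = 0
  · rw [strand]
    split_ifs <;> simp [hG]
  have hle := hc G hG
  rw [strand]
  by_cases h : a' = a
  · subst h
    simp [hle]
  · rw [if_neg h, Pi.zero_apply]
    split_ifs with hle'
    · rw [coeff_monomial, if_neg]
      intro he
      apply h
      rw [← tsub_add_cancel_of_le hle, ← tsub_add_cancel_of_le hle', he]
    · rfl

variable {J : Ideal (MvPolynomial (Fin n) k)} {B : (Fin n →₀ ℕ) → Prop} {d r : ℕ}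

theorem monomialLinear_of_koszulLinear (hJ : ∀ f, f ∈ J ↔ ∀ b ∈ f.support, B b)
    (h : KoszulLinear (idealSub J) d r) : MonomialLinear k B d r := by
  intro i hi a ha c hc hcz
  by_cases h0 : c = 0
  · exact ⟨0, fun _ hG => absurd rfl hG, by rw [koszulD_zero, h0]⟩
  obtain ⟨G₀, hG₀⟩ := Function.ne_iff.1 h0
  obtain ⟨hcard, b₀, -, hb₀⟩ := hc G₀ hG₀
  have hdeg : b₀.degree + i = a.degree := by rw [← hb₀, map_add, degree_indExp, hcard]
  have hle : ∀ G, c G ≠ 0 → indExp G ≤ a := fun G hG => by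
    obtain ⟨-, b, -, hb⟩ := hc G hG
    exact hb ▸ le_add_self
  let p : Finset (Fin n) → MvPolynomial (Fin n) k := fun G => monomial (a - indExp G) (c G)
  let z : Finset (Fin n) → Unit →₀ MvPolynomial (Fin n) k := fun G => Finsupp.single () (p G)
  have hp : koszulD (X : Fin n → MvPolynomial (Fin n) k) p = 0 := by
    refine strand_ext fun a' => ?_
    rw [← koszulD_strand, strand_monomial hle]
    have h0' : strand a' (0 : Finset (Fin n) → MvPolynomial (Fin n) k) = 0 := by
      funext G
      simp [strand]
    rw [h0']
    split_ifs
    · exact hcz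
    · exact koszulD_zero _
  obtain ⟨w, hwN, hw⟩ := h i hi b₀.degree (by omega) z
    (fun G => mem_idealSub.2 <| (hJ _).2 fun b hb => by
      have hb' : b ∈ (p G).support := by simpa [z] using hb
      have hcG : c G ≠ 0 := fun h0 => by simp [p, h0] at hb'
      obtain ⟨-, b', hb'B, hb'a⟩ := hc G hcG
      rw [show b = b' by
        rw [Finset.mem_singleton.1 (support_monomial_subset hb'), ← hb'a, add_tsub_cancel_right]]
      exact hb'B)
    (fun G _ => by
      by_cases hcG : c G = 0
      · simpa [z, p, hcG] using isHomogeneous_zero _ _ _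
      · obtain ⟨hcard', b', -, hb'a⟩ := hc G hcG
        have : a - indExp G = b' := by rw [← hb'a, add_tsub_cancel_right]
        have hb'deg : b'.degree + i = a.degree := by
          rw [← hb'a, map_add, degree_indExp, hcard']
        simp only [z, p, Finsupp.single_eq_same, this]
        exact isHomogeneous_monomial _ (by omega))
    (fun G hG => by
      by_cases hcG : c G = 0
      · simp [z, p, hcG]
      · exact absurd (hc G hcG).1 hG)
    (funext fun G => by
      have := map_koszulD (X : Fin n → MvPolynomial (Fin n) k)
        (f := (Finsupp.lsingle (R := MvPolynomial (Fin n) k) ()).toAddMonoidHom)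
        (g := (Finsupp.lsingle (R := MvPolynomial (Fin n) k) ()).toAddMonoidHom)
        (fun v m => map_smul (Finsupp.lsingle (R := MvPolynomial (Fin n) k) ()) (X v) m) p G
      refine Eq.trans this.symm ?_
      rw [hp]
      simp)
  refine ⟨strand a fun G => w G (), fun G hG => ?_, ?_⟩
  · obtain ⟨b, hb, hba⟩ := exists_of_strand_ne_zero hG
    exact ⟨b, (hJ _).1 (mem_idealSub.1 (hwN G)) b hb, hba⟩
  · have hwp : koszulD (X : Fin n → MvPolynomial (Fin n) k) (fun G => w G ()) = p := by
      funext G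
      have := map_koszulD (X : Fin n → MvPolynomial (Fin n) k)
        (f := (Finsupp.lapply (R := MvPolynomial (Fin n) k) ()).toAddMonoidHom)
        (g := (Finsupp.lapply (R := MvPolynomial (Fin n) k) ()).toAddMonoidHom)
        (fun v m => map_smul (Finsupp.lapply (R := MvPolynomial (Fin n) k) ()) (X v) m) w G
      refine Eq.trans this.symm ?_
      rw [hw]
      simp [z]
    rw [koszulD_strand, hwp, strand_monomial hle, if_pos rfl]

theorem koszulLinear_of_monomialLinear (hJ : ∀ f, f ∈ J ↔ ∀ b ∈ f.support, B b)
    (h : MonomialLinear k B d r) : KoszulLinear (idealSub J) d r := by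
  intro i hi s hs z hzN hzs hzi hz
  let p : Finset (Fin n) → MvPolynomial (Fin n) k := fun G => z G ()
  have hp : koszulD (X : Fin n → MvPolynomial (Fin n) k) p = 0 := by
    funext G
    have := map_koszulD (X : Fin n → MvPolynomial (Fin n) k)
      (f := (Finsupp.lapply (R := MvPolynomial (Fin n) k) ()).toAddMonoidHom)
      (g := (Finsupp.lapply (R := MvPolynomial (Fin n) k) ()).toAddMonoidHom)
      (fun v m => map_smul (Finsupp.lapply (R := MvPolynomial (Fin n) k) ()) (X v) m) z G
    refine Eq.trans this.symm ?_
    rw [hz]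
    simp
  have hstrand : ∀ a G, strand a p G ≠ 0 →
      G.card = i ∧ a.degree = s + i ∧ ∃ b, B b ∧ b + indExp G = a := fun a G hG => by
    obtain ⟨b, hb, hba⟩ := exists_of_strand_ne_zero hG
    have hcard : G.card = i := by
      by_contra hne
      simp [p, hzi G hne] at hb
    have hbs : b.degree = s := by
      rw [Finsupp.degree_eq_weight_one]
      exact hzs G () (mem_support_iff.1 hb)
    refine ⟨hcard, ?_, b, (hJ _).1 (mem_idealSub.1 (hzN G)) b hb, hba⟩
    rw [← hba, map_add, degree_indExp, hcard, hbs]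
  obtain ⟨w, hwB, hw⟩ := exists_koszulD_eq_of_strand B p fun a => by
    by_cases h0 : strand a p = 0
    · exact ⟨0, fun _ hG => absurd rfl hG, by rw [koszulD_zero, h0]⟩
    obtain ⟨G₀, hG₀⟩ := Function.ne_iff.1 h0
    have hdeg := (hstrand a G₀ hG₀).2.1
    refine h i hi a (by omega) _ (fun G hG => ⟨(hstrand a G hG).1, (hstrand a G hG).2.2⟩) ?_
    rw [koszulD_strand, hp]
    funext G
    simp [strand]
  refine ⟨fun G => Finsupp.single () (w G), fun G => mem_idealSub.2 <| (hJ _).2 ?_,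
    funext fun G => ?_⟩
  · simpa using hwB G
  · have := map_koszulD (X : Fin n → MvPolynomial (Fin n) k)
      (f := (Finsupp.lsingle (R := MvPolynomial (Fin n) k) ()).toAddMonoidHom)
      (g := (Finsupp.lsingle (R := MvPolynomial (Fin n) k) ()).toAddMonoidHom)
      (fun v m => map_smul (Finsupp.lsingle (R := MvPolynomial (Fin n) k) ()) (X v) m) w G
    refine Eq.trans this.symm ?_
    rw [hw]
    exact Finsupp.ext fun _ => by simp [p]

theorem isGradedSub_of_monomial (hJ : ∀ f, f ∈ J ↔ ∀ b ∈ f.support, B b) :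
    IsGradedSub (idealSub J) := fun y hy s => by
  rw [mem_idealSub, hJ] at hy ⊢
  intro b hb
  refine hy b ?_
  rw [mem_support_iff] at hb ⊢
  rw [vecComponent_apply, coeff_homogeneousComponent] at hb
  exact fun h0 => hb (by simp [h0])

theorem idealLinear_iff_monomialLinear (hr : 1 ≤ r)
    (hJ : ∀ f, f ∈ J ↔ ∀ b ∈ f.support, B b) :
    IdealLinearFirstSteps k J r ↔ ∃ d, MonomialLinear k B d r :=
  ⟨fun h => (exists_koszulLinear_of_linear hr h).imp fun _ => monomialLinear_of_koszulLinear hJ,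
    fun ⟨_, h⟩ => linear_of_koszulLinear hr (isGradedSub_of_monomial hJ)
      (koszulLinear_of_monomialLinear hJ h)⟩

end Monomial

section Components

variable {k : Type*} [Field k] {n : ℕ}

theorem exists_monomialLinear_iff {B : (Fin n →₀ ℕ) → Prop} {j r : ℕ} (hr : 1 ≤ r)
    (hle : ∀ b, B b → j ≤ b.degree) (hex : ∀ b, B b → ∃ c, B c ∧ c.degree = j) :
    (∃ d, MonomialLinear k B d r) ↔ MonomialLinear k B j r := by
  refine ⟨fun ⟨d, h⟩ => ?_, fun h => ⟨j, h⟩⟩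
  by_cases hd : d = j
  · exact hd ▸ h
  have hB : ∀ b, ¬ B b := fun b hb => by
    obtain ⟨a, ha, haj⟩ := hex b hb
    obtain ⟨c', hc', hc'eq⟩ := h 0 hr a (by omega)
      (fun G => if G = ∅ then 1 else 0)
      (fun G hG => by
        have hG : G = ∅ := by simpa using hG
        subst hG
        exact ⟨Finset.card_empty, a, ha, by simp [indExp]⟩)
      (by funext G; simp [koszulD])
    have h1 : koszulD (fun _ => (1 : k)) c' ∅ ≠ 0 := by simp [hc'eq]
    obtain ⟨v, -, hv⟩ := Finset.exists_ne_zero_of_sum_ne_zero h1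
    have hv' : c' (insert v ∅) ≠ 0 := fun h0 => hv (by rw [h0, smul_zero, smul_zero])
    obtain ⟨b', hb', hb'a⟩ := hc' _ hv'
    have := congrArg Finsupp.degree hb'a
    rw [map_add, degree_indExp, Finset.card_insert_of_notMem (Finset.notMem_empty v)] at this
    have := hle b' hb'
    omega
  intro i _ a _ c hc _
  refine ⟨0, fun _ hG => absurd rfl hG, ?_⟩
  rw [koszulD_zero]
  funext G
  by_contra hG
  obtain ⟨-, b, hb, -⟩ := hc G fun h0 => hG h0.symm
  exact hB b hb

/-- Outside of the squarefree multidegrees the chains of `B'` are cones, so `MonomialLinear` only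
depends on the squarefree exponents. -/
theorem MonomialLinear.of_squarefree {B B' : (Fin n →₀ ℕ) → Prop} {d r : ℕ}
    (hBB' : ∀ b : Fin n →₀ ℕ, (∀ v, b v ≤ 1) → (B b ↔ B' b))
    (hcone : ∀ b v, B' b → 2 ≤ b v → b.degree ≠ d → B' (b - Finsupp.single v 1))
    (h : MonomialLinear k B d r) : MonomialLinear k B' d r := by
  intro i hi a ha c hc hcz
  by_cases hsq : ∀ v, a v ≤ 1
  · have hiff : ∀ G : Finset (Fin n), (∃ b, B b ∧ b + indExp G = a) ↔
        ∃ b, B' b ∧ b + indExp G = a := fun G => exists_congr fun b => and_congr_left fun hb =>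
      hBB' b fun v => (hb ▸ hsq v : (b + indExp G) v ≤ 1).trans' (by simp)
    simp only [← hiff] at hc ⊢
    exact h i hi a ha c hc hcz
  · push Not at hsq
    obtain ⟨v, hv⟩ := hsq
    refine ⟨coneChain v c, fun G hG => ?_, koszulD_coneChain v hcz⟩
    unfold coneChain at hG
    split_ifs at hG with hvG
    · have hG' : c (G.erase v) ≠ 0 := fun h0 => hG (by rw [h0, smul_zero])
      obtain ⟨hcard, b, hb, hba⟩ := hc _ hG'
      have hbv : 2 ≤ b v := by
        rw [← hba, Finsupp.add_apply, indExp_apply, if_neg (Finset.notMem_erase v G)] at hv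
        omega
      have hdeg := congrArg Finsupp.degree hba
      rw [map_add, degree_indExp, hcard] at hdeg
      refine ⟨b - Finsupp.single v 1, hcone b v hb hbv (by omega), ?_⟩
      rw [← Finset.insert_erase hvG, indExp_insert (Finset.notMem_erase v G), ← add_assoc,
        tsub_add_cancel_of_le (Finsupp.single_le_iff.2 (by omega)), hba]
    · exact absurd rfl hG

theorem indExp_le_iff {F : Finset (Fin n)} {b : Fin n →₀ ℕ} : indExp F ≤ b ↔ F ⊆ b.support := by
  refine ⟨fun h v hv => ?_, fun h v => ?_⟩
  · have := h v
    rw [indExp_apply, if_pos hv] at this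
    exact Finsupp.mem_support_iff.2 (by omega)
  · rw [indExp_apply]
    split_ifs with hv
    · exact Nat.one_le_iff_ne_zero.2 (Finsupp.mem_support_iff.1 (h hv))
    · exact Nat.zero_le _

theorem indExp_support {b : Fin n →₀ ℕ} (hb : ∀ v, b v ≤ 1) : indExp b.support = b := by
  ext v
  have := hb v
  rw [indExp_apply]
  split_ifs with h
  · have := Finsupp.mem_support_iff.1 h
    omega
  · exact (Finsupp.notMem_support_iff.1 h).symm

/-- The exponents of the degree `j` component of the squarefree monomial ideal with squarefree
monomials `P`. -/
def ComponentExponent (P : Finset (Fin n) → Prop) (j : ℕ) (b : Fin n →₀ ℕ) : Prop :=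
  ∃ c ≤ b, c.degree = j ∧ P c.support

/-- The exponents of the squarefree degree `j` component of the squarefree monomial ideal with
squarefree monomials `P`. -/
def SqfreeComponentExponent (P : Finset (Fin n) → Prop) (j : ℕ) (b : Fin n →₀ ℕ) : Prop :=
  ∃ F ⊆ b.support, F.card = j ∧ P F

theorem componentExponent_iff_sqfree {P : Finset (Fin n) → Prop} {j : ℕ} {b : Fin n →₀ ℕ}
    (hb : ∀ v, b v ≤ 1) : ComponentExponent P j b ↔ SqfreeComponentExponent P j b := by
  constructor
  · rintro ⟨c, hcb, hcj, hc⟩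
    refine ⟨c.support, Finsupp.support_mono hcb, ?_, hc⟩
    rw [← degree_indExp, indExp_support fun v => (hcb v).trans (hb v), hcj]
  · rintro ⟨F, hF, hFj, hPF⟩
    exact ⟨indExp F, indExp_le_iff.2 hF, by rw [degree_indExp, hFj], by rwa [support_indExp]⟩

theorem SqfreeComponentExponent.sub_single {P : Finset (Fin n) → Prop} {j : ℕ} {b : Fin n →₀ ℕ}
    (h : SqfreeComponentExponent P j b) {v : Fin n} (hv : 2 ≤ b v) :
    SqfreeComponentExponent P j (b - Finsupp.single v 1) := by
  obtain ⟨F, hF, hFj, hPF⟩ := h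
  refine ⟨F, fun u hu => ?_, hFj, hPF⟩
  have := Finsupp.mem_support_iff.1 (hF hu)
  rw [Finsupp.mem_support_iff, Finsupp.tsub_apply, Finsupp.single_apply]
  split_ifs with h
  · subst h
    omega
  · omega

theorem ComponentExponent.sub_single {P : Finset (Fin n) → Prop}
    (hP : ∀ F F', F ⊆ F' → P F → P F') {j : ℕ} {b : Fin n →₀ ℕ}
    (h : ComponentExponent P j b) {v : Fin n} (hv : 2 ≤ b v) (hbj : b.degree ≠ j) :
    ComponentExponent P j (b - Finsupp.single v 1) := by
  obtain ⟨c, hcb, hcj, hPc⟩ := h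
  by_cases hcv : c v < b v
  · refine ⟨c, fun u => ?_, hcj, hPc⟩
    have := hcb u
    rw [Finsupp.tsub_apply, Finsupp.single_apply]
    split_ifs with h
    · subst h
      omega
    · omega
  have hu : ∃ u, c u < b u := by
    by_contra! hu
    exact hbj (by rw [le_antisymm (fun u => hu u) hcb, hcj])
  obtain ⟨u, hu⟩ := hu
  have huv : u ≠ v := fun h => hcv (h ▸ hu)
  have hle : Finsupp.single v 1 ≤ c := Finsupp.single_le_iff.2 (by omega)
  refine ⟨c - Finsupp.single v 1 + Finsupp.single u 1, fun x => ?_, ?_, hP _ _ (fun x hx => ?_) hPc⟩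
  · have := hcb x
    simp only [Finsupp.add_apply, Finsupp.tsub_apply, Finsupp.single_apply]
    split_ifs with h h' h' <;> subst_vars <;> omega
  · have := congrArg Finsupp.degree (tsub_add_cancel_of_le hle)
    rw [map_add, Finsupp.degree_single] at this ⊢
    omega
  · have hx := Finsupp.mem_support_iff.1 hx
    rw [Finsupp.mem_support_iff]
    simp only [Finsupp.add_apply, Finsupp.tsub_apply, Finsupp.single_apply]
    split_ifs with h <;> subst_vars <;> omega

theorem mem_idealComponent_iff {I : Ideal (MvPolynomial (Fin n) k)} {P : Finset (Fin n) → Prop}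
    (hI : ∀ f, f ∈ I ↔ ∀ b ∈ f.support, P b.support) (j : ℕ) (f : MvPolynomial (Fin n) k) :
    f ∈ idealComponent k I j ↔ ∀ b ∈ f.support, ComponentExponent P j b := by
  have hspan : idealComponent k I j =
      Ideal.span ((fun c => monomial c (1 : k)) '' {c | c.degree = j ∧ P c.support}) := by
    refine le_antisymm (Ideal.span_le.2 ?_) (Ideal.span_le.2 ?_)
    · rintro f ⟨hf, hfj⟩
      refine mem_ideal_span_monomial_image.2 fun b hb => ⟨b, ⟨?_, (hI f).1 hf b hb⟩, le_rfl⟩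
      rw [Finsupp.degree_eq_weight_one]
      exact hfj (mem_support_iff.1 hb)
    · rintro _ ⟨c, ⟨hcj, hc⟩, rfl⟩
      refine Ideal.subset_span ⟨(hI _).2 fun b hb => ?_, isHomogeneous_monomial _ hcj⟩
      rwa [Finset.mem_singleton.1 (support_monomial_subset hb)]
  rw [hspan, mem_ideal_span_monomial_image]
  refine forall₂_congr fun b _ => exists_congr fun c => ?_
  simp only [Set.mem_ofPred_eq]
  tauto

theorem mem_sqfreeComponent_iff {I : Ideal (MvPolynomial (Fin n) k)} {P : Finset (Fin n) → Prop}
    (hI : ∀ f, f ∈ I ↔ ∀ b ∈ f.support, P b.support) (j : ℕ) (f : MvPolynomial (Fin n) k) :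
    f ∈ sqfreeComponent k I j ↔ ∀ b ∈ f.support, SqfreeComponentExponent P j b := by
  have hmem : ∀ F, ∏ i ∈ F, (X i : MvPolynomial (Fin n) k) ∈ I ↔ P F := fun F => by
    classical
    rw [prod_X_eq_monomial, hI, support_monomial, if_neg one_ne_zero]
    simp [support_indExp]
  have hspan : sqfreeComponent k I j =
      Ideal.span ((fun c => monomial c (1 : k)) '' (indExp '' {F | F.card = j ∧ P F})) := by
    refine congrArg Ideal.span (Set.ext fun f => ?_)
    constructor
    · rintro ⟨hf, F, hF, rfl⟩
      exact ⟨_, ⟨F, ⟨hF, (hmem F).1 hf⟩, rfl⟩, (prod_X_eq_monomial F).symm⟩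
    · rintro ⟨_, ⟨F, ⟨hF, hPF⟩, rfl⟩, rfl⟩
      simp only [← prod_X_eq_monomial]
      exact ⟨(hmem F).2 hPF, F, hF, rfl⟩
  rw [hspan, mem_ideal_span_monomial_image]
  refine forall₂_congr fun b _ => ?_
  rw [Set.exists_mem_image]
  refine exists_congr fun F => ?_
  rw [indExp_le_iff, and_comm]
  rfl

theorem mem_iff_of_eq_span_prod_X {I : Ideal (MvPolynomial (Fin n) k)} {S : Set (Finset (Fin n))}
    (hI : I = Ideal.span ((fun F : Finset (Fin n) =>
      ∏ i ∈ F, (X i : MvPolynomial (Fin n) k)) '' S)) (f : MvPolynomial (Fin n) k) :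
    f ∈ I ↔ ∀ b ∈ f.support, ∃ F ∈ S, F ⊆ b.support := by
  have hset : (fun F : Finset (Fin n) => ∏ i ∈ F, (X i : MvPolynomial (Fin n) k)) '' S =
      (fun c => monomial c (1 : k)) '' (indExp '' S) := by
    rw [Set.image_image]
    exact Set.image_congr fun F _ => prod_X_eq_monomial F
  rw [hI, hset, mem_ideal_span_monomial_image]
  refine forall₂_congr fun b _ => ?_
  rw [Set.exists_mem_image]
  simp only [indExp_le_iff]

theorem exists_monomialLinear_componentExponent_iff {P : Finset (Fin n) → Prop} {j r : ℕ}
    (hr : 1 ≤ r) (hP : ∀ F F', F ⊆ F' → P F → P F') :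
    (∃ d, MonomialLinear k (ComponentExponent P j) d r) ↔
      ∃ d, MonomialLinear k (SqfreeComponentExponent P j) d r := by
  rw [exists_monomialLinear_iff (j := j) hr
      (fun b ⟨c, hcb, hcj, _⟩ => hcj ▸ Finsupp.degree_mono hcb)
      (fun b ⟨c, _, hcj, hc⟩ => ⟨c, ⟨c, le_rfl, hcj, hc⟩, hcj⟩),
    exists_monomialLinear_iff (j := j) hr
      (fun b ⟨F, hF, hFj, _⟩ => by
        rw [← hFj, ← degree_indExp]
        exact Finsupp.degree_mono (indExp_le_iff.2 hF))
      (fun b ⟨F, _, hFj, hPF⟩ => ⟨indExp F, ⟨F, (support_indExp F).ge, hFj, hPF⟩, by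
        rw [degree_indExp, hFj]⟩)]
  exact ⟨.of_squarefree (fun b hb => componentExponent_iff_sqfree hb)
      fun b v hb hv _ => hb.sub_single hv,
    .of_squarefree (fun b hb => (componentExponent_iff_sqfree hb).symm)
      fun b v hb hv hbj => hb.sub_single hP hv hbj⟩

end Components

/-- **Componentwise linearity in the first `r` steps can be tested on squarefree
components.**  Let `I` be an ideal of `R = k[x_1, …, x_n]` generated by squarefree
monomials and `r ≥ 1` an integer.  Then `I` is componentwise linear in the first
`r` steps if and only if `I` is squarefree componentwise linear in the first `r`
steps. -/
theorem componentwiseLinear_iff_sqfreeComponentwiseLinear (k : Type*) [Field k]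
    (n r : ℕ) (I : Ideal (MvPolynomial (Fin n) k))
    (hI : ∃ S : Set (Finset (Fin n)),
      I = Ideal.span ((fun F : Finset (Fin n) =>
        ∏ i ∈ F, (X i : MvPolynomial (Fin n) k)) '' S))
    (hr : 1 ≤ r) :
    ComponentwiseLinearFirstSteps k I r ↔ SqfreeComponentwiseLinearFirstSteps k I r := by
  obtain ⟨S, hS⟩ := hI
  have hP := mem_iff_of_eq_span_prod_X hS
  refine forall_congr' fun j => ?_
  rw [idealLinear_iff_monomialLinear hr (mem_idealComponent_iff
      (P := fun F => ∃ F' ∈ S, F' ⊆ F) hP j),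
    idealLinear_iff_monomialLinear hr (mem_sqfreeComponent_iff
      (P := fun F => ∃ F' ∈ S, F' ⊆ F) hP j)]
  exact exists_monomialLinear_componentExponent_iff hr
    fun F F' hFF' ⟨G, hG, hGF⟩ => ⟨G, hG, hGF.trans hFF'⟩

end SeqSr
end
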